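/- Let K be an imaginary quadratic extension of ℚ with K ≠ ℚ(√−3). Then the naïve Mertens-type conjecture over K is false, i.e., it is NOT the case that −1 ≤ M_K^- ≤ M_K^+ ≤ 1. -/

import Mathlib

noncomputable section

open NumberField Filter Topology MeasureTheory Complex

open scoped Classical

/-- The Möbius function on integral ideals of a number field `K`. -/
def moebiusK (K : Type) [Field K] [NumberField K] (I : Ideal (𝓞 K)) : ℤ :=
  if Squarefree I then (-1) ^ (UniqueFactorizationMonoid.factors I).card else 0

/-- The Mertens function of a number field `K`: the sum of `μ_K(𝔞)` over nonzero integral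
ideals `𝔞` of norm at most `x`, where ideals of norm exactly `x` count with weight `1/2`. -/
def mertensK (K : Type) [Field K] [NumberField K] (x : ℝ) : ℝ :=
  ∑' I : Ideal (𝓞 K),
    if I ≠ ⊥ ∧ (Ideal.absNorm I : ℝ) < x then (moebiusK K I : ℝ)
    else if I ≠ ⊥ ∧ (Ideal.absNorm I : ℝ) = x then (moebiusK K I : ℝ) / 2
    else 0

/-- `M_K^- = liminf_{x → ∞} M_K(x) / x^{1/2}`, as an extended real number. -/
def MKminus (K : Type) [Field K] [NumberField K] : EReal :=
  Filter.liminf (fun x : ℝ => ((mertensK K x / Real.sqrt x : ℝ) : EReal)) Filter.atTop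

/-- `M_K^+ = limsup_{x → ∞} M_K(x) / x^{1/2}`, as an extended real number. -/
def MKplus (K : Type) [Field K] [NumberField K] : EReal :=
  Filter.limsup (fun x : ℝ => ((mertensK K x / Real.sqrt x : ℝ) : EReal)) Filter.atTop

/-- The naïve Mertens-type conjecture over `K`: `-1 ≤ M_K^- ≤ M_K^+ ≤ 1`. -/
def NaiveMertensConj (K : Type) [Field K] [NumberField K] : Prop :=
  -1 ≤ MKminus K ∧ MKminus K ≤ MKplus K ∧ MKplus K ≤ 1

/-- A predicate identifying the Dedekind zeta function of `K`: a function analytic away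
from `s = 1` agreeing with the Dirichlet series `∑ N(𝔞)^{-s}` on `Re s > 1`. -/
def IsDedekindZeta (K : Type) [Field K] [NumberField K] (Z : ℂ → ℂ) : Prop :=
  (∀ s : ℂ, s ≠ 1 → DifferentiableAt ℂ Z s) ∧
  ∀ s : ℂ, 1 < s.re →
    Z s = ∑' I : {I : Ideal (𝓞 K) // I ≠ ⊥}, (Ideal.absNorm I.1 : ℂ) ^ (-s)

/-- The Riemann hypothesis for a zeta function `Z`: all nontrivial zeros lie on `Re s = 1/2`. -/
def ZetaRH (Z : ℂ → ℂ) : Prop :=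
  ∀ ρ : ℂ, Z ρ = 0 → 0 < ρ.re → ρ.re < 1 → ρ.re = 1 / 2

/-- Simultaneous recurrence of finitely many characters of `ℝ`. -/
theorem exists_ge_norm_cexp_sub_one_lt (P : Finset ℂ) (hP : ∀ p ∈ P, p.re = 0) {ε : ℝ}
    (hε : 0 < ε) (T₀ : ℝ) : ∃ T ≥ T₀, ∀ p ∈ P, ‖1 - cexp (p * T)‖ < ε := by
  set L : ℝ := max T₀ 1
  have hL : 1 ≤ L := le_max_right _ _
  have hnorm : ∀ p ∈ P, ∀ x : ℝ, ‖cexp (p * x)‖ = 1 := by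
    intro p hp x
    rw [Complex.norm_exp]
    simp [hP p hp]
  let u : ℕ → (P → ℂ) := fun n p => cexp (p.1 * ((n * L : ℝ) : ℂ))
  have hu : ∀ n, u n ∈ Metric.closedBall (0 : P → ℂ) 1 := by
    intro n
    rw [mem_closedBall_zero_iff, pi_norm_le_iff_of_nonneg zero_le_one]
    intro p
    exact (hnorm p.1 p.2 _).le
  obtain ⟨a, -, φ, hφ, hlim⟩ := tendsto_subseq_of_bounded Metric.isBounded_closedBall hu
  have hc := hlim.cauchySeq
  rw [Metric.cauchySeq_iff] at hc
  obtain ⟨N, hN⟩ := hc ε hε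
  have hd := hN (N + 1) (by simp) N (by simp)
  have hlt : φ N + 1 ≤ φ (N + 1) := hφ (Nat.lt_succ_self N)
  refine ⟨((φ (N + 1) : ℝ) - φ N) * L, ?_, ?_⟩
  · have h1 : (1 : ℝ) ≤ (φ (N + 1) : ℝ) - φ N := by
      have : ((φ N + 1 : ℕ) : ℝ) ≤ φ (N + 1) := by exact_mod_cast hlt
      push_cast at this
      linarith
    calc T₀ ≤ L := le_max_left _ _
      _ = 1 * L := (one_mul _).symm
      _ ≤ _ := by gcongr
  · intro p hp
    have h1 : dist (u (φ (N + 1)) ⟨p, hp⟩) (u (φ N) ⟨p, hp⟩) < ε :=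
      (dist_le_pi_dist _ _ _).trans_lt hd
    have h2 : cexp (p * ((φ (N + 1) * L : ℝ) : ℂ)) =
        cexp (p * ((φ N * L : ℝ) : ℂ)) * cexp (p * (((φ (N + 1) : ℝ) - φ N) * L : ℝ)) := by
      rw [← Complex.exp_add]
      congr 1
      push_cast
      ring
    rw [dist_comm, dist_eq_norm] at h1
    simp only [u] at h1
    rw [h2] at h1
    have h3 : cexp (p * ((φ N * L : ℝ) : ℂ)) -
        cexp (p * ((φ N * L : ℝ) : ℂ)) * cexp (p * (((φ (N + 1) : ℝ) - φ N) * L : ℝ)) =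
        cexp (p * ((φ N * L : ℝ) : ℂ)) *
          (1 - cexp (p * (((φ (N + 1) : ℝ) - φ N) * L : ℝ))) := by ring
    rwa [h3, norm_mul, hnorm p hp, one_mul] at h1

/-- Maximum principle on a disc for functions with removable singularities, with the boundary
bound only off the imaginary axis. -/
theorem norm_le_of_removable {ψ : ℂ → ℂ} {X M : ℝ} (hX : 0 < X)
    (hψ : ∀ z ∈ Metric.closedBall (0 : ℂ) X, ∃ g : ℂ → ℂ, AnalyticAt ℂ g z ∧ ψ =ᶠ[𝓝[≠] z] g)
    (hM : ∀ z : ℂ, ‖z‖ = X → z.re ≠ 0 → ‖ψ z‖ ≤ M) {z : ℂ} (hz : z ∈ Metric.ball (0 : ℂ) X)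
    (hc : ContinuousAt ψ z) : ‖ψ z‖ ≤ M := by
  choose! g hga hge using hψ
  let Φ : ℂ → ℂ := fun z => g z z
  have hlim : ∀ w ∈ Metric.closedBall (0 : ℂ) X, Tendsto ψ (𝓝[≠] w) (𝓝 (Φ w)) := fun w hw =>
    Tendsto.congr' (hge w hw).symm ((hga w hw).continuousAt.tendsto.mono_left nhdsWithin_le_nhds)
  have hloc : ∀ w ∈ Metric.closedBall (0 : ℂ) X, ∀ᶠ v in 𝓝 w,
      v ∈ Metric.closedBall (0 : ℂ) X → Φ v = g w v := by
    intro w hw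
    have h1 : ∀ᶠ v in 𝓝[≠] w, ψ =ᶠ[𝓝 v] g w := by
      have := hge w hw
      rw [Filter.EventuallyEq, eventually_nhdsWithin_iff] at this
      have h2 := this.eventually_nhds
      rw [eventually_nhdsWithin_iff]
      filter_upwards [h2] with v hv hne
      filter_upwards [hv, isOpen_compl_singleton.mem_nhds hne] with x hx hx'
      exact hx hx'
    have h2 := (hga w hw).eventually_analyticAt
    rw [eventually_nhdsWithin_iff] at h1
    filter_upwards [h1, h2] with v hv hva hvm
    by_cases hvw : v = w
    · subst hvw; rfl
    · have h3 : Tendsto ψ (𝓝[≠] v) (𝓝 (g w v)) :=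
        Tendsto.congr' ((hv hvw).symm.filter_mono nhdsWithin_le_nhds)
          (hva.continuousAt.tendsto.mono_left nhdsWithin_le_nhds)
      exact tendsto_nhds_unique (hlim v hvm) h3
  have hdiff : DiffContOnCl ℂ Φ (Metric.ball (0 : ℂ) X) := by
    constructor
    · intro w hw
      have hw' := Metric.ball_subset_closedBall hw
      have : Φ =ᶠ[𝓝 w] g w := by
        filter_upwards [hloc w hw', Metric.isOpen_ball.mem_nhds hw] with v hv hv'
        exact hv (Metric.ball_subset_closedBall hv')
      exact ((hga w hw').differentiableAt.congr_of_eventuallyEq this).differentiableWithinAt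
    · rw [closure_ball _ hX.ne']
      intro w hw
      refine ContinuousWithinAt.congr_of_eventuallyEq
        (f := g w) (hga w hw).continuousAt.continuousWithinAt ?_ rfl
      rw [Filter.EventuallyEq, eventually_nhdsWithin_iff]
      exact hloc w hw
  have hbd : ∀ w ∈ frontier (Metric.ball (0 : ℂ) X), ‖Φ w‖ ≤ M := by
    intro w hw
    rw [frontier_ball _ hX.ne', mem_sphere_zero_iff_norm] at hw
    have hwc : w ∈ Metric.closedBall (0 : ℂ) X := by simp [hw]
    have hw0 : w ≠ 0 := by
      rintro rfl
      simp at hw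
      exact hX.ne hw
    have hrot : Tendsto (fun θ : ℝ => w * cexp (θ * I)) (𝓝[>] 0) (𝓝[≠] w) := by
      apply tendsto_nhdsWithin_of_tendsto_nhds_of_eventually_within
      · have : ContinuousAt (fun θ : ℝ => w * cexp (θ * I)) 0 := by fun_prop
        have h := this.tendsto
        simp only [ofReal_zero, zero_mul, Complex.exp_zero, mul_one] at h
        exact h.mono_left nhdsWithin_le_nhds
      · filter_upwards [Ioo_mem_nhdsGT (show (0 : ℝ) < 1 by norm_num)] with θ hθ heq
        simp only [Set.mem_singleton_iff, mul_eq_left₀ hw0] at heq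
        have := congrArg Complex.im heq
        rw [Complex.exp_ofReal_mul_I_im] at this
        simp only [one_im] at this
        exact (Real.sin_pos_of_pos_of_lt_pi hθ.1 (by linarith [Real.pi_gt_three, hθ.2])).ne' this
    have hre : ∀ᶠ θ : ℝ in 𝓝[>] 0, (w * cexp (θ * I)).re ≠ 0 := by
      by_cases h0 : w.re = 0
      · filter_upwards [Ioo_mem_nhdsGT (show (0 : ℝ) < 1 by norm_num)] with θ hθ
        simp only [mul_re, Complex.exp_ofReal_mul_I_re, Complex.exp_ofReal_mul_I_im, h0, zero_mul,
          zero_sub, neg_ne_zero]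
        refine mul_ne_zero (fun h => hw0 (Complex.ext h0 h)) ?_
        exact (Real.sin_pos_of_pos_of_lt_pi hθ.1 (by linarith [Real.pi_gt_three, hθ.2])).ne'
      · have h1 := (Complex.continuous_re.tendsto w).comp (hrot.mono_right nhdsWithin_le_nhds)
        exact h1.eventually_ne h0
    have h2 : Tendsto (fun θ : ℝ => ‖ψ (w * cexp (θ * I))‖) (𝓝[>] 0) (𝓝 ‖Φ w‖) :=
      ((hlim w hwc).comp hrot).norm
    refine le_of_tendsto h2 ?_
    filter_upwards [hre] with θ hθ
    refine hM _ ?_ hθ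
    rw [norm_mul, Complex.norm_exp_ofReal_mul_I, mul_one, hw]
  have hfin := Complex.norm_le_of_forall_mem_frontier_norm_le Metric.isBounded_ball hdiff hbd
    (subset_closure hz)
  have : Φ z = ψ z := tendsto_nhds_unique (hlim z (Metric.ball_subset_closedBall hz))
    (hc.tendsto.mono_left nhdsWithin_le_nhds)
  rwa [this] at hfin

/-- A meromorphic function bounded by `C / Re z` to the right of an imaginary point has at most
a simple pole there. -/
theorem exists_simple_pole {B : ℂ → ℂ} {p : ℂ} (hp : p.re = 0) (hB : MeromorphicAt B p) {C : ℝ}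
    (hC : ∀ z : ℂ, 0 < z.re → ‖B z‖ ≤ C / z.re) :
    ∃ m : ℂ, ∃ h : ℂ → ℂ, AnalyticAt ℂ h p ∧ B =ᶠ[𝓝[≠] p] fun z => m / (z - p) + h z := by
  have hmain : ∃ g : ℂ → ℂ, AnalyticAt ℂ g p ∧ (fun z => (z - p) * B z) =ᶠ[𝓝[≠] p] g := by
    have hmer : MeromorphicAt (fun z => (z - p) * B z) p := by fun_prop
    have hord : 0 ≤ meromorphicOrderAt (fun z => (z - p) * B z) p := by
      by_contra! hlt
      have h1 := tendsto_cobounded_of_meromorphicOrderAt_neg hlt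
      have hseq : Tendsto (fun t : ℝ => p + t) (𝓝[>] 0) (𝓝[≠] p) := by
        apply tendsto_nhdsWithin_of_tendsto_nhds_of_eventually_within
        · have : ContinuousAt (fun t : ℝ => p + (t : ℂ)) 0 := by fun_prop
          have h := this.tendsto
          simp only [ofReal_zero, add_zero] at h
          exact h.mono_left nhdsWithin_le_nhds
        · filter_upwards [self_mem_nhdsWithin] with t ht heq
          simp at heq
          exact (ne_of_gt ht) heq
      have h2 := (tendsto_norm_cobounded_atTop.comp h1).comp hseq
      have h3 := (h2.eventually_gt_atTop C).and self_mem_nhdsWithin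
      obtain ⟨t, ht, ht0⟩ := h3.exists
      have ht0 : 0 < t := ht0
      have h4 := hC (p + t) (by simp [hp, ht0])
      simp only [Function.comp, add_sub_cancel_left, norm_mul, add_re, hp, ofReal_re, zero_add,
        norm_real, Real.norm_eq_abs, abs_of_pos ht0] at ht h4
      rw [le_div_iff₀ ht0] at h4
      linarith [mul_comm t ‖B (p + t)‖]
    refine ⟨toMeromorphicNFAt (fun z => (z - p) * B z) p, ?_, ?_⟩
    · rw [← (meromorphicNFAt_toMeromorphicNFAt).meromorphicOrderAt_nonneg_iff_analyticAt,
        meromorphicOrderAt_congr hmer.eq_nhdsNE_toMeromorphicNFAt.symm]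
      exact hord
    · exact hmer.eq_nhdsNE_toMeromorphicNFAt
  obtain ⟨g, hg, he⟩ := hmain
  refine ⟨g p, dslope g p, ?_, ?_⟩
  · obtain ⟨q, hq⟩ := hg
    exact ⟨q.fslope, hq.has_fpower_series_dslope_fslope⟩
  · filter_upwards [he, self_mem_nhdsWithin] with z hz hne
    have hne' : z - p ≠ 0 := sub_ne_zero.mpr hne
    rw [dslope_of_ne _ hne, slope_def_field, ← hz]
    field_simp
    ring

/-- The Laplace transform of `f` on `(0, ∞)`. -/
def laplace (f : ℝ → ℝ) (z : ℂ) : ℂ := ∫ u in Set.Ioi (0 : ℝ), (f u : ℂ) * cexp (-z * u)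

section Laplace

variable {f : ℝ → ℝ} {C : ℝ}

theorem norm_mul_cexp_neg_le (hC : ∀ u, 0 ≤ u → |f u| ≤ C) (z : ℂ) {u : ℝ} (hu : 0 ≤ u) :
    ‖(f u : ℂ) * cexp (-z * u)‖ ≤ C * Real.exp (-z.re * u) := by
  rw [norm_mul, Complex.norm_exp, norm_real, Real.norm_eq_abs]
  simp only [neg_mul, neg_re, mul_re, ofReal_re, ofReal_im, mul_zero, sub_zero]
  gcongr
  exact hC u hu

theorem integrableOn_laplace (hf : Measurable f) (hC : ∀ u, 0 ≤ u → |f u| ≤ C) {z : ℂ}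
    (hz : 0 < z.re) : IntegrableOn (fun u : ℝ => (f u : ℂ) * cexp (-z * u)) (Set.Ioi 0) := by
  have h1 : IntegrableOn (fun u : ℝ => C * Real.exp (-z.re * u)) (Set.Ioi 0) :=
    (exp_neg_integrableOn_Ioi 0 hz).const_mul C
  refine Integrable.mono' h1 (by fun_prop) ?_
  filter_upwards [ae_restrict_mem measurableSet_Ioi] with u hu
  exact norm_mul_cexp_neg_le hC z (le_of_lt hu)

theorem norm_laplace_le (hC : ∀ u, 0 ≤ u → |f u| ≤ C) {z : ℂ}
    (hz : 0 < z.re) : ‖laplace f z‖ ≤ C / z.re := by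
  have h1 : IntegrableOn (fun u : ℝ => C * Real.exp (-z.re * u)) (Set.Ioi 0) :=
    (exp_neg_integrableOn_Ioi 0 hz).const_mul C
  have h2 : ∫ u in Set.Ioi (0 : ℝ), C * Real.exp (-z.re * u) = C / z.re := by
    rw [integral_const_mul, integral_exp_mul_Ioi (by linarith) 0]
    simp [div_eq_mul_inv]
  rw [← h2]
  refine norm_integral_le_of_norm_le h1 ?_
  filter_upwards [ae_restrict_mem measurableSet_Ioi] with u hu
  exact norm_mul_cexp_neg_le hC z (le_of_lt hu)

theorem differentiable_truncated_laplace (hf : Measurable f) (hC : ∀ u, 0 ≤ u → |f u| ≤ C)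
    (T : ℝ) : Differentiable ℂ
      (fun z : ℂ => ∫ u in Set.Ioc (0 : ℝ) T, (f u : ℂ) * cexp (-z * u)) := by
  intro z
  have hC0 : 0 ≤ C := (abs_nonneg _).trans (hC 0 le_rfl)
  have hb : ∀ (w : ℂ), ‖w‖ ≤ ‖z‖ + 1 → ∀ u ∈ Set.Ioc (0 : ℝ) T,
      ‖(f u : ℂ) * cexp (-w * u)‖ ≤ C * Real.exp ((‖z‖ + 1) * T) := by
    intro w hw u hu
    refine (norm_mul_cexp_neg_le hC w hu.1.le).trans ?_
    have h1 : -w.re * u ≤ (‖z‖ + 1) * T := by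
      have := (neg_le_abs w.re).trans ((Complex.abs_re_le_norm w).trans hw)
      exact (mul_le_mul_of_nonneg_right this hu.1.le).trans
        (mul_le_mul_of_nonneg_left hu.2 (by positivity))
    gcongr
  refine (hasDerivAt_integral_of_dominated_loc_of_deriv_le (μ := volume.restrict (Set.Ioc 0 T))
    (F := fun (z : ℂ) (u : ℝ) => (f u : ℂ) * cexp (-z * u))
    (F' := fun (z : ℂ) (u : ℝ) => (f u : ℂ) * cexp (-z * u) * (-u))
    (bound := fun _ => C * Real.exp ((‖z‖ + 1) * T) * T)
    (Metric.ball_mem_nhds z one_pos) ?_ ?_ ?_ ?_ ?_ ?_).2.differentiableAt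
  · exact Eventually.of_forall fun w => by fun_prop
  · refine Measure.integrableOn_of_bounded (M := C * Real.exp ((‖z‖ + 1) * T)) (by simp)
      (by fun_prop) ?_
    filter_upwards [ae_restrict_mem measurableSet_Ioc] with u hu
    exact hb z (by linarith) u hu
  · fun_prop
  · filter_upwards [ae_restrict_mem measurableSet_Ioc] with u hu w hw
    rw [norm_mul, norm_neg, norm_real, Real.norm_eq_abs, abs_of_pos hu.1]
    have hw' : ‖w‖ ≤ ‖z‖ + 1 := by
      rw [Metric.mem_ball, dist_eq_norm] at hw
      have := norm_add_le (w - z) z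
      simp only [sub_add_cancel] at this
      linarith
    exact mul_le_mul (hb w hw' u hu) hu.2 hu.1.le (by positivity)
  · exact integrable_const _
  · refine Eventually.of_forall fun u w _ => ?_
    have h1 : HasDerivAt (fun w : ℂ => -w * (u : ℂ)) (-u) w := by
      simpa using (hasDerivAt_id w).neg.mul_const (u : ℂ)
    simpa [mul_assoc] using (h1.cexp).const_mul (f u : ℂ)

theorem differentiableAt_laplace (hf : Measurable f) (hC : ∀ u, 0 ≤ u → |f u| ≤ C) {z : ℂ}
    (hz : 0 < z.re) : DifferentiableAt ℂ (laplace f) z := by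
  have hC0 : 0 ≤ C := (abs_nonneg _).trans (hC 0 le_rfl)
  set δ : ℝ := z.re / 2 with hδ
  have hδ0 : 0 < δ := by positivity
  refine (hasDerivAt_integral_of_dominated_loc_of_deriv_le (μ := volume.restrict (Set.Ioi 0))
    (F := fun (z : ℂ) (u : ℝ) => (f u : ℂ) * cexp (-z * u))
    (F' := fun (z : ℂ) (u : ℝ) => (f u : ℂ) * cexp (-z * u) * (-u))
    (bound := fun u => C * (2 / δ) * Real.exp (-(δ / 2) * u))
    (Metric.ball_mem_nhds z hδ0) ?_ ?_ ?_ ?_ ?_ ?_).2.differentiableAt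
  · exact Eventually.of_forall fun w => by fun_prop
  · exact integrableOn_laplace hf hC hz
  · fun_prop
  · filter_upwards [ae_restrict_mem measurableSet_Ioi] with u hu w hw
    have hu0 : 0 < u := hu
    rw [norm_mul, norm_neg, norm_real, Real.norm_eq_abs, abs_of_pos hu0]
    have hw' : δ ≤ w.re := by
      rw [Metric.mem_ball, dist_eq_norm] at hw
      have := (Complex.abs_re_le_norm (w - z)).trans hw.le
      rw [sub_re, abs_le] at this
      linarith [this.1]
    have h1 := norm_mul_cexp_neg_le hC w hu0.le
    have h2 : u ≤ 2 / δ * Real.exp (δ / 2 * u) := by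
      have := Real.add_one_le_exp (δ / 2 * u)
      have h3 : u = 2 / δ * (δ / 2 * u) := by field_simp
      calc u = 2 / δ * (δ / 2 * u) := h3
        _ ≤ _ := by gcongr; linarith
    have h4 : Real.exp (-w.re * u) ≤ Real.exp (-δ * u) := by gcongr
    calc _ ≤ C * Real.exp (-δ * u) * (2 / δ * Real.exp (δ / 2 * u)) := by
          gcongr
          exact h1.trans (by gcongr)
      _ = C * (2 / δ) * (Real.exp (-δ * u) * Real.exp (δ / 2 * u)) := by ring
      _ = _ := by
          rw [← Real.exp_add]
          congr 2
          ring
  · exact (exp_neg_integrableOn_Ioi 0 (by positivity)).const_mul _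
  · refine Eventually.of_forall fun u w _ => ?_
    have h1 : HasDerivAt (fun w : ℂ => -w * (u : ℂ)) (-u) w := by
      simpa using (hasDerivAt_id w).neg.mul_const (u : ℂ)
    simpa [mul_assoc] using (h1.cexp).const_mul (f u : ℂ)

theorem norm_exp_mul_truncated_laplace_le (hC : ∀ u, 0 ≤ u → |f u| ≤ C)
    {T : ℝ} (hT : 0 ≤ T) {z : ℂ} (hz : z.re < 0) :
    ‖cexp (z * T) * ∫ u in Set.Ioc (0 : ℝ) T, (f u : ℂ) * cexp (-z * u)‖ ≤ C / (-z.re) := by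
  have hC0 : 0 ≤ C := (abs_nonneg _).trans (hC 0 le_rfl)
  have h1 : ‖∫ u in Set.Ioc (0 : ℝ) T, (f u : ℂ) * cexp (-z * u)‖ ≤
      ∫ u in Set.Ioc (0 : ℝ) T, C * Real.exp (-z.re * u) := by
    refine norm_integral_le_of_norm_le ?_ ?_
    · exact (by fun_prop : Continuous fun u : ℝ => C * Real.exp (-z.re * u)).integrableOn_Ioc
    · filter_upwards [ae_restrict_mem measurableSet_Ioc] with u hu
      exact norm_mul_cexp_neg_le hC z hu.1.le
  have h2 : ∫ u in Set.Ioc (0 : ℝ) T, C * Real.exp (-z.re * u) =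
      C * ((Real.exp (-z.re * T) - 1) / (-z.re)) := by
    rw [integral_const_mul, ← intervalIntegral.integral_of_le hT,
      intervalIntegral.integral_comp_mul_left Real.exp (by linarith : (-z.re) ≠ 0), integral_exp]
    simp [div_eq_inv_mul]
  rw [h2] at h1
  rw [norm_mul, Complex.norm_exp]
  have h3 : (z * (T : ℂ)).re = z.re * T := by simp
  rw [h3]
  have hz' : 0 < -z.re := by linarith
  calc Real.exp (z.re * T) * _ ≤ Real.exp (z.re * T) *
        (C * ((Real.exp (-z.re * T) - 1) / (-z.re))) := by gcongr
    _ = C * (1 - Real.exp (z.re * T)) / (-z.re) := by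
        have : Real.exp (z.re * T) * Real.exp (-z.re * T) = 1 := by
          rw [← Real.exp_add]; simp
        linear_combination C / (-z.re) * this
    _ ≤ C / (-z.re) := by
        gcongr
        have := Real.exp_pos (z.re * T)
        nlinarith

theorem laplace_sub_shift (hf : Measurable f) (hC : ∀ u, 0 ≤ u → |f u| ≤ C) {T : ℝ} (hT : 0 ≤ T)
    {z : ℂ} (hz : 0 < z.re) :
    laplace f z * (1 - cexp (z * T)) +
      cexp (z * T) * ∫ u in Set.Ioc (0 : ℝ) T, (f u : ℂ) * cexp (-z * u) =
    laplace f z - laplace (fun u => f (u + T)) z := by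
  have h0 := integrableOn_laplace hf hC hz
  have h1 : laplace f z = (∫ u in Set.Ioc (0 : ℝ) T, (f u : ℂ) * cexp (-z * u)) +
      ∫ u in Set.Ioi T, (f u : ℂ) * cexp (-z * u) := by
    rw [laplace, ← Set.Ioc_union_Ioi_eq_Ioi hT, setIntegral_union
      (Set.Ioc_disjoint_Ioi le_rfl) measurableSet_Ioi]
    · exact h0.mono_set Set.Ioc_subset_Ioi_self
    · exact h0.mono_set (Set.Ioi_subset_Ioi hT)
  have h2 : laplace (fun u => f (u + T)) z =
      cexp (z * T) * ∫ u in Set.Ioi T, (f u : ℂ) * cexp (-z * u) := by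
    have hmp := (measurePreserving_add_right volume T).setIntegral_preimage_emb
      (measurableEmbedding_addRight T)
      (fun u : ℝ => cexp (z * T) * ((f u : ℂ) * cexp (-z * u))) (Set.Ioi T)
    rw [Set.preimage_add_const_Ioi, sub_self] at hmp
    rw [laplace, ← integral_const_mul, ← hmp]
    refine integral_congr_ae (Eventually.of_forall fun u => ?_)
    simp only [ofReal_add]
    rw [mul_left_comm, ← Complex.exp_add]
    congr 2
    ring
  rw [h2]
  linear_combination (- cexp (z * T)) * h1

end Laplace

/-- The non-analytic points of a meromorphic function in a disc form a finite set. -/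
theorem finite_not_analyticAt {B : ℂ → ℂ} (hB : ∀ z, MeromorphicAt B z) (X : ℝ) :
    {z ∈ Metric.closedBall (0 : ℂ) X | ¬ AnalyticAt ℂ B z}.Finite := by
  have h : ∀ z : ℂ, ∃ U ∈ 𝓝 z, ∀ w ∈ U, w ≠ z → AnalyticAt ℂ B w := fun z => by
    have h1 := (hB z).eventually_analyticAt
    rw [eventually_nhdsWithin_iff] at h1
    exact ⟨_, h1, fun w hw hne => hw hne⟩
  choose U hU hUa using h
  obtain ⟨t, -, ht⟩ := (isCompact_closedBall (0 : ℂ) X).elim_nhds_subcover U fun z _ => hU z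
  refine t.finite_toSet.subset ?_
  rintro z ⟨hz, hza⟩
  obtain ⟨p, hp, hzp⟩ := Set.mem_iUnion₂.1 (ht hz)
  by_contra hne
  exact hza (hUa p z hzp fun h => hne (h ▸ hp))

theorem norm_one_add_sq_div {z : ℂ} {X : ℝ} (hX : 0 < X) (hz : ‖z‖ = X) :
    ‖1 + z ^ 2 / (X : ℂ) ^ 2‖ = 2 * |z.re| / X := by
  have hX' : (X : ℂ) ≠ 0 := by exact_mod_cast hX.ne'
  have h1 : (X : ℂ) ^ 2 = z * (starRingEnd ℂ) z := by
    rw [Complex.mul_conj, Complex.normSq_eq_norm_sq, hz]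
    push_cast; rfl
  have h2 : 1 + z ^ 2 / (X : ℂ) ^ 2 = z * (2 * z.re : ℝ) / (X : ℂ) ^ 2 := by
    rw [show ((2 * z.re : ℝ) : ℂ) = (starRingEnd ℂ) z + z by
      rw [add_comm, Complex.add_conj]]
    field_simp
    rw [h1]
    ring
  rw [h2, norm_div, norm_mul, norm_real, Real.norm_eq_abs, abs_mul, norm_pow, norm_real,
    Real.norm_eq_abs, abs_of_pos hX, hz, abs_of_pos (show (0 : ℝ) < 2 by norm_num)]
  field_simp

/-- A bounded function whose Laplace transform continues to a meromorphic function with poles only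
on the imaginary axis, controlled on large circles, is almost periodic in a weak sense. -/
theorem laplace_recurrence {f : ℝ → ℝ} {C K : ℝ} {B : ℂ → ℂ} (hf : Measurable f)
    (hC : ∀ u, 0 ≤ u → |f u| ≤ C) (hB : ∀ z, MeromorphicAt B z)
    (hoff : ∀ z : ℂ, z.re ≠ 0 → ∃ g : ℂ → ℂ, AnalyticAt ℂ g z ∧ B =ᶠ[𝓝[≠] z] g)
    (hlap : ∀ z : ℂ, 0 < z.re → B z = laplace f z)
    (hcirc : ∀ n : ℕ, 1 ≤ n → ∀ z : ℂ, ‖z‖ = n → z.re < 0 → ‖B z‖ ≤ K / (-z.re))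
    {ε : ℝ} (hε : 0 < ε) (T₀ : ℝ) (J : ℕ) :
    ∃ T ≥ T₀, ∀ m : ℕ, 1 ≤ m → m ≤ J →
      ‖laplace f m - laplace (fun u => f (u + T)) m‖ ≤ ε := by
  have hC0 : 0 ≤ C := (abs_nonneg _).trans (hC 0 le_rfl)
  have hK0 : 0 ≤ K := by
    have h1 := hcirc 1 le_rfl (-1) (by simp) (by simp)
    simp only [neg_re, one_re, neg_neg, div_one] at h1
    exact (norm_nonneg _).trans h1
  set M₀ : ℝ := 2 * (2 * C + 2 * K + 1) with hM₀
  obtain ⟨n, hn⟩ := exists_nat_gt (max (J : ℝ) ((M₀ + 1) / ε))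
  have hnJ : J < n := by exact_mod_cast (le_max_left _ _).trans_lt hn
  have hnε : (M₀ + 1) / ε < n := (le_max_right _ _).trans_lt hn
  have hM₀pos : 0 < M₀ := by positivity
  have hX : (0 : ℝ) < n := lt_trans (by positivity) hnε
  have hn1 : 1 ≤ n := by exact_mod_cast hX
  have hpole : ∀ p : ℂ, ∃ m : ℂ, ∃ h : ℂ → ℂ, AnalyticAt ℂ h p ∧
      (p.re = 0 → B =ᶠ[𝓝[≠] p] fun z => m / (z - p) + h z) := by
    intro p
    by_cases hp : p.re = 0
    · obtain ⟨m, h, h1, h2⟩ := exists_simple_pole hp (hB p) (C := C) fun z hz => by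
        rw [hlap z hz]; exact norm_laplace_le hC hz
      exact ⟨m, h, h1, fun _ => h2⟩
    · exact ⟨0, 0, analyticAt_const, fun h => absurd h hp⟩
  choose μ h ha hBp using hpole
  set P : Finset ℂ := (finite_not_analyticAt hB n).toFinset.filter (fun p => p.re = 0) with hP
  have hP0 : ∀ p ∈ P, p.re = 0 := fun p hp => (Finset.mem_filter.1 hp).2
  set S : ℝ := ∑ p ∈ P, ‖μ p‖ with hS
  have hS0 : 0 ≤ S := Finset.sum_nonneg fun _ _ => norm_nonneg _
  obtain ⟨T, hT, hTP⟩ := exists_ge_norm_cexp_sub_one_lt P hP0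
    (ε := 1 / (n * (S + 1))) (by positivity) (max T₀ 0)
  have hT0 : 0 ≤ T := (le_max_right _ _).trans hT
  have hsum : ∀ (z : ℂ) (b : ℝ), 0 < b → (∀ p ∈ P, b ≤ ‖z - p‖) →
      ‖∑ p ∈ P, μ p * (1 - cexp (p * T)) / (z - p)‖ ≤ 1 / (n * b) := by
    intro z b hb hzb
    calc _ ≤ ∑ p ∈ P, ‖μ p * (1 - cexp (p * T)) / (z - p)‖ := norm_sum_le _ _
      _ ≤ ∑ p ∈ P, ‖μ p‖ * (1 / (n * (S + 1))) / b := by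
        refine Finset.sum_le_sum fun p hp => ?_
        rw [norm_div, norm_mul]
        gcongr
        · exact (hTP p hp).le
        · exact hzb p hp
      _ = S / (S + 1) * (1 / (n * b)) := by
        rw [← Finset.sum_div, ← Finset.sum_mul, ← hS]
        field_simp
      _ ≤ 1 * (1 / (n * b)) := by
        gcongr
        rw [div_le_one (by positivity)]
        linarith
      _ = _ := one_mul _
  have hre : ∀ (z p : ℂ), p ∈ P → |z.re| ≤ ‖z - p‖ := by
    intro z p hp
    have := Complex.abs_re_le_norm (z - p)
    rwa [sub_re, hP0 p hp, sub_zero] at this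
  let IT : ℂ → ℂ := fun z => ∫ u in Set.Ioc (0 : ℝ) T, (f u : ℂ) * cexp (-z * u)
  have hIT : Differentiable ℂ IT := differentiable_truncated_laplace hf hC T
  let ψ : ℂ → ℂ := fun z => (1 + z ^ 2 / ((n : ℝ) : ℂ) ^ 2) *
    (B z * (1 - cexp (z * T)) + cexp (z * T) * IT z -
      ∑ p ∈ P, μ p * (1 - cexp (p * T)) / (z - p))
  have hTexp : ∀ z : ℂ, AnalyticAt ℂ (fun z : ℂ => cexp (z * T)) z := fun z => by fun_prop
  have hITa : ∀ z : ℂ, AnalyticAt ℂ IT z := fun z => hIT.analyticAt z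
  have hrem : ∀ z ∈ Metric.closedBall (0 : ℂ) n, ∃ g : ℂ → ℂ, AnalyticAt ℂ g z ∧
      ψ =ᶠ[𝓝[≠] z] g := by
    intro z hz
    have hsumA : ∀ Q : Finset ℂ, z ∉ Q →
        AnalyticAt ℂ (fun w => ∑ p ∈ Q, μ p * (1 - cexp (p * T)) / (w - p)) z := by
      intro Q hQ
      refine Finset.analyticAt_fun_sum _ fun p hp => ?_
      have : z - p ≠ 0 := sub_ne_zero.2 fun h => hQ (h ▸ hp)
      exact AnalyticAt.div (by fun_prop) (by fun_prop) this
    have hpol : AnalyticAt ℂ (fun z : ℂ => 1 + z ^ 2 / ((n : ℝ) : ℂ) ^ 2) z := by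
      fun_prop
    by_cases hzP : z ∈ P
    · have hd : AnalyticAt ℂ (dslope (fun z : ℂ => cexp (z * T)) z) z := by
        obtain ⟨q, hq⟩ := hTexp z
        exact ⟨q.fslope, hq.has_fpower_series_dslope_fslope⟩
      have hQ := hsumA (P.erase z) (Finset.notMem_erase z P)
      refine ⟨fun w => (1 + w ^ 2 / ((n : ℝ) : ℂ) ^ 2) *
        (h z w * (1 - cexp (w * T)) - μ z * dslope (fun z : ℂ => cexp (z * T)) z w +
          cexp (w * T) * IT w - ∑ p ∈ P.erase z, μ p * (1 - cexp (p * T)) / (w - p)), ?_, ?_⟩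
      · exact hpol.mul ((((((ha z).mul (analyticAt_const.sub (hTexp z))).sub
          (analyticAt_const.mul hd)).add ((hTexp z).mul (hITa z)))).sub hQ)
      · filter_upwards [hBp z (hP0 z hzP), self_mem_nhdsWithin] with w hw hne
        have hne' : w - z ≠ 0 := sub_ne_zero.mpr hne
        simp only [ψ]
        rw [hw, dslope_of_ne _ hne, slope_def_field, ← Finset.add_sum_erase _ _ hzP]
        field_simp
        ring
    · have hg : ∃ g : ℂ → ℂ, AnalyticAt ℂ g z ∧ B =ᶠ[𝓝[≠] z] g := by
        by_cases h0 : z.re = 0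
        · refine ⟨B, ?_, EventuallyEq.rfl⟩
          by_contra hna
          exact hzP (Finset.mem_filter.2 ⟨(Set.Finite.mem_toFinset _).2 ⟨hz, hna⟩, h0⟩)
        · exact hoff z h0
      obtain ⟨g, hga, hge⟩ := hg
      refine ⟨fun w => (1 + w ^ 2 / ((n : ℝ) : ℂ) ^ 2) *
        (g w * (1 - cexp (w * T)) + cexp (w * T) * IT w -
          ∑ p ∈ P, μ p * (1 - cexp (p * T)) / (w - p)), ?_, ?_⟩
      · exact hpol.mul (((hga.mul (analyticAt_const.sub (hTexp z))).add
          ((hTexp z).mul (hITa z))).sub (hsumA P hzP))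
      · filter_upwards [hge] with w hw
        simp only [ψ, hw]
  have hright : ∀ z : ℂ, 0 < z.re → B z * (1 - cexp (z * T)) + cexp (z * T) * IT z =
      laplace f z - laplace (fun u => f (u + T)) z := by
    intro z hz
    rw [hlap z hz]
    exact laplace_sub_shift hf hC hT0 hz
  have hCT : ∀ u, 0 ≤ u → |f (u + T)| ≤ C := fun u hu => hC _ (by linarith)
  have hbdy : ∀ z : ℂ, ‖z‖ = n → z.re ≠ 0 → ‖ψ z‖ ≤ M₀ / n := by
    intro z hz hz0
    have hpos : 0 < |z.re| := abs_pos.2 hz0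
    have hs := hsum z |z.re| hpos fun p hp => hre z p hp
    have hs' : 1 / (n * |z.re|) ≤ 1 / |z.re| := by
      gcongr
      have : (1 : ℝ) ≤ n := by exact_mod_cast hn1
      nlinarith
    have hmain : ‖B z * (1 - cexp (z * T)) + cexp (z * T) * IT z‖ ≤
        (2 * C + 2 * K) / |z.re| := by
      rcases lt_or_gt_of_ne hz0 with hneg | hpos'
      · rw [abs_of_neg hneg]
        have h1 := hcirc n hn1 z hz hneg
        have h2 := norm_exp_mul_truncated_laplace_le hC hT0 hneg
        have hneg' : 0 < -z.re := by linarith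
        have h3 : ‖1 - cexp (z * T)‖ ≤ 2 := by
          refine (norm_sub_le _ _).trans ?_
          rw [norm_one, Complex.norm_exp]
          have : Real.exp (z * T).re ≤ 1 := by
            rw [Real.exp_le_one_iff]
            simp only [mul_re, ofReal_re, ofReal_im, mul_zero, sub_zero]
            exact mul_nonpos_of_nonpos_of_nonneg hneg.le hT0
          linarith
        refine (norm_add_le _ _).trans ?_
        rw [norm_mul]
        have h4 : ‖B z‖ * ‖1 - cexp (z * T)‖ ≤ K / (-z.re) * 2 := by gcongr
        have h5 : C / (-z.re) ≤ 2 * C / (-z.re) := by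
          gcongr
          linarith
        calc _ ≤ K / (-z.re) * 2 + C / (-z.re) := add_le_add h4 h2
          _ ≤ K / (-z.re) * 2 + 2 * C / (-z.re) := by gcongr
          _ = _ := by ring
      · rw [hright z hpos', abs_of_pos hpos']
        refine (norm_sub_le _ _).trans ?_
        have h1 := norm_laplace_le hC hpos'
        have h2 := norm_laplace_le hCT hpos'
        have h5 : 0 ≤ 2 * K / z.re := by positivity
        calc _ ≤ C / z.re + C / z.re := add_le_add h1 h2
          _ ≤ C / z.re + C / z.re + 2 * K / z.re := by linarith
          _ = _ := by ring
    simp only [ψ]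
    rw [norm_mul, norm_one_add_sq_div hX hz]
    calc _ ≤ 2 * |z.re| / n * ((2 * C + 2 * K) / |z.re| + 1 / |z.re|) := by
          gcongr
          exact (norm_sub_le _ _).trans (add_le_add hmain (hs.trans hs'))
      _ = M₀ / n := by
          rw [hM₀]
          field_simp
  refine ⟨T, (le_max_left _ _).trans hT, fun m hm1 hmJ => ?_⟩
  have hmn : (m : ℝ) < n := by exact_mod_cast hmJ.trans_lt hnJ
  have hmre : (0 : ℝ) < (m : ℂ).re := by simpa using (show 0 < m from hm1)
  have hcont : ContinuousAt ψ (m : ℂ) := by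
    have h1 : AnalyticAt ℂ (fun w => ∑ p ∈ P, μ p * (1 - cexp (p * T)) / (w - p)) (m : ℂ) := by
      refine Finset.analyticAt_fun_sum _ fun p hp => ?_
      have : (m : ℂ) - p ≠ 0 := sub_ne_zero.2 fun h => by
        rw [h, hP0 p hp] at hmre
        exact lt_irrefl _ hmre
      exact AnalyticAt.div (by fun_prop) (by fun_prop) this
    have h2 : ContinuousAt B (m : ℂ) := by
      refine (differentiableAt_laplace hf hC hmre).continuousAt.congr ?_
      filter_upwards [(isOpen_lt continuous_const Complex.continuous_re).mem_nhds hmre] with w hw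
      exact (hlap w hw).symm
    have h3 := h1.continuousAt
    have h4 := (hIT m).continuousAt
    simp only [ψ]
    fun_prop
  have hfin := norm_le_of_removable hX hrem hbdy (z := (m : ℂ)) (by simpa using hmn) hcont
  simp only [ψ] at hfin
  rw [hright m hmre, norm_mul] at hfin
  have hsm := hsum m 1 one_pos fun p hp => by
    have h1 := hre m p hp
    simp only [natCast_re, Nat.abs_cast] at h1
    have : (1 : ℝ) ≤ m := by exact_mod_cast hm1
    linarith
  have hfac : 1 ≤ ‖1 + (m : ℂ) ^ 2 / ((n : ℝ) : ℂ) ^ 2‖ := by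
    have : 1 + (m : ℂ) ^ 2 / ((n : ℝ) : ℂ) ^ 2 = ((1 + (m : ℝ) ^ 2 / (n : ℝ) ^ 2 : ℝ) : ℂ) := by
      push_cast; rfl
    rw [this, norm_real, Real.norm_eq_abs, abs_of_nonneg (by positivity)]
    have : 0 ≤ (m : ℝ) ^ 2 / (n : ℝ) ^ 2 := by positivity
    linarith
  have hq : ‖laplace f m - laplace (fun u => f (u + T)) m -
      ∑ p ∈ P, μ p * (1 - cexp (p * T)) / ((m : ℂ) - p)‖ ≤ M₀ / n := by
    refine le_trans ?_ hfin
    exact le_mul_of_one_le_left (norm_nonneg _) hfac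
  have htri := norm_sub_norm_le (laplace f m - laplace (fun u => f (u + T)) m)
    (∑ p ∈ P, μ p * (1 - cexp (p * T)) / ((m : ℂ) - p))
  rw [div_lt_iff₀ hε] at hnε
  have hlast : (M₀ + 1) / n ≤ ε := by
    rw [div_le_iff₀ hX]
    linarith
  rw [mul_one] at hsm
  have : (M₀ + 1) / n = M₀ / n + 1 / n := by ring
  linarith

/-- Smallness of finitely many integer Laplace moments controls continuous test functions. -/
theorem abs_integral_test_le {ψ : ℝ → ℝ} (hψ : Continuous ψ) {C : ℝ} (hC0 : 0 ≤ C) {δ : ℝ}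
    (hδ : 0 < δ) : ∃ J : ℕ, ∃ ε > 0, ∀ g : ℝ → ℝ, Measurable g → (∀ u, 0 ≤ u → |g u| ≤ C) →
      (∀ m : ℕ, 1 ≤ m → m ≤ J → ‖laplace g m‖ ≤ ε) →
      |∫ u in Set.Ioi (0 : ℝ), g u * (Real.exp (-u) * ψ (Real.exp (-u)))| ≤ δ := by
  obtain ⟨p, hp⟩ := exists_polynomial_near_of_continuousOn 0 1 ψ hψ.continuousOn
    (δ / (2 * (C + 1))) (by positivity)
  set S : ℝ := ∑ i ∈ Finset.range (p.natDegree + 1), |p.coeff i| with hS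
  have hS0 : 0 ≤ S := Finset.sum_nonneg fun _ _ => abs_nonneg _
  refine ⟨p.natDegree + 1, δ / (2 * (S + 1)), by positivity, fun g hg hgC hgm => ?_⟩
  have hreal : ∀ m : ℕ, 1 ≤ m → IntegrableOn (fun u => g u * Real.exp (-(m : ℝ) * u)) (Set.Ioi 0) ∧
      laplace g m = ((∫ u in Set.Ioi (0 : ℝ), g u * Real.exp (-(m : ℝ) * u) : ℝ) : ℂ) := by
    intro m hm
    have hm' : (0 : ℝ) < (m : ℂ).re := by simpa using (show 0 < m from hm)
    have h1 := integrableOn_laplace hg hgC hm'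
    have h2 : (fun u : ℝ => (g u : ℂ) * cexp (-(m : ℂ) * u)) =
        fun u : ℝ => ((g u * Real.exp (-(m : ℝ) * u) : ℝ) : ℂ) := by
      funext u; push_cast; rfl
    refine ⟨?_, ?_⟩
    · rw [h2] at h1
      exact h1.re
    · rw [laplace, h2]
      exact integral_ofReal
  have hpoly : ∀ u, g u * (Real.exp (-u) * p.eval (Real.exp (-u))) =
      ∑ i ∈ Finset.range (p.natDegree + 1), p.coeff i *
          (g u * Real.exp (-((i + 1 : ℕ) : ℝ) * u)) := by
    intro u
    rw [Polynomial.eval_eq_sum_range, Finset.mul_sum, Finset.mul_sum]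
    refine Finset.sum_congr rfl fun i _ => ?_
    have : Real.exp (-((i + 1 : ℕ) : ℝ) * u) = Real.exp (-u) * Real.exp (-u) ^ i := by
      rw [← Real.exp_nat_mul, ← Real.exp_add]
      congr 1
      push_cast
      ring
    rw [this]
    ring
  have hint1 : IntegrableOn (fun u => g u * (Real.exp (-u) * p.eval (Real.exp (-u))))
      (Set.Ioi 0) := by
    simp_rw [hpoly]
    exact integrable_finsetSum _ fun i _ => ((hreal (i + 1) (by lia)).1).const_mul _
  have hb : ∀ u ∈ Set.Ioi (0 : ℝ), |g u * (Real.exp (-u) *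
      (ψ (Real.exp (-u)) - p.eval (Real.exp (-u))))| ≤ δ / 2 * Real.exp (-u) := by
    intro u hu
    have hu0 : 0 < u := hu
    have h1 := hp (Real.exp (-u)) ⟨(Real.exp_pos _).le, by simpa using hu0.le⟩
    rw [abs_sub_comm] at h1
    rw [abs_mul, abs_mul, abs_of_pos (Real.exp_pos _)]
    calc _ ≤ C * (Real.exp (-u) * (δ / (2 * (C + 1)))) := by
          gcongr
          exact hgC u hu0.le
      _ = C / (C + 1) * (δ / 2 * Real.exp (-u)) := by field_simp
      _ ≤ 1 * (δ / 2 * Real.exp (-u)) := by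
          gcongr
          rw [div_le_one (by positivity)]
          linarith
      _ = _ := one_mul _
  have hexp : IntegrableOn (fun u : ℝ => δ / 2 * Real.exp (-u)) (Set.Ioi 0) := by
    have := exp_neg_integrableOn_Ioi 0 one_pos
    simp only [neg_mul, one_mul] at this
    exact this.const_mul (δ / 2)
  have hmeas : Measurable fun u => g u * (Real.exp (-u) *
      (ψ (Real.exp (-u)) - p.eval (Real.exp (-u)))) := by
    have : Continuous fun u : ℝ => Real.exp (-u) *
      (ψ (Real.exp (-u)) - p.eval (Real.exp (-u))) := by fun_prop
    exact hg.mul this.measurable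
  have hint2 : IntegrableOn (fun u => g u * (Real.exp (-u) *
      (ψ (Real.exp (-u)) - p.eval (Real.exp (-u))))) (Set.Ioi 0) := by
    refine Integrable.mono' hexp hmeas.aestronglyMeasurable ?_
    filter_upwards [ae_restrict_mem measurableSet_Ioi] with u hu
    exact hb u hu
  have hsplit : ∫ u in Set.Ioi (0 : ℝ), g u * (Real.exp (-u) * ψ (Real.exp (-u))) =
      (∫ u in Set.Ioi (0 : ℝ), g u * (Real.exp (-u) * p.eval (Real.exp (-u)))) +
      ∫ u in Set.Ioi (0 : ℝ), g u * (Real.exp (-u) *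
      (ψ (Real.exp (-u)) - p.eval (Real.exp (-u)))) := by
    rw [← integral_add hint1 hint2]
    congr 1
    funext u
    ring
  have hpart1 : |∫ u in Set.Ioi (0 : ℝ), g u * (Real.exp (-u) * p.eval (Real.exp (-u)))| ≤
      δ / 2 := by
    simp_rw [hpoly]
    rw [integral_finsetSum _ fun i _ => ((hreal (i + 1) (by lia)).1).const_mul _]
    refine (Finset.abs_sum_le_sum_abs _ _).trans ?_
    calc _ ≤ ∑ i ∈ Finset.range (p.natDegree + 1), |p.coeff i| * (δ / (2 * (S + 1))) := by
          refine Finset.sum_le_sum fun i hi => ?_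
          rw [integral_const_mul, abs_mul]
          gcongr
          have h1 := hgm (i + 1) (by lia) (by have := Finset.mem_range.1 hi; lia)
          rw [(hreal (i + 1) (by lia)).2, norm_real] at h1
          exact h1
      _ = S / (S + 1) * (δ / 2) := by
          rw [← Finset.sum_mul, ← hS]
          field_simp
      _ ≤ 1 * (δ / 2) := by
          gcongr
          rw [div_le_one (by positivity)]
          linarith
      _ = _ := one_mul _
  have hpart2 : |∫ u in Set.Ioi (0 : ℝ), g u * (Real.exp (-u) *
      (ψ (Real.exp (-u)) - p.eval (Real.exp (-u))))| ≤ δ / 2 := by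
    have h1 : ∫ u in Set.Ioi (0 : ℝ), δ / 2 * Real.exp (-u) = δ / 2 := by
      rw [integral_const_mul, integral_exp_neg_Ioi_zero, mul_one]
    rw [← Real.norm_eq_abs]
    conv_rhs => rw [← h1]
    refine norm_integral_le_of_norm_le hexp ?_
    filter_upwards [ae_restrict_mem measurableSet_Ioi] with u hu
    exact hb u hu
  rw [hsplit]
  exact (abs_add_le _ _).trans (by linarith)

/-- If `f` is right-continuous at `u₀ ≥ 0`, weakly almost periodic in the sense of
`laplace_recurrence`, and `limsup f ≤ 1`, then `f u₀ ≤ 1`. -/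
theorem le_one_of_recurrence {f : ℝ → ℝ} {C : ℝ} (hf : Measurable f)
    (hC : ∀ u, 0 ≤ u → |f u| ≤ C)
    (hrec : ∀ ε > 0, ∀ T₀ : ℝ, ∀ J : ℕ, ∃ T ≥ T₀, ∀ m : ℕ, 1 ≤ m → m ≤ J →
      ‖laplace f m - laplace (fun u => f (u + T)) m‖ ≤ ε)
    (hlim : ∀ ε > 0, ∀ᶠ u in atTop, f u ≤ 1 + ε) {u₀ : ℝ} (hu₀ : 0 ≤ u₀)
    (hcont : ContinuousWithinAt f (Set.Ici u₀) u₀) : f u₀ ≤ 1 := by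
  by_contra! hgt
  set η : ℝ := (f u₀ - 1) / 3 with hη
  have hη0 : 0 < η := by rw [hη]; linarith
  have hC0 : 0 ≤ C := (abs_nonneg _).trans (hC 0 le_rfl)
  have h1 : ∀ᶠ u in 𝓝[≥] u₀, 1 + 2 * η < f u :=
    hcont.eventually_const_lt (by rw [hη]; linarith)
  obtain ⟨v, hv, hvs⟩ := mem_nhdsGE_iff_exists_Ico_subset.1 h1
  obtain ⟨U, hU⟩ := eventually_atTop.1 (hlim η hη0)
  have hv : u₀ < v := hv
  have hI : Real.exp (-v) < Real.exp (-u₀) := by gcongr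
  set x₁ := Real.exp (-v)
  set x₂ := Real.exp (-u₀)
  let ψ : ℝ → ℝ := fun x => max 0 ((x - x₁) * (x₂ - x))
  have hψ : Continuous ψ := by fun_prop
  let w : ℝ → ℝ := fun u => Real.exp (-u) * ψ (Real.exp (-u))
  have hw : Continuous w := by fun_prop
  have hw0 : ∀ u, 0 ≤ w u := fun u => mul_nonneg (Real.exp_pos _).le (le_max_left _ _)
  have hwsupp : ∀ u, u ∉ Set.Ioo u₀ v → w u = 0 := by
    intro u hu
    have : (Real.exp (-u) - x₁) * (x₂ - Real.exp (-u)) ≤ 0 := by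
      rw [Set.mem_Ioo, not_and_or, not_lt, not_lt] at hu
      rcases hu with h | h
      · have a1 : x₂ ≤ Real.exp (-u) := by simp only [x₂]; gcongr
        nlinarith
      · have a1 : Real.exp (-u) ≤ x₁ := by simp only [x₁]; gcongr
        nlinarith
    simp only [w, ψ, max_eq_left this, mul_zero]
  have hwpos : ∀ u ∈ Set.Ioo u₀ v, 0 < w u := by
    intro u hu
    refine mul_pos (Real.exp_pos _) (lt_max_of_lt_right (mul_pos ?_ ?_))
    · simp only [x₁, sub_pos]; gcongr; exact hu.2
    · simp only [x₂, sub_pos]; gcongr; exact hu.1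
  have hwc : HasCompactSupport w :=
    HasCompactSupport.intro (isCompact_Icc (a := u₀) (b := v)) fun u hu =>
      hwsupp u fun h => hu (Set.Ioo_subset_Icc_self h)
  have hwint := hw.integrable_of_hasCompactSupport (μ := volume) hwc
  have hIpos : 0 < ∫ u in Set.Ioi (0 : ℝ), w u := by
    have hall : ∫ u in Set.Ioi (0 : ℝ), w u = ∫ u, w u :=
      setIntegral_eq_integral_of_forall_compl_eq_zero
        (fun u hu => hwsupp u fun h => hu (hu₀.trans_lt h.1))
    rw [hall]
    have hmid : (u₀ + v) / 2 ∈ Set.Ioo u₀ v := ⟨by linarith, by linarith⟩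
    exact hw.integral_pos_of_hasCompactSupport_nonneg_nonzero hwc hw0 (hwpos _ hmid).ne'
  set I := ∫ u in Set.Ioi (0 : ℝ), w u
  obtain ⟨J, ε, hε, hJ⟩ := abs_integral_test_le hψ (C := 2 * C) (by positivity)
    (δ := η * I / 2) (by positivity)
  obtain ⟨T, hT, hTm⟩ := hrec ε hε (max U 0) J
  have hT0 : 0 ≤ T := (le_max_right _ _).trans hT
  have hTU : U ≤ T := (le_max_left _ _).trans hT
  have hCT : ∀ u, 0 ≤ u → |f (u + T)| ≤ C := fun u hu => hC _ (by linarith)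
  have hfT : Measurable fun u => f (u + T) := by fun_prop
  have hgC : ∀ u, 0 ≤ u → |f u - f (u + T)| ≤ 2 * C := fun u hu =>
    (abs_sub _ _).trans (by linarith [hC u hu, hCT u hu])
  have hgm : Measurable fun u => f u - f (u + T) := hf.sub hfT
  have hbound := hJ (fun u => f u - f (u + T)) hgm hgC fun m hm hmJ => by
    have hm' : (0 : ℝ) < (m : ℂ).re := by simpa using (show 0 < m from hm)
    have h2 : laplace (fun u => f u - f (u + T)) m =
        laplace f m - laplace (fun u => f (u + T)) m := by
      rw [laplace, laplace, laplace, ← integral_sub (integrableOn_laplace hf hC hm')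
        (integrableOn_laplace hfT hCT hm')]
      congr 1
      funext u
      push_cast
      ring
    rw [h2]
    exact hTm m hm hmJ
  have hge : η * I ≤ ∫ u in Set.Ioi (0 : ℝ), (f u - f (u + T)) * w u := by
    rw [← integral_const_mul]
    refine setIntegral_mono_on (hwint.integrableOn.const_mul _) ?_ measurableSet_Ioi ?_
    · refine Integrable.mono' (hwint.integrableOn.const_mul (2 * C))
        (hgm.mul hw.measurable).aestronglyMeasurable ?_
      filter_upwards [ae_restrict_mem measurableSet_Ioi] with u hu
      rw [Real.norm_eq_abs, abs_mul, abs_of_nonneg (hw0 u)]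
      exact mul_le_mul_of_nonneg_right (hgC u (le_of_lt hu)) (hw0 u)
    · intro u hu
      by_cases hus : u ∈ Set.Ioo u₀ v
      · have h3 : 1 + 2 * η < f u := hvs ⟨hus.1.le, hus.2⟩
        have h4 : f (u + T) ≤ 1 + η := hU _ (by have : (0 : ℝ) < u := hu; linarith)
        exact mul_le_mul_of_nonneg_right (by linarith) (hw0 u)
      · rw [hwsupp u hus, mul_zero, mul_zero]
  have := (le_abs_self _).trans hbound
  have hηI : 0 < η * I := mul_pos hη0 hIpos
  linarith

theorem norm_betaIntegral_le {u v : ℂ} (hu : 0 < u.re) (hv : 0 < v.re) :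
    ‖betaIntegral u v‖ ≤ (betaIntegral u.re v.re).re := by
  have hle : (0 : ℝ) ≤ 1 := zero_le_one
  have heq : ∀ x ∈ Set.Ioo (0 : ℝ) 1, ∀ a b : ℂ, ‖(x : ℂ) ^ (a - 1) * (1 - (x : ℂ)) ^ (b - 1)‖ =
      ((x : ℂ) ^ ((a.re : ℂ) - 1) * (1 - (x : ℂ)) ^ ((b.re : ℂ) - 1)).re := by
    intro x hx a b
    have h1 : (1 - (x : ℂ)) = ((1 - x : ℝ) : ℂ) := by push_cast; rfl
    have h2 : (0 : ℝ) < 1 - x := by linarith [hx.2]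
    have h3 : ((x : ℂ) ^ ((a.re : ℂ) - 1) * (1 - (x : ℂ)) ^ ((b.re : ℂ) - 1)) =
        ((x ^ (a.re - 1) * (1 - x) ^ (b.re - 1) : ℝ) : ℂ) := by
      rw [h1]
      push_cast [ofReal_cpow hx.1.le, ofReal_cpow h2.le]
      rfl
    rw [h3, ofReal_re, norm_mul, norm_cpow_eq_rpow_re_of_pos hx.1, h1,
      norm_cpow_eq_rpow_re_of_pos h2]
    simp
  have hinteg := betaIntegral_convergent (u := (u.re : ℂ)) (v := (v.re : ℂ)) (by simpa) (by simpa)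
  rw [intervalIntegrable_iff_integrableOn_Ioo_of_le hle] at hinteg
  rw [betaIntegral, betaIntegral, intervalIntegral.integral_of_le hle,
    intervalIntegral.integral_of_le hle, integral_Ioc_eq_integral_Ioo,
    integral_Ioc_eq_integral_Ioo]
  have h5 := integral_re (𝕜 := ℂ) hinteg
  simp only [RCLike.re_to_complex] at h5
  rw [← h5]
  refine norm_integral_le_of_norm_le hinteg.re ?_
  filter_upwards [ae_restrict_mem measurableSet_Ioo] with x hx
  exact (heq x hx u v).le

/-- Comparison of Gamma quotients on a vertical line with their value on the real axis. -/
theorem norm_Gamma_div_Gamma_le {s : ℂ} (h1 : -1 < s.re) (h2 : s.re < 1 / 2) :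
    ‖Gamma (s + 1) / Gamma (2 - s)‖ ≤ Real.Gamma (s.re + 1) / Real.Gamma (2 - s.re) := by
  have hu : 0 < (s + 1).re := by simp; linarith
  have hv : 0 < ((1 - 2 * s.re : ℝ) : ℂ).re := by simp; linarith
  have hb := Gamma_mul_Gamma_eq_betaIntegral hu hv
  have hb' := Gamma_mul_Gamma_eq_betaIntegral (s := ((s + 1).re : ℂ)) (by simpa using hu) hv
  have hle := norm_betaIntegral_le hu hv
  have hsum : s + 1 + ((1 - 2 * s.re : ℝ) : ℂ) = (starRingEnd ℂ) (2 - s) := by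
    apply Complex.ext
    · simp
      ring
    · simp
  have hsum' : ((s + 1).re : ℂ) + ((1 - 2 * s.re : ℝ) : ℂ) = ((2 - s.re : ℝ) : ℂ) := by
    push_cast; simp; ring
  rw [hsum, Gamma_conj] at hb
  rw [hsum'] at hb'
  have e1 : (((1 - 2 * s.re : ℝ) : ℂ).re : ℂ) = ((1 - 2 * s.re : ℝ) : ℂ) := by rw [ofReal_re]
  rw [e1] at hle
  set V : ℝ := Real.Gamma (1 - 2 * s.re)
  have hV : 0 < V := Real.Gamma_pos_of_pos (by linarith)
  have hW : 0 < Real.Gamma (2 - s.re) := Real.Gamma_pos_of_pos (by linarith)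
  have hG : Gamma (2 - s) ≠ 0 := Gamma_ne_zero_of_re_pos (by simp; linarith)
  rw [Gamma_ofReal] at hb hb'
  rw [Gamma_ofReal, Gamma_ofReal] at hb'
  have hb'' : Real.Gamma (s.re + 1) * V = Real.Gamma (2 - s.re) *
      (betaIntegral ((s + 1).re : ℂ) ((1 - 2 * s.re : ℝ) : ℂ)).re := by
    have := congrArg Complex.re hb'
    rw [re_ofReal_mul, re_ofReal_mul, ofReal_re] at this
    simpa using this
  have hbn : ‖Gamma (s + 1)‖ * V = ‖Gamma (2 - s)‖ *
      ‖betaIntegral (s + 1) ((1 - 2 * s.re : ℝ) : ℂ)‖ := by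
    have := congrArg norm hb
    rw [norm_mul, norm_mul, norm_conj, norm_real, Real.norm_of_nonneg hV.le] at this
    exact this
  rw [norm_div, div_le_div_iff₀ (norm_pos_iff.2 hG) hW]
  refine le_of_mul_le_mul_right ?_ hV
  calc ‖Gamma (s + 1)‖ * Real.Gamma (2 - s.re) * V
      = ‖Gamma (2 - s)‖ * Real.Gamma (2 - s.re) *
        ‖betaIntegral (s + 1) ((1 - 2 * s.re : ℝ) : ℂ)‖ := by
        rw [mul_right_comm, hbn]; ring
    _ ≤ ‖Gamma (2 - s)‖ * Real.Gamma (2 - s.re) *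
        (betaIntegral ((s + 1).re : ℂ) ((1 - 2 * s.re : ℝ) : ℂ)).re := by gcongr
    _ = ‖Gamma (2 - s)‖ * (Real.Gamma (s.re + 1) * V) := by rw [hb'']; ring
    _ = _ := by ring

theorem exists_norm_Gamma_ratio_le : ∃ C : ℝ, ∀ s : ℂ, -1 / 2 ≤ s.re → s.re < 1 / 2 →
    1 / 2 ≤ ‖s‖ → ‖Gamma s / Gamma (1 - s)‖ ≤ C := by
  have hc : ContinuousOn (fun x : ℝ => Real.Gamma (x + 1) / Real.Gamma (2 - x))
      (Set.Icc (-1 / 2) (1 / 2)) := by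
    intro x hx
    refine ContinuousAt.continuousWithinAt ?_
    have h1 : ContinuousAt Real.Gamma (x + 1) :=
      (Real.differentiableAt_Gamma fun m => by
        have : (0 : ℝ) ≤ m := m.cast_nonneg
        linarith [hx.1]).continuousAt
    have h2 : ContinuousAt Real.Gamma (2 - x) :=
      (Real.differentiableAt_Gamma fun m => by
        have : (0 : ℝ) ≤ m := m.cast_nonneg
        linarith [hx.2]).continuousAt
    refine ContinuousAt.div ?_ ?_ (Real.Gamma_pos_of_pos (by linarith [hx.2])).ne'
    · exact ContinuousAt.comp (f := fun x : ℝ => x + 1) h1 (by fun_prop)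
    · exact ContinuousAt.comp (f := fun x : ℝ => 2 - x) h2 (by fun_prop)
  obtain ⟨C, hC⟩ := isCompact_Icc.exists_bound_of_continuousOn hc
  refine ⟨3 * C, fun s h1 h2 h3 => ?_⟩
  have hs0 : s ≠ 0 := by rintro rfl; norm_num at h3
  have hs1 : 1 - s ≠ 0 := by
    intro h
    have := congrArg re h
    simp at this
    linarith
  have e1 := Gamma_add_one s hs0
  have e2 := Gamma_add_one (1 - s) hs1
  rw [show 1 - s + 1 = 2 - s by ring] at e2
  have hG1 : Gamma (1 - s) ≠ 0 := Gamma_ne_zero_of_re_pos (by simp; linarith)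
  have heq : Gamma s / Gamma (1 - s) = (1 - s) / s * (Gamma (s + 1) / Gamma (2 - s)) := by
    rw [e1, e2]
    field_simp
  rw [heq, norm_mul]
  have hq : ‖(1 - s) / s‖ ≤ 3 := by
    rw [norm_div, div_le_iff₀ (by linarith)]
    have := norm_sub_le 1 s
    rw [norm_one] at this
    linarith
  refine mul_le_mul hq ((norm_Gamma_div_Gamma_le (by linarith) h2).trans ?_) (norm_nonneg _)
    (by norm_num)
  exact (le_abs_self _).trans (hC s.re ⟨h1, h2.le⟩)

theorem norm_Gamma_ratio_shift_le {C : ℝ} (hC : ∀ s : ℂ, -1 / 2 ≤ s.re → s.re < 1 / 2 →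
    1 / 2 ≤ ‖s‖ → ‖Gamma s / Gamma (1 - s)‖ ≤ C) (j : ℕ) : ∀ s : ℂ, -1 / 2 - (j : ℝ) ≤ s.re →
    s.re < 1 / 2 - j → 1 / 2 ≤ ‖s + j‖ →
    ‖Gamma s / Gamma (1 - s)‖ ≤ C * (4 ^ j / (j.factorial : ℝ) ^ 2) := by
  induction j with
  | zero =>
    intro s h1 h2 h3
    simpa using hC s (by simpa using h1) (by simpa using h2) (by simpa using h3)
  | succ j ih =>
    intro s h1 h2 h3
    push_cast at h1 h2 h3
    have h4 := ih (s + 1) (by simp; linarith) (by simp; linarith)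
      (by rwa [show s + 1 + (j : ℂ) = s + (j + 1) by ring])
    have hj : (0 : ℝ) ≤ j := j.cast_nonneg
    have hs : ((j : ℝ) + 1) / 2 ≤ ‖s‖ := by
      refine le_trans ?_ (Complex.abs_re_le_norm s)
      rw [abs_of_nonpos (by linarith)]
      linarith
    have hs0 : s ≠ 0 := by rintro rfl; rw [norm_zero] at hs; linarith
    have e1 := Gamma_add_one s hs0
    have e2 := Gamma_add_one (-s) (neg_ne_zero.2 hs0)
    have e3 : Gamma s / Gamma (1 - s) = -(Gamma (s + 1) / Gamma (1 - (s + 1))) / s ^ 2 := by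
      rw [show 1 - (s + 1) = -s by ring, show 1 - s = -s + 1 by ring, e1, e2]
      field_simp
    rw [e3, norm_div, norm_neg, norm_pow, div_le_iff₀ (by positivity)]
    refine h4.trans ?_
    have hC0 : 0 ≤ C * (4 ^ j / (j.factorial : ℝ) ^ 2) := (norm_nonneg _).trans h4
    calc C * (4 ^ j / (j.factorial : ℝ) ^ 2)
        = C * (4 ^ j / (j.factorial : ℝ) ^ 2) * (4 / (j + 1) ^ 2) * (((j : ℝ) + 1) / 2) ^ 2 := by
          field_simp
          norm_num
      _ ≤ C * (4 ^ j / (j.factorial : ℝ) ^ 2) * (4 / (j + 1) ^ 2) * ‖s‖ ^ 2 := by gcongr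
      _ = _ := by
          rw [Nat.factorial_succ, pow_succ]
          push_cast
          field_simp
          ring

theorem exists_rpow_mul_norm_Gamma_ratio_le {D : ℝ} (hD : 0 < D) : ∃ C : ℝ, ∀ s : ℂ, s.re < 1 / 2 →
    (∀ k : ℕ, 1 / 2 ≤ ‖s + k‖) → D ^ (2 * s.re - 1) * ‖Gamma s / Gamma (1 - s)‖ ≤ C := by
  obtain ⟨C, hC⟩ := exists_norm_Gamma_ratio_le
  have hC0 : 0 ≤ C := (norm_nonneg _).trans (hC (1 / 4 + I) (by norm_num) (by norm_num) (by
    refine le_trans ?_ (Complex.abs_im_le_norm _)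
    norm_num))
  refine ⟨(1 + D ^ (-2 : ℝ)) * (C * Real.exp (4 / D ^ 2)), fun s hs hk => ?_⟩
  set j : ℕ := ⌈-1 / 2 - s.re⌉₊
  have h1 : -1 / 2 - (j : ℝ) ≤ s.re := by
    have h : -1 / 2 - s.re ≤ (j : ℝ) := Nat.le_ceil _
    linarith
  have h2 : s.re < 1 / 2 - j := by
    by_cases h : -1 / 2 - s.re < 0
    · have : j = 0 := Nat.ceil_eq_zero.2 h.le
      rw [this]; simpa using hs
    · have h' : (j : ℝ) < -1 / 2 - s.re + 1 := Nat.ceil_lt_add_one (not_lt.1 h)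
      linarith
  have h3 := norm_Gamma_ratio_shift_le hC j s h1 h2 (hk j)
  have h4 : D ^ (2 * s.re - 1) ≤ (1 + D ^ (-2 : ℝ)) * (1 / D ^ 2) ^ j := by
    have e : D ^ (2 * s.re - 1) = D ^ (2 * (s.re + j) - 1) * (1 / D ^ 2) ^ j := by
      rw [one_div, inv_pow, ← pow_mul, ← Real.rpow_natCast, ← Real.rpow_neg hD.le,
        ← Real.rpow_add hD]
      congr 1
      push_cast
      ring
    rw [e]
    refine mul_le_mul_of_nonneg_right ?_ (by positivity)
    rcases le_total 1 D with h | h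
    · have := Real.rpow_le_rpow_of_exponent_le h (show 2 * (s.re + j) - 1 ≤ 0 by linarith)
      rw [Real.rpow_zero] at this
      linarith [Real.rpow_pos_of_pos hD (-2)]
    · have := Real.rpow_le_rpow_of_exponent_ge hD h (show -2 ≤ 2 * (s.re + j) - 1 by linarith)
      linarith
  calc D ^ (2 * s.re - 1) * ‖Gamma s / Gamma (1 - s)‖
      ≤ ((1 + D ^ (-2 : ℝ)) * (1 / D ^ 2) ^ j) * (C * (4 ^ j / (j.factorial : ℝ) ^ 2)) := by
        gcongr
    _ = (1 + D ^ (-2 : ℝ)) * (C * ((4 / D ^ 2) ^ j / (j.factorial : ℝ))) / j.factorial := by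
        rw [div_pow, div_pow]
        field_simp
        simp
    _ ≤ (1 + D ^ (-2 : ℝ)) * (C * ((4 / D ^ 2) ^ j / (j.factorial : ℝ))) := by
        refine div_le_self (by positivity) ?_
        exact_mod_cast Nat.one_le_iff_ne_zero.2 j.factorial_ne_zero
    _ ≤ _ := by
        gcongr
        exact Real.pow_div_factorial_le_exp _ (by positivity) j

/-- The meromorphic function with simple poles at `-k` of residue `b k`. -/
def polarSum (b : ℕ → ℝ) (s : ℂ) : ℂ := ∑' k : ℕ, (b k : ℂ) / (s + k)

/-- The exponential sum with Laplace transform `polarSum b (z + 1 / 2)`. -/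
def expSum (b : ℕ → ℝ) (u : ℝ) : ℝ := ∑' k : ℕ, b k * Real.exp (-(k + 1 / 2) * max u 0)

section Polar

variable {b : ℕ → ℝ}

theorem exists_half_le_norm_add (s₀ : ℂ) : ∃ K : ℕ, ∀ k : ℕ, k ≠ K → 1 / 2 ≤ ‖s₀ + k‖ := by
  refine ⟨⌊1 / 2 - s₀.re⌋₊, fun k hk => le_trans ?_ (Complex.abs_re_le_norm _)⟩
  rw [add_re, natCast_re, le_abs]
  rcases lt_or_gt_of_ne hk with h | h
  · right
    have h1 : ((k + 1 : ℕ) : ℝ) ≤ 1 / 2 - s₀.re := (Nat.le_floor_iff' (by lia)).1 h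
    push_cast at h1
    linarith
  · left
    have h1 := (Nat.floor_lt' (by lia)).1 h
    linarith

theorem polarSum_eventuallyEq (hb : Summable fun k => |b k|) (s₀ : ℂ) : ∃ K : ℕ, ∃ G : ℂ → ℂ,
    AnalyticAt ℂ G s₀ ∧ (∀ k : ℕ, k ≠ K → s₀ + k ≠ 0) ∧
      polarSum b =ᶠ[𝓝 s₀] fun s => b K / (s + K) + G s := by
  obtain ⟨K, hK⟩ := exists_half_le_norm_add s₀
  have hbd : ∀ k : ℕ, ∀ s ∈ Metric.ball s₀ (1 / 4),
      ‖if k = K then 0 else (b k : ℂ) / (s + k)‖ ≤ 4 * |b k| := by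
    intro k s hs
    split_ifs with h
    · rw [norm_zero]; positivity
    · have h1 := hK k h
      have h2 : ‖s - s₀‖ < 1 / 4 := by simpa [dist_eq_norm] using hs
      have h3 : 1 / 4 ≤ ‖s + k‖ := by
        have := norm_sub_norm_le (s₀ + k) (s₀ - s)
        rw [show s₀ + k - (s₀ - s) = s + k by ring, norm_sub_rev s₀ s] at this
        linarith
      rw [norm_div, norm_real, Real.norm_eq_abs, div_le_iff₀ (by linarith)]
      nlinarith [abs_nonneg (b k)]
  have hdiff : DifferentiableOn ℂ (fun s => ∑' k : ℕ, if k = K then 0 else (b k : ℂ) / (s + k))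
      (Metric.ball s₀ (1 / 4)) := by
    refine differentiableOn_tsum_of_summable_norm (hb.mul_left 4) (fun k => ?_)
      Metric.isOpen_ball hbd
    by_cases h : k = K
    · simp [h]
    · simp only [h, if_false]
      intro s hs
      refine DifferentiableAt.differentiableWithinAt ?_
      have h2 : ‖s - s₀‖ < 1 / 4 := by simpa [dist_eq_norm] using hs
      have h3 : s + k ≠ 0 := by
        intro h0
        have h1 := hK k h
        rw [show s₀ + (k : ℂ) = -(s - s₀) by linear_combination h0, norm_neg] at h1
        linarith
      fun_prop (disch := assumption)
  refine ⟨K, _, hdiff.analyticAt (Metric.ball_mem_nhds _ (by norm_num)), fun k hk h0 => ?_, ?_⟩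
  · have := hK k hk
    rw [h0, norm_zero] at this
    linarith
  · filter_upwards [Metric.ball_mem_nhds s₀ (show (0 : ℝ) < 1 / 4 by norm_num)] with s hs
    have hsum : Summable fun k : ℕ => (b k : ℂ) / (s + k) := by
      refine (summable_congr_cofinite ?_).2 (Summable.of_norm_bounded (hb.mul_left 4)
        fun k => hbd k s hs)
      filter_upwards [(Set.finite_singleton K).compl_mem_cofinite] with k hk
      exact (if_neg hk).symm
    exact hsum.tsum_eq_add_tsum_ite K

theorem norm_polarSum_le (hb : Summable fun k : ℕ => (2 * k + 2) * |b k|) {n : ℕ} (hn : 1 ≤ n)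
    {s : ℂ} (hs : ‖s - 1 / 2‖ = n) :
    ‖polarSum b s‖ ≤ (∑' k : ℕ, (2 * k + 2) * |b k|) / n := by
  have hn' : (1 : ℝ) ≤ n := by exact_mod_cast hn
  rw [← tsum_div_const]
  refine tsum_of_norm_bounded (hb.div_const _).hasSum fun k => ?_
  have hk0 : (0 : ℝ) ≤ k := k.cast_nonneg
  have h0 : ‖((k : ℂ) + 1 / 2)‖ = (k : ℝ) + 1 / 2 := by
    have : ((k : ℂ) + 1 / 2) = (((k : ℝ) + 1 / 2 : ℝ) : ℂ) := by push_cast; rfl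
    rw [this, norm_real, Real.norm_of_nonneg (by positivity)]
  have h1 : 1 / 2 ≤ ‖s + k‖ := by
    have h2 : |(n : ℝ) - (k + 1 / 2)| ≤ ‖s + k‖ := by
      have := abs_norm_sub_norm_le (s - 1 / 2) (-((k : ℂ) + 1 / 2))
      rw [norm_neg, h0, hs, show s - 1 / 2 - -((k : ℂ) + 1 / 2) = s + k by ring] at this
      exact this
    refine le_trans ?_ h2
    rw [le_abs]
    rcases lt_or_ge k n with h | h
    · left
      have : ((k + 1 : ℕ) : ℝ) ≤ n := by exact_mod_cast h
      push_cast at this; linarith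
    · right
      have : (n : ℝ) ≤ k := by exact_mod_cast h
      linarith
  have h3 : (n : ℝ) ≤ ‖s + k‖ * (2 * k + 2) := by
    have := norm_sub_le (s + k) ((k : ℂ) + 1 / 2)
    rw [h0, show s + k - ((k : ℂ) + 1 / 2) = s - 1 / 2 by ring, hs] at this
    nlinarith
  rw [norm_div, norm_real, Real.norm_eq_abs, div_le_div_iff₀ (by linarith) (by linarith)]
  nlinarith [abs_nonneg (b k)]

theorem summable_abs_of_weighted (hb : Summable fun k : ℕ => (2 * k + 2) * |b k|) :
    Summable fun k => |b k| :=
  Summable.of_nonneg_of_le (fun _ => abs_nonneg _) (fun k => by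
    have hk0 : (0 : ℝ) ≤ k := k.cast_nonneg
    nlinarith [abs_nonneg (b k)]) hb

theorem continuous_expSum (hb : Summable fun k => |b k|) : Continuous (expSum b) := by
  refine continuous_tsum (fun k => by fun_prop) hb fun k u => ?_
  rw [norm_mul, Real.norm_eq_abs, Real.norm_of_nonneg (Real.exp_pos _).le]
  refine mul_le_of_le_one_right (abs_nonneg _) (Real.exp_le_one_iff.2 ?_)
  have : 0 ≤ ((k : ℝ) + 1 / 2) * max u 0 := by positivity
  linarith

theorem abs_expSum_le (hb : Summable fun k => |b k|) {u : ℝ} (hu : 0 ≤ u) :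
    |expSum b u| ≤ Real.exp (-u / 2) * ∑' k, |b k| := by
  rw [← tsum_mul_left, ← Real.norm_eq_abs]
  refine tsum_of_norm_bounded (hb.mul_left _).hasSum fun k => ?_
  rw [norm_mul, Real.norm_eq_abs, Real.norm_of_nonneg (Real.exp_pos _).le, mul_comm, max_eq_left hu]
  gcongr
  have : 0 ≤ (k : ℝ) * u := by positivity
  linarith

theorem laplace_expSum (hb : Summable fun k => |b k|) {z : ℂ} (hz : 0 < z.re) :
    laplace (expSum b) z = polarSum b (z + 1 / 2) := by
  let F : ℕ → ℝ → ℂ := fun k u => b k * cexp (-(z + 1 / 2 + k) * u)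
  have hre : ∀ k : ℕ, (-(z + 1 / 2 + k)).re < 0 := by
    intro k
    have hk0 : (0 : ℝ) ≤ k := k.cast_nonneg
    simp
    norm_num
    linarith
  have hinteg : ∀ k, Integrable (F k) (volume.restrict (Set.Ioi 0)) := fun k =>
    (integrableOn_exp_mul_complex_Ioi (hre k) 0).const_mul _
  have hval : ∀ k, ∫ u in Set.Ioi (0 : ℝ), F k u = b k / (z + 1 / 2 + k) := by
    intro k
    rw [integral_const_mul, integral_exp_mul_complex_Ioi (hre k) 0]
    have hne : z + 1 / 2 + (k : ℂ) ≠ 0 := fun h => by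
      have := hre k
      rw [h, neg_zero, zero_re] at this
      exact lt_irrefl _ this
    simp only [ofReal_zero, mul_zero, Complex.exp_zero, neg_div_neg_eq]
    rw [mul_one_div]
  have hnorm : ∀ k, ∫ u in Set.Ioi (0 : ℝ), ‖F k u‖ ≤ 2 * |b k| := by
    intro k
    have hk0 : (0 : ℝ) ≤ k := k.cast_nonneg
    have h1 : ∀ u : ℝ, ‖F k u‖ = |b k| * Real.exp ((-(z + 1 / 2 + k)).re * u) := fun u => by
      rw [norm_mul, norm_real, Real.norm_eq_abs, Complex.norm_exp]
      simp
    simp_rw [h1]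
    rw [integral_const_mul, integral_exp_mul_Ioi (hre k) 0, mul_zero, Real.exp_zero, mul_comm 2]
    refine mul_le_mul_of_nonneg_left ?_ (abs_nonneg _)
    have h2 : (-(z + 1 / 2 + k)).re ≤ -(1 / 2) := by
      simp
      linarith
    rw [div_le_iff_of_neg (hre k)]
    linarith
  have hs := hasSum_integral_of_summable_integral_norm hinteg
    (Summable.of_nonneg_of_le (fun k => integral_nonneg fun _ => norm_nonneg _) hnorm
      (hb.mul_left 2))
  rw [polarSum, ← tsum_congr hval, hs.tsum_eq, laplace]
  refine setIntegral_congr_fun measurableSet_Ioi fun u hu => ?_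
  have hu0 : (0 : ℝ) < u := hu
  simp only [F, expSum, max_eq_left hu0.le]
  rw [ofReal_tsum, ← tsum_mul_right]
  refine tsum_congr fun k => ?_
  push_cast
  rw [mul_assoc, ← Complex.exp_add]
  congr 2
  ring

end Polar

/-- The theta series `r + ∑ a(n) exp (-n t / D)`. -/
def thetaSum (a : ℕ → ℝ) (D r t : ℝ) : ℝ := r + ∑' n : ℕ, a n * Real.exp (-(n / D) * t)

/-- Coefficients `a` of a zeta function and `c` of its inverse, whose theta series satisfies a
modular transformation law of weight one. -/
structure ZetaPair (a c : ℕ → ℝ) (D r : ℝ) : Prop where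
  D_pos : 0 < D
  r_pos : 0 < r
  a_zero : a 0 = 0
  a_one : a 1 = 1
  nonneg : ∀ n, 0 ≤ a n
  abs_le : ∀ n, |c n| ≤ a n
  summable : ∀ s : ℝ, 1 < s → Summable fun n : ℕ => a n / (n : ℝ) ^ s
  mul : ∀ s : ℂ, 1 < s.re →
    LSeries (fun n => (a n : ℂ)) s * LSeries (fun n => (c n : ℂ)) s = 1
  theta : ∀ t : ℝ, 0 < t → thetaSum a D r (1 / t) = t * thetaSum a D r t

namespace ZetaPair

variable {a c : ℕ → ℝ} {D r : ℝ}

theorem summable_exp (h : ZetaPair a c D r) {x : ℝ} (hx : 0 < x) :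
    Summable fun n : ℕ => a n * Real.exp (-(n / D) * x) := by
  have hD := h.D_pos
  have h2 := (h.summable 2 (by norm_num)).mul_left (2 * (D / x) ^ 2)
  refine Summable.of_nonneg_of_le (fun n => mul_nonneg (h.nonneg n) (Real.exp_pos _).le)
    (fun n => ?_) h2
  rcases Nat.eq_zero_or_pos n with rfl | hn
  · simp [h.a_zero]
  have hn' : (0 : ℝ) < n := by exact_mod_cast hn
  have hy : 0 < (n : ℝ) / D * x := by positivity
  have h3 := Real.pow_div_factorial_le_exp _ hy.le 2
  have h4 : Real.exp (-(n / D) * x) ≤ 2 / ((n : ℝ) / D * x) ^ 2 := by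
    rw [neg_mul, Real.exp_neg, inv_le_comm₀ (Real.exp_pos _) (by positivity), inv_div]
    simpa using h3
  calc a n * Real.exp (-(n / D) * x) ≤ a n * (2 / ((n : ℝ) / D * x) ^ 2) :=
        mul_le_mul_of_nonneg_left h4 (h.nonneg n)
    _ = _ := by
        rw [show ((n : ℝ) ^ (2 : ℝ)) = (n : ℝ) ^ 2 by norm_cast]
        field_simp

theorem continuousOn_thetaSum (h : ZetaPair a c D r) :
    ContinuousOn (thetaSum a D r) (Set.Ioi 0) := by
  intro t ht
  have ht : 0 < t := ht
  refine ContinuousAt.continuousWithinAt ?_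
  have hU : Set.Ioi (t / 2) ∈ 𝓝 t := Ioi_mem_nhds (by linarith)
  refine ContinuousOn.continuousAt (s := Set.Ioi (t / 2)) ?_ hU
  refine continuousOn_const.add (continuousOn_tsum (fun n => by fun_prop)
    (h.summable_exp (half_pos ht)) fun n x hx => ?_)
  have hx : t / 2 < x := hx
  rw [Real.norm_of_nonneg (mul_nonneg (h.nonneg n) (Real.exp_pos _).le)]
  refine mul_le_mul_of_nonneg_left (Real.exp_le_exp.2 ?_) (h.nonneg n)
  have : 0 ≤ (n : ℝ) / D := div_nonneg n.cast_nonneg h.D_pos.le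
  nlinarith

theorem abs_thetaSum_sub_le (h : ZetaPair a c D r) : ∃ C : ℝ, ∀ t : ℝ, 1 ≤ t →
    |thetaSum a D r t - r| ≤ C * Real.exp (-(1 / D) * t) := by
  have hD := h.D_pos
  refine ⟨Real.exp (1 / D) * ∑' n : ℕ, a n * Real.exp (-(n / D) * 1), fun t ht => ?_⟩
  rw [thetaSum, add_sub_cancel_left, ← Real.norm_eq_abs, mul_right_comm, ← tsum_mul_left]
  refine tsum_of_norm_bounded ((h.summable_exp one_pos).mul_left _).hasSum fun n => ?_
  rw [Real.norm_of_nonneg (mul_nonneg (h.nonneg n) (Real.exp_pos _).le), mul_left_comm]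
  rcases Nat.eq_zero_or_pos n with rfl | hn
  · simp [h.a_zero]
  refine mul_le_mul_of_nonneg_left ?_ (h.nonneg n)
  rw [← Real.exp_add, ← Real.exp_add, Real.exp_le_exp]
  have hn' : (1 : ℝ) ≤ n := by exact_mod_cast hn
  have : 0 ≤ ((n : ℝ) - 1) * (t - 1) := mul_nonneg (by linarith) (by linarith)
  have h5 : 1 / D + -(1 / D) * t + -(↑n / D) * 1 - -(↑n / D) * t = ((n : ℝ) - 1) * (t - 1) / D := by
    field_simp
    ring
  have : 0 ≤ ((n : ℝ) - 1) * (t - 1) / D := by positivity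
  linarith

/-- The Mellin transform data attached to a zeta pair. -/
def fePair (h : ZetaPair a c D r) : WeakFEPair ℂ :=
  have hinteg : LocallyIntegrableOn (fun t : ℝ => (thetaSum a D r t : ℂ)) (Set.Ioi 0) :=
    (continuous_ofReal.comp_continuousOn h.continuousOn_thetaSum).locallyIntegrableOn
      measurableSet_Ioi
  have htop (ρ : ℝ) : (fun t : ℝ => (thetaSum a D r t : ℂ) - r) =O[atTop] fun t : ℝ => t ^ ρ := by
    obtain ⟨C, hC⟩ := h.abs_thetaSum_sub_le
    refine Asymptotics.IsBigO.trans (g := fun t : ℝ => Real.exp (-(1 / D) * t)) ?_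
      (isLittleO_exp_neg_mul_rpow_atTop (one_div_pos.2 h.D_pos) ρ).isBigO
    refine Asymptotics.IsBigO.of_bound C ?_
    filter_upwards [eventually_ge_atTop 1] with t ht
    rw [← ofReal_sub, norm_real, Real.norm_eq_abs, Real.norm_of_nonneg (Real.exp_pos _).le]
    exact hC t ht
  { f := fun t => thetaSum a D r t
    g := fun t => thetaSum a D r t
    k := 1
    ε := 1
    f₀ := r
    g₀ := r
    hf_int := hinteg
    hg_int := hinteg
    hk := one_pos
    hε := one_ne_zero
    h_feq := fun x hx => by
      rw [h.theta x hx]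
      simp
    hf_top := htop
    hg_top := htop }

theorem lseriesSummable_c (h : ZetaPair a c D r) {s : ℂ} (hs : 1 < s.re) :
    LSeriesSummable (fun n => (c n : ℂ)) s := by
  refine Summable.of_norm_bounded (h.summable s.re hs) fun n => ?_
  rw [LSeries.norm_term_eq]
  split_ifs with hn
  · exact div_nonneg (h.nonneg n) (by positivity)
  · rw [norm_real, Real.norm_eq_abs]
    exact div_le_div_of_nonneg_right (h.abs_le n) (by positivity)

theorem mellin_fePair (h : ZetaPair a c D r) {s : ℂ} (hs : 1 < s.re) :
    h.fePair.Λ s = (D : ℂ) ^ s * Gamma s * LSeries (fun n => (a n : ℂ)) s := by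
  have hD := h.D_pos
  have hD' : (D : ℂ) ≠ 0 := by exact_mod_cast hD.ne'
  have h1 := (h.fePair.hasMellin (s := s) hs).2
  rw [← h1]
  have h2 := hasSum_mellin (a := fun n : ℕ => (a n : ℂ)) (p := fun n : ℕ => (n : ℝ) / D)
    (F := fun t => (thetaSum a D r t : ℂ) - r) (s := s) (fun n => ?_) (by linarith)
        (fun t ht => ?_) ?_
  · change mellin (fun t => (thetaSum a D r t : ℂ) - r) s = _
    rw [← h2.tsum_eq, LSeries, ← tsum_mul_left]
    refine tsum_congr fun n => ?_
    rcases Nat.eq_zero_or_pos n with rfl | hn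
    · simp [h.a_zero]
    rw [LSeries.term_of_ne_zero hn.ne', ofReal_div, div_eq_mul_inv (Gamma s * (a n : ℂ)),
      ofReal_natCast, ← ofReal_natCast, ← ofReal_div, div_eq_mul_inv, ofReal_mul,
      mul_cpow_ofReal_nonneg n.cast_nonneg (by positivity), ofReal_inv, inv_cpow _ _ (by
        rw [arg_ofReal_of_nonneg hD.le]; exact Real.pi_pos.ne)]
    field_simp
  · rcases Nat.eq_zero_or_pos n with rfl | hn
    · left; simp [h.a_zero]
    · right; positivity
  · rw [thetaSum]
    have := (h.summable_exp ht).hasSum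
    have h3 := Complex.hasSum_ofReal.2 this
    rw [← ofReal_sub, add_sub_cancel_left]
    convert h3 using 2 with n
    push_cast
    rfl
  · have := (h.summable s.re hs).mul_left (D ^ s.re)
    refine this.congr fun n => ?_
    rw [norm_real, Real.norm_of_nonneg (h.nonneg n), Real.div_rpow n.cast_nonneg hD.le]
    field_simp

/-- The completed zeta function, with its poles cancelled. -/
theorem exists_entire (h : ZetaPair a c D r) : ∃ E : ℂ → ℂ, Differentiable ℂ E ∧
    (∀ s, E (1 - s) = E s) ∧ E 0 = r ∧ ∀ s, 1 < s.re →
      E s = s * (s - 1) * ((D : ℂ) ^ s * Gamma s * LSeries (fun n => (a n : ℂ)) s) := by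
  have hsymm : h.fePair.symm = h.fePair := by
    simp only [WeakFEPair.symm, fePair, inv_one]
  refine ⟨fun s => s * (s - 1) * h.fePair.Λ₀ s + r, ?_, fun s => ?_, by simp, fun s hs => ?_⟩
  · have := h.fePair.differentiable_Λ₀
    fun_prop
  · have h1 := h.fePair.functional_equation₀ s
    rw [hsymm] at h1
    have h2 : h.fePair.Λ₀ (1 - s) = h.fePair.Λ₀ s := by simpa [fePair] using h1
    simp only
    rw [h2]
    ring
  · have hs0 : s ≠ 0 := by rintro rfl; norm_num at hs
    have hs1 : s - 1 ≠ 0 := by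
      intro h0
      have := congrArg re h0
      simp at this
      linarith
    have hs2 : 1 - s ≠ 0 := by
      rw [← neg_sub]; exact neg_ne_zero.2 hs1
    have h0 : h.fePair.Λ₀ s = h.fePair.Λ s + 1 / s * r + 1 / (1 - s) * r := by
      have := h.fePair.Λ₀_eq s
      simpa [fePair] using this
    simp only
    rw [h0, h.mellin_fePair hs]
    field_simp
    ring

end ZetaPair

theorem analyticAt_Gamma_of_ne {s : ℂ} (hs : ∀ m : ℕ, s ≠ -m) : AnalyticAt ℂ Gamma s := by
  have h1 : AnalyticAt ℂ (fun s => (Gamma s)⁻¹) s := differentiable_one_div_Gamma.analyticAt s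
  have h2 : (fun s => (Gamma s)⁻¹)⁻¹ = Gamma := by
    funext s
    simp
  exact h2 ▸ h1.inv (inv_ne_zero (Gamma_ne_zero hs))

/-- Local form of the Gamma function at its poles. -/
theorem exists_Gamma_eq_div (k : ℕ) : ∃ P : ℂ → ℂ, AnalyticAt ℂ P (-k) ∧
    P (-k) = (-1) ^ k / (k.factorial : ℂ) ∧ ∀ᶠ s in 𝓝[≠] (-k : ℂ), Gamma s = P s / (s + k) := by
  induction k with
  | zero =>
    refine ⟨fun s => Gamma (s + 1), ?_, by simp, ?_⟩
    · have h1 : AnalyticAt ℂ Gamma (-((0 : ℕ) : ℂ) + 1) := analyticAt_Gamma_of_ne fun m h => by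
        have := congrArg re h
        simp at this
        have hm : (0 : ℝ) ≤ m := m.cast_nonneg
        linarith
      exact h1.comp (f := fun s : ℂ => s + 1) (by fun_prop)
    · filter_upwards [self_mem_nhdsWithin] with s hs
      have hs0 : s ≠ 0 := by simpa using hs
      rw [Gamma_add_one s hs0]
      simp [hs0]
  | succ k ih =>
    obtain ⟨P, hP, hPv, hPe⟩ := ih
    have hk1 : (-((k + 1 : ℕ) : ℂ)) ≠ 0 := neg_ne_zero.2 (by exact_mod_cast k.succ_ne_zero)
    have hsh : -((k + 1 : ℕ) : ℂ) + 1 = -k := by push_cast; ring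
    refine ⟨fun s => P (s + 1) / s, ?_, ?_, ?_⟩
    · have h1 : AnalyticAt ℂ (fun s => P (s + 1)) (-((k + 1 : ℕ) : ℂ)) := by
        rw [← hsh] at hP
        exact hP.comp (f := fun s : ℂ => s + 1) (by fun_prop)
      exact h1.div analyticAt_id hk1
    · simp only
      rw [hsh, hPv, Nat.factorial_succ, pow_succ]
      have : ((k : ℂ) + 1) ≠ 0 := by exact_mod_cast k.succ_ne_zero
      push_cast
      field_simp
    · have ht : Tendsto (fun s : ℂ => s + 1) (𝓝[≠] (-((k + 1 : ℕ) : ℂ))) (𝓝[≠] (-k : ℂ)) := by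
        refine tendsto_nhdsWithin_iff.2 ⟨?_, ?_⟩
        · rw [← hsh]
          exact (by fun_prop : Continuous fun s : ℂ => s + 1).continuousAt.tendsto.mono_left
            nhdsWithin_le_nhds
        · filter_upwards [self_mem_nhdsWithin] with s hs h
          apply hs
          rw [Set.mem_singleton_iff] at h ⊢
          push_cast
          linear_combination h
      filter_upwards [ht.eventually hPe, nhdsWithin_le_nhds (isOpen_ne.mem_nhds hk1)] with s hs hs0
      rw [Gamma_add_one s hs0] at hs
      push_cast
      rw [div_div, mul_comm s, ← div_div, show s + (k + 1 : ℂ) = s + 1 + k by ring, ← hs,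
        mul_div_cancel_left₀ _ hs0]

/-- Subtracting the polar part of a function with a simple pole leaves an analytic function. -/
theorem exists_analyticAt_sub_polar {H : ℂ → ℂ} {p : ℂ} (hH : AnalyticAt ℂ H p) :
    ∃ g : ℂ → ℂ, AnalyticAt ℂ g p ∧ ∀ᶠ s in 𝓝[≠] p, H s / (s - p) - H p / (s - p) = g s := by
  obtain ⟨q, hq⟩ := hH
  refine ⟨dslope H p, ⟨_, hq.has_fpower_series_dslope_fslope⟩, ?_⟩
  filter_upwards [self_mem_nhdsWithin] with s hs
  rw [dslope_of_ne _ hs, slope_def_field, sub_div]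

namespace ZetaPair

variable {a c : ℕ → ℝ} {D r : ℝ}

/-- Summatory function of the coefficients. -/
def summatory (c : ℕ → ℝ) (x : ℝ) : ℝ := ∑ k ∈ Finset.Icc 1 ⌊x⌋₊, c k

/-- The summatory function on the logarithmic scale, normalised by the square root. -/
def scaled (c : ℕ → ℝ) (u : ℝ) : ℝ := Real.exp (-u / 2) * summatory c (Real.exp u)

theorem measurable_scaled : Measurable (scaled c) := by
  have h1 : Measurable fun x : ℝ => summatory c x :=
    (measurable_from_nat (f := fun n : ℕ => ∑ k ∈ Finset.Icc 1 n, c k)).comp Nat.measurable_floor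
  exact (by fun_prop : Measurable fun u : ℝ => Real.exp (-u / 2)).mul
    (h1.comp Real.measurable_exp)

theorem exp_half_mul_sqrt (u : ℝ) : Real.exp (-u / 2) * √(Real.exp u) = 1 := by
  rw [Real.sqrt_eq_rpow, ← Real.exp_mul, ← Real.exp_add]
  simp; ring

theorem abs_scaled_le {C : ℝ} {N : ℕ} (hN : 1 ≤ N)
    (hM : ∀ n : ℕ, N ≤ n → |∑ k ∈ Finset.Icc 1 n, c k| ≤ C * √n) {u : ℝ}
    (hu : (N : ℝ) ≤ Real.exp u) : |scaled c u| ≤ C := by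
  have hfl : N ≤ ⌊Real.exp u⌋₊ := Nat.le_floor hu
  have h2 := hM _ hfl
  have hC : 0 ≤ C := by
    by_contra! h
    have : 0 < √(⌊Real.exp u⌋₊ : ℝ) := Real.sqrt_pos.2 (by exact_mod_cast (by lia))
    nlinarith [abs_nonneg (∑ k ∈ Finset.Icc 1 ⌊Real.exp u⌋₊, c k)]
  rw [scaled, abs_mul, abs_of_pos (Real.exp_pos _), summatory]
  calc _ ≤ Real.exp (-u / 2) * (C * √(Real.exp u)) := by
        gcongr
        refine h2.trans ?_
        gcongr
        exact Nat.floor_le (Real.exp_pos _).le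
    _ = C * (Real.exp (-u / 2) * √(Real.exp u)) := by ring
    _ = C := by rw [exp_half_mul_sqrt, mul_one]

theorem laplace_scaled (h : ZetaPair a c D r) {C : ℝ}
    (hM : ∀ n : ℕ, 1 ≤ n → |∑ k ∈ Finset.Icc 1 n, c k| ≤ C * √n) {s : ℂ} (hs : 1 < s.re) :
    laplace (scaled c) (s - 1 / 2) * s * LSeries (fun n => (a n : ℂ)) s = 1 := by
  have hO : (fun n : ℕ => ∑ k ∈ Finset.Icc 1 n, (c k : ℂ)) =O[atTop]
      fun n : ℕ => (n : ℝ) ^ (1 / 2 : ℝ) := by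
    refine Asymptotics.IsBigO.of_bound C ?_
    filter_upwards [eventually_ge_atTop 1] with n hn
    rw [← ofReal_sum, norm_real, Real.norm_eq_abs, Real.norm_of_nonneg (by positivity),
      ← Real.sqrt_eq_rpow]
    exact hM n hn
  have h1 := LSeries_eq_mul_integral (fun n => (c n : ℂ)) (r := 1 / 2) (by norm_num)
    (s := s) (by linarith) (h.lseriesSummable_c hs) hO
  have h2 : laplace (scaled c) (s - 1 / 2) =
      ∫ t in Set.Ioi (1 : ℝ), (∑ k ∈ Finset.Icc 1 ⌊t⌋₊, (c k : ℂ)) * (t : ℂ) ^ (-(s + 1)) := by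
    rw [← Real.exp_zero, ← integral_comp_exp_Ioi, laplace]
    refine setIntegral_congr_fun measurableSet_Ioi fun u _ => ?_
    simp only [scaled, summatory]
    rw [cpow_def_of_ne_zero (by exact_mod_cast (Real.exp_pos u).ne'), ← ofReal_log
      (Real.exp_pos u).le, Real.log_exp, real_smul]
    push_cast
    have : cexp (-u / 2) * cexp (-(s - 1 / 2) * u) = cexp u * cexp (u * -(s + 1)) := by
      rw [← Complex.exp_add, ← Complex.exp_add]
      congr 1
      ring
    linear_combination (∑ k ∈ Finset.Icc 1 ⌊Real.exp u⌋₊, (c k : ℂ)) * this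
  have h3 := h.mul s hs
  rw [h1, ← h2] at h3
  linear_combination h3

end ZetaPair

/-- The value `∑ a(n) / n ^ m`. -/
def zetaNat (a : ℕ → ℝ) (m : ℕ) : ℝ := ∑' n : ℕ, a n / (n : ℝ) ^ m

/-- Residues of the Mellin transform of the summatory function of `c` at nonpositive integers. -/
def residueCoeff (a : ℕ → ℝ) (D r : ℝ) (k : ℕ) : ℝ :=
  if k = 0 then -1 / r
  else (-1) ^ (k + 1) / (D ^ (2 * k + 1) * k * (k.factorial : ℝ) ^ 2 * zetaNat a (k + 1))

namespace ZetaPair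

variable {a c : ℕ → ℝ} {D r : ℝ}

theorem summable_nat (h : ZetaPair a c D r) {m : ℕ} (hm : 2 ≤ m) :
    Summable fun n : ℕ => a n / (n : ℝ) ^ m := by
  have := h.summable m (by exact_mod_cast hm)
  simpa using this

theorem one_le_zetaNat (h : ZetaPair a c D r) {m : ℕ} (hm : 2 ≤ m) : 1 ≤ zetaNat a m := by
  have := (h.summable_nat hm).le_tsum 1 fun n _ => div_nonneg (h.nonneg n) (by positivity)
  simpa [h.a_one, zetaNat] using this

theorem LSeries_natCast (h : ZetaPair a c D r) (m : ℕ) :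
    LSeries (fun n => (a n : ℂ)) m = zetaNat a m := by
  rw [LSeries, zetaNat, ofReal_tsum]
  refine tsum_congr fun n => ?_
  rcases Nat.eq_zero_or_pos n with rfl | hn
  · simp [h.a_zero]
  · rw [LSeries.term_of_ne_zero hn.ne']
    push_cast
    rw [cpow_natCast]

theorem abs_residueCoeff_le (h : ZetaPair a c D r) {k : ℕ} (hk : k ≠ 0) :
    |residueCoeff a D r k| ≤ 1 / D * ((1 / D ^ 2) ^ k / (k * (k.factorial : ℝ) ^ 2)) := by
  have hD := h.D_pos
  have hk' : (0 : ℝ) < k := by exact_mod_cast Nat.pos_of_ne_zero hk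
  have hZ := h.one_le_zetaNat (m := k + 1) (by lia)
  rw [residueCoeff, if_neg hk, abs_div, abs_pow, abs_neg, abs_one, one_pow,
      abs_of_pos (by positivity)]
  calc _ ≤ 1 / (D ^ (2 * k + 1) * k * (k.factorial : ℝ) ^ 2 * 1) := by gcongr
    _ = _ := by
      rw [pow_succ, pow_mul]
      field_simp
      rw [← mul_pow, mul_one_div_cancel (by positivity), one_pow]

theorem summable_weighted_residueCoeff (h : ZetaPair a c D r) :
    Summable fun k : ℕ => (2 * k + 2) * |residueCoeff a D r k| := by
  have hD := h.D_pos
  have h1 := (Real.summable_pow_div_factorial (1 / D ^ 2)).mul_left (4 / D)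
  refine (summable_nat_add_iff 1).1 (Summable.of_nonneg_of_le (fun k => by positivity)
    (fun k => ?_) ((summable_nat_add_iff 1).2 h1))
  have h2 := h.abs_residueCoeff_le k.succ_ne_zero
  have hk : (0 : ℝ) ≤ k := k.cast_nonneg
  have hf : (1 : ℝ) ≤ (k + 1).factorial := by
    exact_mod_cast Nat.one_le_iff_ne_zero.2 (Nat.factorial_ne_zero _)
  calc (2 * ((k + 1 : ℕ) : ℝ) + 2) * |residueCoeff a D r (k + 1)|
      ≤ (4 * ((k + 1 : ℕ) : ℝ)) * (1 / D * ((1 / D ^ 2) ^ (k + 1) /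
        (((k + 1 : ℕ) : ℝ) * ((k + 1).factorial : ℝ) ^ 2))) := by
        gcongr
        push_cast
        linarith
    _ = 4 / D * ((1 / D ^ 2) ^ (k + 1) / (k + 1).factorial) * (1 / (k + 1).factorial) := by
        field_simp
    _ ≤ 4 / D * ((1 / D ^ 2) ^ (k + 1) / (k + 1).factorial) * 1 := by
        gcongr
        rw [div_le_one (by positivity)]
        exact hf
    _ = _ := mul_one _

/-- The difference between the scaled summatory function and its residual exponential sum is
recurrent in the weak sense of Laplace transforms. -/
theorem scaled_sub_expSum_recurrence (h : ZetaPair a c D r) {C : ℝ}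
    (hM : ∀ n : ℕ, 1 ≤ n → |∑ k ∈ Finset.Icc 1 n, c k| ≤ C * √n)
    {ε : ℝ} (hε : 0 < ε) (T₀ : ℝ) (J : ℕ) : ∃ T ≥ T₀, ∀ m : ℕ, 1 ≤ m → m ≤ J →
      ‖laplace (fun u => scaled c u - expSum (residueCoeff a D r) u) m -
        laplace (fun u => scaled c (u + T) - expSum (residueCoeff a D r) (u + T)) m‖ ≤ ε := by
  have hD := h.D_pos
  have hDc : (D : ℂ) ≠ 0 := by exact_mod_cast hD.ne'
  set b := residueCoeff a D r with hbdef
  have hbw : Summable fun k : ℕ => (2 * k + 2) * |b k| := h.summable_weighted_residueCoeff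
  have hb := summable_abs_of_weighted hbw
  set g := scaled c with hgdef
  have hg : Measurable g := measurable_scaled
  have hgC : ∀ u, 0 ≤ u → |g u| ≤ C := fun u hu =>
    abs_scaled_le le_rfl hM (by simpa using hu)
  have hC0 : 0 ≤ C := (abs_nonneg _).trans (hgC 0 le_rfl)
  obtain ⟨E, hE, hEfe, hE0, hEz⟩ := h.exists_entire
  have hEa : ∀ s, AnalyticAt ℂ E s := fun s => hE.analyticAt s
  -- the identity `L E = D ^ s (s - 1) Γ` on the half plane `1 / 2 < re s`
  have hid : ∀ s : ℂ, 1 / 2 < s.re →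
      laplace g (s - 1 / 2) * E s = (D : ℂ) ^ s * (s - 1) * Gamma s := by
    let U : Set ℂ := {s : ℂ | 1 / 2 < s.re}
    have hUo : IsOpen U := isOpen_lt continuous_const continuous_re
    have hf1 : AnalyticOnNhd ℂ (fun s => laplace g (s - 1 / 2) * E s) U := by
      refine DifferentiableOn.analyticOnNhd (fun s hs => ?_) hUo
      have hs : 1 / 2 < s.re := hs
      have h1 : DifferentiableAt ℂ (laplace g) (s - 1 / 2) :=
        differentiableAt_laplace hg hgC (by simp; norm_num; linarith)
      have h2 : DifferentiableAt ℂ (fun s : ℂ => laplace g (s - 1 / 2)) s :=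
        h1.comp (f := fun s : ℂ => s - 1 / 2) s (by fun_prop)
      exact (h2.mul (hE s)).differentiableWithinAt
    have hf2 : AnalyticOnNhd ℂ (fun s => (D : ℂ) ^ s * (s - 1) * Gamma s) U := by
      refine DifferentiableOn.analyticOnNhd (fun s hs => ?_) hUo
      have hs : 1 / 2 < s.re := hs
      have h1 : DifferentiableAt ℂ Gamma s := differentiableAt_Gamma s fun m hm => by
        rw [hm] at hs
        simp at hs
        have : (0 : ℝ) ≤ m := m.cast_nonneg
        linarith
      have h2 : DifferentiableAt ℂ (fun s : ℂ => (D : ℂ) ^ s) s :=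
        differentiableAt_id.const_cpow (Or.inl hDc)
      exact ((h2.mul (by fun_prop)).mul h1).differentiableWithinAt
    have hpre : IsPreconnected U := (convex_halfSpace_re_gt (1 / 2)).isPreconnected
    refine hf1.eqOn_of_preconnected_of_eventuallyEq hf2 hpre (z₀ := 2) (by simp [U]; norm_num) ?_
    have : {s : ℂ | 1 < s.re} ∈ 𝓝 (2 : ℂ) :=
      (isOpen_lt continuous_const continuous_re).mem_nhds (by simp)
    filter_upwards [this] with s hs
    have hs : 1 < s.re := hs
    have h1 := h.laplace_scaled hM hs
    rw [hEz s hs]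
    linear_combination (s - 1) * ((D : ℂ) ^ s * Gamma s) * h1
  have hEne1 : ∀ s : ℂ, 1 / 2 < s.re → E s ≠ 0 := by
    intro s hs h0
    by_cases h1 : s = 1
    · have := hEfe 0
      rw [sub_zero, hE0, ← h1, h0] at this
      exact h.r_pos.ne (by exact_mod_cast this)
    · have h2 := hid s hs
      rw [h0, mul_zero] at h2
      have h3 : Gamma s ≠ 0 := Gamma_ne_zero_of_re_pos (by linarith)
      have h4 : (D : ℂ) ^ s ≠ 0 := by simp [cpow_eq_zero_iff, hDc]
      exact mul_ne_zero (mul_ne_zero h4 (sub_ne_zero.2 h1)) h3 h2.symm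
  have hEne : ∀ s : ℂ, s.re ≠ 1 / 2 → E s ≠ 0 := by
    intro s hs
    rcases lt_or_gt_of_ne hs with h1 | h1
    · rw [← hEfe]
      exact hEne1 _ (by simp; linarith)
    · exact hEne1 s h1
  have hDs : ∀ s, AnalyticAt ℂ (fun s : ℂ => (D : ℂ) ^ s) s := fun s =>
    (differentiable_id.const_cpow (Or.inl hDc)).analyticAt s
  have hDne : ∀ s : ℂ, (D : ℂ) ^ s ≠ 0 := fun s => by simp [cpow_eq_zero_iff, hDc]
  let Q : ℂ → ℂ := fun s => (D : ℂ) ^ s * (s - 1) * Gamma s / E s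
  have hQm : ∀ s, MeromorphicAt Q s := fun s =>
    (((hDs s).meromorphicAt.mul (analyticAt_id.sub analyticAt_const).meromorphicAt).mul
      (Meromorphic.Gamma s)).div (hEa s).meromorphicAt
  have hPm : ∀ s, MeromorphicAt (polarSum b) s := by
    intro s
    obtain ⟨K, G, hG, -, hEq⟩ := polarSum_eventuallyEq hb s
    refine MeromorphicAt.congr ?_ (hEq.filter_mono nhdsWithin_le_nhds).symm
    exact ((MeromorphicAt.const _ _).div
      (analyticAt_id.add analyticAt_const).meromorphicAt).add hG.meromorphicAt
  have hBm : ∀ s, MeromorphicAt (fun w => Q w - polarSum b w) s := fun s => (hQm s).sub (hPm s)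
  have hres : ∀ K : ℕ, (D : ℂ) ^ (-K : ℂ) * (-K - 1) * ((-1) ^ K / (K.factorial : ℂ)) / E (-K) =
      b K := by
    intro K
    rcases Nat.eq_zero_or_pos K with rfl | hK
    · simp [hbdef, residueCoeff, hE0]
    · have h1 : E (-K) = (K + 1) * K * ((D : ℂ) ^ (K + 1) * (K.factorial : ℂ) *
          (zetaNat a (K + 1) : ℂ)) := by
        rw [← hEfe, sub_neg_eq_add, hEz _ (by simpa using hK)]
        have h2 : (1 + K : ℂ) = ((K + 1 : ℕ) : ℂ) := by push_cast; ring
        rw [h2, h.LSeries_natCast, cpow_natCast]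
        push_cast
        rw [Complex.Gamma_nat_eq_factorial]
        ring
      have h3 := h.one_le_zetaNat (m := K + 1) (by lia)
      have h4 : (zetaNat a (K + 1) : ℂ) ≠ 0 := by
          exact_mod_cast (by linarith : zetaNat a (K + 1) ≠ 0)
      have h5 : (K : ℂ) ≠ 0 := by exact_mod_cast hK.ne'
      have h6 : (K.factorial : ℂ) ≠ 0 := by exact_mod_cast K.factorial_ne_zero
      have h7 : (K + 1 : ℂ) ≠ 0 := by exact_mod_cast K.succ_ne_zero
      rw [h1, hbdef, residueCoeff, if_neg hK.ne', cpow_neg, cpow_natCast]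
      push_cast
      field_simp
      ring
  have hoffs : ∀ s : ℂ, s.re ≠ 1 / 2 → ∃ G : ℂ → ℂ, AnalyticAt ℂ G s ∧
      ∀ᶠ w in 𝓝[≠] s, Q w - polarSum b w = G w := by
    intro s hs
    obtain ⟨K, G, hG, hne, hEq⟩ := polarSum_eventuallyEq hb s
    have hEq' := hEq.filter_mono (nhdsWithin_le_nhds (s := {s}ᶜ))
    by_cases hK : s + K = 0
    · obtain rfl : s = -K := eq_neg_of_add_eq_zero_left hK
      obtain ⟨P, hP, hPK, hPG⟩ := exists_Gamma_eq_div K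
      have hH : AnalyticAt ℂ (fun w => (D : ℂ) ^ w * (w - 1) * P w / E w) (-K) :=
        (((hDs _).mul (analyticAt_id.sub analyticAt_const)).mul hP).div (hEa _) (hEne _ hs)
      obtain ⟨q, hq, hqe⟩ := exists_analyticAt_sub_polar hH
      refine ⟨fun w => q w - G w, hq.sub hG, ?_⟩
      filter_upwards [hEq', hPG, hqe] with w h1 h2 h3
      simp only [hPK, hres, sub_neg_eq_add] at h3
      rw [h1, ← h3]
      simp only [Q]
      rw [h2]
      ring
    · have hall : ∀ m : ℕ, s ≠ -m := by
        intro m hm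
        rcases eq_or_ne m K with rfl | h1
        · exact hK (by rw [hm]; ring)
        · exact hne m h1 (by rw [hm]; ring)
      refine ⟨fun w => Q w - (b K / (w + K) + G w), ?_, hEq'.mono fun w hw => by rw [hw]⟩
      exact ((((hDs s).mul (analyticAt_id.sub analyticAt_const)).mul
        (analyticAt_Gamma_of_ne hall)).div (hEa s) (hEne s hs)).sub
        ((analyticAt_const.div (analyticAt_id.add analyticAt_const) hK).add hG)
  have hfm : Measurable fun u => g u - expSum b u := hg.sub (continuous_expSum hb).measurable
  have hxC : ∀ u, 0 ≤ u → |expSum b u| ≤ ∑' k, |b k| := fun u hu =>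
    (abs_expSum_le hb hu).trans (mul_le_of_le_one_left (tsum_nonneg fun _ => abs_nonneg _)
      (Real.exp_le_one_iff.2 (by linarith)))
  have hfC : ∀ u, 0 ≤ u → |g u - expSum b u| ≤ C + ∑' k, |b k| := fun u hu =>
    (abs_sub _ _).trans (add_le_add (hgC u hu) (hxC u hu))
  obtain ⟨C₁, hC₁⟩ := exists_rpow_mul_norm_Gamma_ratio_le hD
  have hC₁0 : 0 ≤ C₁ := by
    refine le_trans (by positivity) (hC₁ I (by simp) fun k => ?_)
    refine le_trans ?_ (Complex.abs_im_le_norm _)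
    norm_num
  refine laplace_recurrence (f := fun u => g u - expSum b u)
    (B := (fun w => Q w - polarSum b w) ∘ fun z => z + 1 / 2)
    (K := C₁ * 3 * C + ∑' k : ℕ, (2 * k + 2) * |b k|) hfm hfC
    (fun z => (hBm _).comp_analyticAt (analyticAt_id.add analyticAt_const))
    (fun z hz => ?_) (fun z hz => ?_) (fun n hn z hzn hz => ?_) hε T₀ J
  · obtain ⟨G, hG, hGe⟩ := hoffs (z + 1 / 2) (by simpa using hz)
    refine ⟨fun w => G (w + 1 / 2),
      hG.comp_of_eq (analyticAt_id.add analyticAt_const) rfl, ?_⟩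
    have ht : Tendsto (fun w : ℂ => w + 1 / 2) (𝓝[≠] z) (𝓝[≠] (z + 1 / 2)) := by
      refine tendsto_nhdsWithin_of_tendsto_nhds_of_eventually_within _ ?_ ?_
      · exact ((continuous_id.add continuous_const).tendsto z).mono_left nhdsWithin_le_nhds
      · filter_upwards [self_mem_nhdsWithin] with w hw hw'
        exact hw (add_right_cancel hw')
    exact ht.eventually hGe
  · have h1 := hid (z + 1 / 2) (by simpa using hz)
    have h2 := hEne (z + 1 / 2) (by simpa using hz.ne')
    rw [add_sub_cancel_right] at h1
    have h3 : laplace (fun u => g u - expSum b u) z = laplace g z - laplace (expSum b) z := by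
      rw [laplace, laplace, laplace, ← integral_sub (integrableOn_laplace hg hgC hz)
        (integrableOn_laplace (continuous_expSum hb).measurable hxC hz)]
      refine integral_congr_ae (Eventually.of_forall fun u => ?_)
      simp only [ofReal_sub]
      ring
    rw [h3, laplace_expSum hb hz]
    simp only [Function.comp, Q]
    rw [← h1, mul_div_cancel_right₀ _ h2]
  · set s : ℂ := z + 1 / 2 with hs
    have hsz : s - 1 / 2 = z := by rw [hs]; ring
    have hsre : s.re = z.re + 1 / 2 := by rw [hs]; simp
    have hsn : ‖s - 1 / 2‖ = n := by rw [hsz, hzn]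
    have hzle : -z.re ≤ n := by
      rw [← hzn]
      exact (neg_le_abs _).trans (Complex.abs_re_le_norm z)
    have hsum0 : 0 ≤ ∑' k : ℕ, (2 * k + 2) * |b k| := tsum_nonneg fun k => by positivity
    have hpol : ‖polarSum b s‖ ≤ (∑' k : ℕ, (2 * k + 2) * |b k|) / (-z.re) :=
      (norm_polarSum_le hbw hn hsn).trans (by gcongr; linarith)
    have hsk : ∀ k : ℕ, 1 / 2 ≤ ‖s + k‖ := by
      intro k
      have e : s + k = z - (-(k + 1 / 2 : ℝ) : ℝ) := by rw [hs]; push_cast; ring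
      have h1 : |(n : ℝ) - (k + 1 / 2)| ≤ ‖s + k‖ := by
        have := abs_norm_sub_norm_le z ((-(k + 1 / 2 : ℝ) : ℝ) : ℂ)
        rwa [← e, hzn, Complex.norm_real, norm_neg, Real.norm_of_nonneg (by positivity)] at this
      refine le_trans ?_ h1
      rcases le_or_gt n k with h2 | h2
      · have : (n : ℝ) ≤ k := by exact_mod_cast h2
        rw [abs_sub_comm, abs_of_nonneg (by linarith)]
        linarith
      · have : (k : ℝ) + 1 ≤ n := by exact_mod_cast h2
        rw [abs_of_nonneg (by linarith)]
        linarith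
    have hs0 : s ≠ 0 := by
      rintro h0
      have := hsk 0
      rw [h0] at this
      norm_num at this
    have hEs : E s ≠ 0 := hEne s (by rw [hsre]; linarith)
    have h1 := hid (1 - s) (by simp [hsre]; linarith)
    have e1 : (1 - s - 1 / 2 : ℂ) = -z := by rw [hs]; ring
    rw [hEfe, e1] at h1
    have hG1 : Gamma (1 - s) ≠ 0 := Gamma_ne_zero_of_re_pos (by simp [hsre]; linarith)
    have hQs : Q s = (D : ℂ) ^ (2 * s - 1) * (Gamma s / Gamma (1 - s)) * ((1 - s) / s) *
        laplace g (-z) := by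
      have e2 : (D : ℂ) ^ s = (D : ℂ) ^ (2 * s - 1) * (D : ℂ) ^ (1 - s) := by
        rw [← cpow_add _ _ hDc]
        congr 1
        ring
      simp only [Q]
      rw [div_eq_iff hEs, e2]
      have e3 : laplace g (-z) * E s = -(D : ℂ) ^ (1 - s) * s * Gamma (1 - s) := by
        rw [h1]; ring
      rw [mul_assoc _ (laplace g (-z)), e3]
      field_simp
      ring
    have hlap := norm_laplace_le hgC (z := -z) (by simpa using hz)
    rw [neg_re] at hlap
    have hratio : ‖(1 - s) / s‖ ≤ 3 := by
      have h0 := hsk 0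
      simp only [Nat.cast_zero, add_zero] at h0
      rw [norm_div, div_le_iff₀ (by linarith)]
      have := norm_sub_le 1 s
      rw [norm_one] at this
      linarith
    have hDn : ‖(D : ℂ) ^ (2 * s - 1)‖ = D ^ (2 * s.re - 1) := by
      rw [norm_cpow_eq_rpow_re_of_pos hD]
      simp
    have hQn : ‖Q s‖ ≤ C₁ * 3 * C / (-z.re) := by
      rw [hQs, norm_mul, norm_mul, norm_mul, hDn, mul_div_assoc]
      gcongr
      exact hC₁ s (by rw [hsre]; linarith) hsk
    rw [add_div]
    exact (norm_sub_le _ _).trans (add_le_add hQn hpol)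

/-- The Mertens summatory function of a zeta pair satisfying the naive Mertens bound
asymptotically satisfies an explicit bound at every integer. -/
theorem abs_sum_sub_tsum_residue_le (h : ZetaPair a c D r)
    (hlim : ∀ ε > 0, ∃ N : ℕ, ∀ n : ℕ, N ≤ n → |∑ k ∈ Finset.Icc 1 n, c k| ≤ (1 + ε) * √n)
    {N : ℕ} (hN : 1 ≤ N) :
    |∑ k ∈ Finset.Icc 1 N, c k - ∑' k : ℕ, residueCoeff a D r k / (N : ℝ) ^ k| ≤ √N := by
  have hD := h.D_pos
  have hDc : (D : ℂ) ≠ 0 := by exact_mod_cast hD.ne'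
  obtain ⟨C, hM⟩ : ∃ C, ∀ n : ℕ, 1 ≤ n → |∑ k ∈ Finset.Icc 1 n, c k| ≤ C * √n := by
    obtain ⟨N₀, hN₀⟩ := hlim 1 one_pos
    refine ⟨max (1 + 1) (∑ k ∈ Finset.Icc 1 N₀, |c k|), fun n hn => ?_⟩
    rcases le_total N₀ n with h1 | h1
    · exact (hN₀ n h1).trans (by gcongr; exact le_max_left _ _)
    · have h2 : (1 : ℝ) ≤ √n := Real.one_le_sqrt.2 (by exact_mod_cast hn)
      calc |∑ k ∈ Finset.Icc 1 n, c k| ≤ ∑ k ∈ Finset.Icc 1 n, |c k| :=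
            Finset.abs_sum_le_sum_abs _ _
        _ ≤ ∑ k ∈ Finset.Icc 1 N₀, |c k| :=
            Finset.sum_le_sum_of_subset_of_nonneg (Finset.Icc_subset_Icc_right h1)
              fun _ _ _ => abs_nonneg _
        _ ≤ max (1 + 1) (∑ k ∈ Finset.Icc 1 N₀, |c k|) := le_max_right _ _
        _ ≤ max (1 + 1) (∑ k ∈ Finset.Icc 1 N₀, |c k|) * √n :=
            le_mul_of_one_le_right (le_trans (by norm_num) (le_max_left _ _)) h2
  set b := residueCoeff a D r with hbdef
  have hb : Summable fun k => |b k| := summable_abs_of_weighted h.summable_weighted_residueCoeff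
  have hrec := fun ε hε => h.scaled_sub_expSum_recurrence hM (ε := ε) hε
  have hN' : (1 : ℝ) ≤ N := by exact_mod_cast hN
  set u₀ : ℝ := Real.log N with hu₀
  have hexp : Real.exp u₀ = N := Real.exp_log (by linarith)
  have hu₀0 : 0 ≤ u₀ := Real.log_nonneg hN'
  let f : ℝ → ℝ := fun u => scaled c u - expSum b u
  have hfm : Measurable f := measurable_scaled.sub (continuous_expSum hb).measurable
  have hfC : ∀ u, 0 ≤ u → |f u| ≤ C + ∑' k, |b k| := fun u hu =>
    (abs_sub _ _).trans (add_le_add (abs_scaled_le le_rfl hM (by simpa using hu))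
      ((abs_expSum_le hb hu).trans (mul_le_of_le_one_left (tsum_nonneg fun _ => abs_nonneg _)
        (Real.exp_le_one_iff.2 (by linarith)))))
  have hlimf : ∀ ε > 0, ∀ᶠ u in atTop, |f u| ≤ 1 + ε := by
    intro ε hε
    obtain ⟨N₀, hN₀⟩ := hlim (ε / 2) (by positivity)
    have h1 : Tendsto (fun u : ℝ => Real.exp (-u / 2) * ∑' k, |b k|) atTop (𝓝 0) := by
      rw [← zero_mul (∑' k, |b k|)]
      refine Tendsto.mul_const _ (Real.tendsto_exp_atBot.comp ?_)
      exact (tendsto_neg_atTop_atBot).atBot_div_const (by norm_num)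
    filter_upwards [Real.tendsto_exp_atTop.eventually_ge_atTop ((max N₀ 1 : ℕ) : ℝ),
      h1.eventually_le_const (half_pos hε), eventually_ge_atTop 0] with u h2 h3 h4
    have h5 := abs_scaled_le (le_max_right N₀ 1)
      (fun n hn => hN₀ n ((le_max_left _ _).trans hn)) h2
    have h6 := (abs_sub (scaled c u) (expSum b u)).trans
      (add_le_add h5 ((abs_expSum_le hb h4).trans h3))
    calc |f u| ≤ _ := h6
      _ = 1 + ε := by ring
  have hcont : ContinuousWithinAt f (Set.Ici u₀) u₀ := by
    refine ContinuousWithinAt.sub ?_ (continuous_expSum hb).continuousWithinAt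
    have h1 : ContinuousWithinAt (fun u => Real.exp (-u / 2) * summatory c N) (Set.Ici u₀) u₀ :=
      (by fun_prop : Continuous fun u => Real.exp (-u / 2) * summatory c N).continuousWithinAt
    refine h1.congr_of_eventuallyEq ?_ (by rw [scaled, hexp])
    have h2 : ∀ᶠ u in 𝓝[≥] u₀, Real.exp u < N + 1 :=
      (Real.continuous_exp.continuousWithinAt (s := Set.Ici u₀) (x := u₀)).eventually_lt_const
        (by rw [hexp]; linarith)
    filter_upwards [h2, self_mem_nhdsWithin] with u h3 h4
    have h5 : (N : ℝ) ≤ Real.exp u := by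
      rw [← hexp]
      exact Real.exp_le_exp.2 h4
    have h6 : ⌊Real.exp u⌋₊ = N := (Nat.floor_eq_iff (by positivity)).2 ⟨h5, h3⟩
    rw [scaled, summatory, summatory, h6, Nat.floor_natCast]
  have hneg : ∀ (F : ℝ → ℝ) (z : ℂ), laplace (fun u => -F u) z = -laplace F z := by
    intro F z
    simp [laplace, ← integral_neg]
  have hup : f u₀ ≤ 1 := le_one_of_recurrence hfm hfC hrec
    (fun ε hε => (hlimf ε hε).mono fun u hu => (le_abs_self _).trans hu) hu₀0 hcont
  have hdn : -f u₀ ≤ 1 := by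
    refine le_one_of_recurrence (f := fun u => -f u) (C := C + ∑' k, |b k|) hfm.neg
      (fun u hu => by rw [abs_neg]; exact hfC u hu) (fun ε hε T₀ J => ?_)
      (fun ε hε => (hlimf ε hε).mono fun u hu => (neg_le_abs _).trans hu) hu₀0 hcont.neg
    obtain ⟨T, hT, hTJ⟩ := hrec ε hε T₀ J
    refine ⟨T, hT, fun m h1 h2 => ?_⟩
    rw [hneg f, hneg fun u => f (u + T), neg_sub_neg, norm_sub_rev]
    exact hTJ m h1 h2
  have hval : f u₀ = Real.exp (-u₀ / 2) *
      (∑ k ∈ Finset.Icc 1 N, c k - ∑' k : ℕ, b k / (N : ℝ) ^ k) := by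
    simp only [f]
    rw [mul_sub, scaled, summatory, hexp, Nat.floor_natCast, expSum, ← tsum_mul_left]
    congr 1
    refine tsum_congr fun k => ?_
    rw [max_eq_left hu₀0, ← hexp, ← Real.exp_nat_mul, div_eq_mul_inv (b k), ← Real.exp_neg,
      mul_left_comm, ← Real.exp_add]
    congr 2
    ring
  have hroot := exp_half_mul_sqrt u₀
  rw [hexp] at hroot
  set X := ∑ k ∈ Finset.Icc 1 N, c k - ∑' k : ℕ, b k / (N : ℝ) ^ k
  have hX : X = √N * f u₀ := by
    rw [hval]
    linear_combination -X * hroot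
  rw [hX, abs_mul, abs_of_nonneg (Real.sqrt_nonneg _)]
  exact mul_le_of_le_one_right (Real.sqrt_nonneg _) (_root_.abs_le.2 ⟨by linarith, hup⟩)

end ZetaPair

open UniqueFactorizationMonoid in
theorem sum_moebius_dvd {R : Type*} [CommMonoidWithZero R] [UniqueFactorizationMonoid R]
    [Subsingleton Rˣ] {x : R} (hx : x ≠ 0) {S : Finset R} (hS : ∀ y, y ∈ S ↔ y ∣ x) :
    ∑ y ∈ S, moebius y = if x = 1 then 1 else 0 := by
  split_ifs with h1
  · have : S = {1} := by
      ext y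
      rw [hS, h1, Finset.mem_singleton, ← isUnit_iff_dvd_one, isUnit_iff_eq_one]
    simp [this]
  · obtain ⟨p, hp, x', rfl⟩ := WfDvdMonoid.exists_irreducible_factor
      (fun h => h1 (isUnit_iff_eq_one.1 h)) hx
    have hpp : Prime p := UniqueFactorizationMonoid.irreducible_iff_prime.1 hp
    rw [← Finset.sum_filter_add_sum_filter_not S (fun y => p ∣ y)]
    have himg : (S.filter fun y => ¬ p ∣ y).image (p * ·) ⊆ S.filter fun y => p ∣ y := by
      intro z hz
      obtain ⟨y, hy, rfl⟩ := Finset.mem_image.1 hz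
      obtain ⟨hyS, hpy⟩ := Finset.mem_filter.1 hy
      refine Finset.mem_filter.2 ⟨(hS _).2 (mul_dvd_mul_left p ?_), dvd_mul_right _ _⟩
      have h2 : IsRelPrime y p := (hp.isRelPrime_iff_not_dvd.2 hpy).symm
      exact h2.dvd_of_dvd_mul_left ((hS y).1 hyS)
    rw [← Finset.sum_subset himg, Finset.sum_image]
    · rw [← Finset.sum_add_distrib]
      refine Finset.sum_eq_zero fun y hy => ?_
      have h2 : IsRelPrime p y := hp.isRelPrime_iff_not_dvd.2 (Finset.mem_filter.1 hy).2
      rw [h2.moebius_mul, hp.moebius_eq]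
      ring
    · exact fun y _ z _ h => mul_left_cancel₀ hp.ne_zero h
    · intro z hz hz'
      obtain ⟨hzS, y, rfl⟩ := Finset.mem_filter.1 hz
      refine moebius_of_not_squarefree fun hsq => hz' ?_
      refine Finset.mem_image.2 ⟨y, Finset.mem_filter.2 ⟨(hS y).2 ?_, fun hpy => ?_⟩, rfl⟩
      · exact (dvd_mul_left y p).trans ((hS _).1 hzS)
      · exact hp.not_isUnit (hsq p (mul_dvd_mul_left p hpy))

section

variable (K : Type) [Field K] [NumberField K]

/-- The ideals of given norm. -/
def idealsOfNorm (n : ℕ) : Finset (Ideal (𝓞 K)) :=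
  (Ideal.finite_setOfPred_absNorm_eq (S := 𝓞 K) n).toFinset

/-- The number of nonzero ideals of given norm. -/
def idealCount (n : ℕ) : ℝ := if n = 0 then 0 else (idealsOfNorm K n).card

/-- The sum of the Möbius function over nonzero ideals of given norm. -/
def moebiusSum (n : ℕ) : ℝ := if n = 0 then 0 else ∑ I ∈ idealsOfNorm K n, (moebiusK K I : ℝ)

variable {K}

@[simp]
theorem mem_idealsOfNorm {n : ℕ} {I : Ideal (𝓞 K)} :
    I ∈ idealsOfNorm K n ↔ Ideal.absNorm I = n := by
  simp [idealsOfNorm]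

theorem moebiusK_eq (I : Ideal (𝓞 K)) : moebiusK K I = UniqueFactorizationMonoid.moebius I := by
  rw [moebiusK, UniqueFactorizationMonoid.moebius]

theorem abs_moebiusK_le (I : Ideal (𝓞 K)) : |(moebiusK K I : ℝ)| ≤ 1 := by
  rw [moebiusK]
  split_ifs <;> simp

theorem abs_moebiusSum_le (n : ℕ) : |moebiusSum K n| ≤ idealCount K n := by
  rw [moebiusSum, idealCount]
  split_ifs
  · simp
  · refine (Finset.abs_sum_le_sum_abs _ _).trans ?_
    refine (Finset.sum_le_card_nsmul _ _ 1 fun I _ => abs_moebiusK_le I).trans ?_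
    simp

theorem idealCount_nonneg (n : ℕ) : 0 ≤ idealCount K n := by
  rw [idealCount]
  split_ifs <;> positivity

theorem idealCount_one : idealCount K 1 = 1 := by
  have : idealsOfNorm K 1 = {⊤} := by
    ext I
    simp
  simp [idealCount, this]

theorem sum_idealCount_mul_moebiusSum {n : ℕ} (hn : n ≠ 0) :
    ∑ p ∈ n.divisorsAntidiagonal, idealCount K p.1 * moebiusSum K p.2 =
      if n = 1 then 1 else 0 := by
  have hfin : ∀ I : Ideal (𝓞 K), I ≠ ⊥ → {J : Ideal (𝓞 K) | J ∣ I}.Finite := by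
    intro I hI
    have := UniqueFactorizationMonoid.fintypeSubtypeDvd I hI
    exact Set.finite_coe_iff.1 (Finite.of_fintype {J : Ideal (𝓞 K) // J ∣ I})
  have hbot : ∀ I ∈ idealsOfNorm K n, I ≠ ⊥ := by
    rintro I hI rfl
    rw [mem_idealsOfNorm, Ideal.absNorm_bot] at hI
    exact hn hI.symm
  let S : Ideal (𝓞 K) → Finset (Ideal (𝓞 K)) := fun I =>
    if h : I ≠ ⊥ then (hfin I h).toFinset else ∅
  have hS : ∀ I, I ≠ ⊥ → ∀ J, J ∈ S I ↔ J ∣ I := by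
    intro I hI J
    simp [S, hI]
  calc ∑ p ∈ n.divisorsAntidiagonal, idealCount K p.1 * moebiusSum K p.2
      = ∑ p ∈ n.divisorsAntidiagonal, ∑ q ∈ idealsOfNorm K p.1 ×ˢ idealsOfNorm K p.2,
          (moebiusK K q.2 : ℝ) := by
        refine Finset.sum_congr rfl fun p hp => ?_
        have h0 := Nat.mem_divisorsAntidiagonal.1 hp
        have h1 : p.1 ≠ 0 := left_ne_zero_of_mul (h0.1 ▸ hn)
        have h2 : p.2 ≠ 0 := right_ne_zero_of_mul (h0.1 ▸ hn)
        rw [idealCount, moebiusSum, if_neg h1, if_neg h2, Finset.sum_product]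
        simp
    _ = ∑ I ∈ idealsOfNorm K n, ∑ J ∈ S I, (moebiusK K J : ℝ) := by
        rw [Finset.sum_sigma', Finset.sum_sigma']
        refine Finset.sum_bij (fun x _ => ⟨x.2.1 * x.2.2, x.2.2⟩) ?_ ?_ ?_ ?_
        · rintro ⟨⟨i, j⟩, ⟨L, J⟩⟩ h
          simp only [Finset.mem_sigma, Nat.mem_divisorsAntidiagonal, Finset.mem_product,
            mem_idealsOfNorm] at h ⊢
          have h1 : Ideal.absNorm (L * J) = n := by rw [map_mul, h.2.1, h.2.2, h.1.1]
          exact ⟨h1, (hS _ (hbot _ (mem_idealsOfNorm.2 h1)) _).2 (dvd_mul_left _ _)⟩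
        · rintro ⟨⟨i, j⟩, ⟨L, J⟩⟩ h ⟨⟨i', j'⟩, ⟨L', J'⟩⟩ h' heq
          simp only [Finset.mem_sigma, Nat.mem_divisorsAntidiagonal, Finset.mem_product,
            mem_idealsOfNorm] at h h'
          simp only [Sigma.mk.injEq, heq_eq_eq] at heq
          obtain ⟨h1, rfl⟩ := heq
          have hJ : J ≠ 0 := by
            rintro rfl
            apply hn
            rw [← h.1.1, ← h.2.2, Ideal.zero_eq_bot, Ideal.absNorm_bot, mul_zero]
          obtain rfl := mul_right_cancel₀ hJ h1
          rw [← h.2.1, ← h.2.2, ← h'.2.1, ← h'.2.2]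
        · rintro ⟨I, J⟩ h
          simp only [Finset.mem_sigma] at h
          obtain ⟨L, rfl⟩ := (hS I (hbot I h.1) J).1 h.2
          refine ⟨⟨(Ideal.absNorm L, Ideal.absNorm J), (L, J)⟩, ?_, by simp [mul_comm]⟩
          have h1 := mem_idealsOfNorm.1 h.1
          simp only [Finset.mem_sigma, Nat.mem_divisorsAntidiagonal, Finset.mem_product,
            mem_idealsOfNorm, and_true, ← map_mul]
          exact ⟨by rw [mul_comm, h1], hn⟩
        · intros
          rfl
    _ = ∑ I ∈ idealsOfNorm K n, if I = 1 then (1 : ℝ) else 0 := by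
        refine Finset.sum_congr rfl fun I hI => ?_
        have h1 := sum_moebius_dvd (hbot I hI) (hS I (hbot I hI))
        simp_rw [moebiusK_eq]
        exact_mod_cast h1
    _ = if n = 1 then 1 else 0 := by
        rw [Finset.sum_ite_eq']
        simp [eq_comm]

theorem summable_idealCount {s : ℝ} (hs : 1 < s) :
    Summable fun n : ℕ => idealCount K n / (n : ℝ) ^ s := by
  have hO : (fun n : ℕ => ∑ k ∈ Finset.Icc 1 n, idealCount K k) =O[atTop]
      fun n => (n : ℝ) ^ (1 : ℝ) := by
    have h1 := (Ideal.tendsto_norm_le_div_atTop₀ K).comp tendsto_natCast_atTop_atTop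
    have h2 := h1.isBigO_one ℝ
    refine (Asymptotics.IsBigO.congr' (h2.mul
        (Asymptotics.isBigO_refl (fun n : ℕ => (n : ℝ)) atTop))
      ?_ ?_)
    · filter_upwards [eventually_ge_atTop 1] with n hn
      have hn' : (n : ℝ) ≠ 0 := by positivity
      simp only [Function.comp]
      rw [div_mul_cancel₀ _ hn']
      have h3 : ∑ k ∈ Finset.Icc 1 n, idealCount K k =
          ((∑ k ∈ Finset.Icc 1 n, (idealsOfNorm K k).card : ℕ) : ℝ) := by
        push_cast
        refine Finset.sum_congr rfl fun k hk => ?_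
        rw [idealCount, if_neg (by have := (Finset.mem_Icc.1 hk).1; lia)]
      rw [h3, Nat.cast_inj, ← Finset.card_biUnion]
      · rw [← Nat.card_eq_finsetCard]
        refine Nat.card_congr
          { toFun := fun I => ⟨I.1.1, ?_⟩
            invFun := fun I => ⟨⟨I.1, ?_⟩, ?_⟩
            left_inv := fun _ => rfl
            right_inv := fun _ => rfl }
        · have h4 := I.2
          have h5 : Ideal.absNorm I.1.1 ≠ 0 := by
            rw [Ne, Ideal.absNorm_eq_zero_iff]
            exact nonZeroDivisors.coe_ne_zero I.1
          simp only [Finset.mem_biUnion, Finset.mem_Icc, mem_idealsOfNorm]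
          exact ⟨_, ⟨by lia, by exact_mod_cast h4⟩, rfl⟩
        · have := I.2
          simp only [Finset.mem_biUnion, Finset.mem_Icc, mem_idealsOfNorm] at this
          obtain ⟨k, hk, hk'⟩ := this
          rw [mem_nonZeroDivisors_iff_ne_zero]
          intro h0
          rw [h0, Ideal.zero_eq_bot, Ideal.absNorm_bot] at hk'
          lia
        · have := I.2
          simp only [Finset.mem_biUnion, Finset.mem_Icc, mem_idealsOfNorm] at this
          obtain ⟨k, hk, hk'⟩ := this
          simp only [hk']
          exact_mod_cast hk.2
      · intro i _ j _ hij
        refine Finset.disjoint_left.2 fun I h1 h2 => hij ?_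
        rw [mem_idealsOfNorm] at h1 h2
        rw [← h1, ← h2]
    · filter_upwards with n
      simp
  have h3 := LSeriesSummable_of_sum_norm_bigO_and_nonneg (s := (s : ℂ)) hO idealCount_nonneg
    zero_le_one (by simpa using hs)
  refine h3.norm.congr fun n => ?_
  rcases Nat.eq_zero_or_pos n with rfl | hn
  · simp [idealCount]
  · rw [LSeries.term_of_ne_zero hn.ne', norm_div, Complex.norm_real,
      Real.norm_of_nonneg (idealCount_nonneg n), norm_natCast_cpow_of_pos hn, ofReal_re]

theorem lseries_idealCount_mul_moebiusSum {s : ℂ} (hs : 1 < s.re) :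
    LSeries (fun n => (idealCount K n : ℂ)) s * LSeries (fun n => (moebiusSum K n : ℂ)) s = 1 := by
  have hterm : ∀ n : ℕ, ‖LSeries.term (fun n => (idealCount K n : ℂ)) s n‖ =
      idealCount K n / (n : ℝ) ^ s.re := by
    intro n
    rcases Nat.eq_zero_or_pos n with rfl | hn
    · simp [idealCount]
    · rw [LSeries.term_of_ne_zero hn.ne', norm_div, Complex.norm_real,
        Real.norm_of_nonneg (idealCount_nonneg n), norm_natCast_cpow_of_pos hn]
  have h1 : LSeriesSummable (fun n => (idealCount K n : ℂ)) s :=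
    Summable.of_norm ((summable_idealCount hs).congr fun n => (hterm n).symm)
  have h2 : LSeriesSummable (fun n => (moebiusSum K n : ℂ)) s := by
    refine Summable.of_norm_bounded (summable_idealCount (K := K) hs) fun n => ?_
    rw [← hterm]
    refine LSeries.norm_term_le s ?_
    rw [Complex.norm_real, Complex.norm_real, Real.norm_eq_abs,
      Real.norm_of_nonneg (idealCount_nonneg n)]
    exact abs_moebiusSum_le n
  rw [← LSeries_convolution' h1 h2]
  refine Eq.trans ?_ (congr_fun LSeries_delta s)
  refine LSeries_congr (fun {n} hn => ?_) s
  rw [LSeries.convolution_def]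
  have := sum_idealCount_mul_moebiusSum (K := K) hn
  have h3 : ((∑ p ∈ n.divisorsAntidiagonal, idealCount K p.1 * moebiusSum K p.2 : ℝ) : ℂ) =
      LSeries.delta n := by
    rw [this, LSeries.delta]
    split_ifs <;> simp
  rw [← h3]
  push_cast
  rfl

end

theorem tsum_gaussian_eq {τ : ℝ} (hτ : 0 < τ) (x : ℝ) :
    ∑' m : ℤ, cexp (-Real.pi * τ * (m + x) ^ 2) =
      (√τ : ℂ)⁻¹ * ∑' k : ℤ, cexp (-Real.pi / τ * k ^ 2 + 2 * Real.pi * (-I * x) * k) := by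
  have h := Complex.tsum_exp_neg_quadratic (a := (τ⁻¹ : ℝ)) (by simpa using hτ) (-I * x)
  have e1 : ((τ⁻¹ : ℝ) : ℂ) ^ (1 / 2 : ℂ) = (√τ : ℂ)⁻¹ := by
    rw [Real.sqrt_eq_rpow, ← Complex.ofReal_inv, ← Real.inv_rpow hτ.le,
      Complex.ofReal_cpow (by positivity)]
    norm_num
  have hs : (√τ : ℂ) ≠ 0 := by exact_mod_cast (Real.sqrt_pos.2 hτ).ne'
  have e2 : ∀ k : ℤ, cexp (-Real.pi / τ * k ^ 2 + 2 * Real.pi * (-I * x) * k) =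
      cexp (-Real.pi * (τ⁻¹ : ℝ) * k ^ 2 + 2 * Real.pi * (-I * x) * k) := by
    intro k
    push_cast
    rw [div_eq_mul_inv]
  simp_rw [e2]
  rw [h, e1, one_div, inv_inv, inv_mul_cancel_left₀ hs]
  refine tsum_congr fun m => ?_
  have e3 : I * (-I * (x : ℂ)) = x := by
    rw [← mul_assoc, mul_neg, I_mul_I, neg_neg, one_mul]
  rw [e3]
  push_cast
  rw [div_inv_eq_mul]

theorem summable_gaussian_int {δ : ℝ} (hδ : 0 < δ) :
    Summable fun k : ℤ => Real.exp (-δ * k ^ 2) := by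
  have h := (summable_jacobiTheta₂_term_iff 0 (I * (δ / Real.pi : ℝ))).2 (by simp; positivity)
  refine h.norm.congr fun k => ?_
  rw [norm_jacobiTheta₂_term]
  congr 1
  simp
  field_simp

theorem summable_gaussian_prod {δ ε : ℝ} (hδ : 0 < δ) (hε : 0 < ε) :
    Summable fun v : ℤ × ℤ => Real.exp (-δ * v.1 ^ 2) * Real.exp (-ε * v.2 ^ 2) :=
  (summable_gaussian_int hδ).mul_of_nonneg (summable_gaussian_int hε)
    (fun _ => (Real.exp_pos _).le) fun _ => (Real.exp_pos _).le

theorem tsum_tsum_gaussian_inv {α β t : ℝ} (hα : 0 < α) (ht : 0 < t) :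
    ∑' n : ℤ, ∑' m : ℤ, cexp (-Real.pi * (1 / t) * (α * (m + β * n) ^ 2 + n ^ 2 / α)) =
      t * ∑' n : ℤ, ∑' m : ℤ, cexp (-Real.pi * t * (α * (m + β * n) ^ 2 + n ^ 2 / α)) := by
  have hαc : (α : ℂ) ≠ 0 := by exact_mod_cast hα.ne'
  have htc : (t : ℂ) ≠ 0 := by exact_mod_cast ht.ne'
  let W : ℤ → ℤ → ℂ := fun n k =>
    cexp (-Real.pi * t / α * n ^ 2) * cexp (-Real.pi / (t * α) * k ^ 2 + 2 * Real.pi *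
        (-I * β * n) * k)
  have hW : Summable (Function.uncurry W) := by
    refine Summable.of_norm ((summable_gaussian_prod (δ := Real.pi * t / α)
      (ε := Real.pi / (t * α)) (by positivity) (by positivity)).congr fun v => ?_)
    simp only [Function.uncurry, W, norm_mul, Complex.norm_exp]
    congr 2
    · have : (-Real.pi * t / α * v.1 ^ 2 : ℂ) = ((-(Real.pi * t / α) * v.1 ^ 2 : ℝ) : ℂ) := by
        push_cast; ring
      rw [this, ofReal_re]
    · have : (-Real.pi / (t * α) * v.2 ^ 2 + 2 * Real.pi * (-I * β * v.1) * v.2 : ℂ) =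
          ((-(Real.pi / (t * α)) * v.2 ^ 2 : ℝ) : ℂ) +
          ((-(2 * Real.pi * β * v.1 * v.2) : ℝ) : ℂ) * I := by
        push_cast; ring
      rw [this, add_re, ofReal_re, re_ofReal_mul, I_re, mul_zero, add_zero]
  have h1 : ∑' n : ℤ, ∑' m : ℤ, cexp (-Real.pi * t * (α * (m + β * n) ^ 2 + n ^ 2 / α)) =
      (√(t * α) : ℂ)⁻¹ * ∑' n : ℤ, ∑' k : ℤ, W n k := by
    rw [← tsum_mul_left]
    refine tsum_congr fun n => ?_
    have h2 := tsum_gaussian_eq (τ := t * α) (by positivity) (β * n)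
    calc _ = ∑' m : ℤ, cexp (-Real.pi * t / α * n ^ 2) *
          cexp (-Real.pi * (t * α : ℝ) * (m + (β * n : ℝ)) ^ 2) := by
          refine tsum_congr fun m => ?_
          rw [← Complex.exp_add]
          congr 1
          push_cast
          field_simp
          ring
      _ = _ := by
          rw [tsum_mul_left, h2, mul_left_comm, ← tsum_mul_left]
          congr 1
          refine tsum_congr fun k => ?_
          simp only [W]
          push_cast
          ring_nf
  have h3 : ∑' n : ℤ, ∑' m : ℤ, cexp (-Real.pi * (1 / t) * (α * (m + β * n) ^ 2 + n ^ 2 / α)) =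
      (√(t / α) : ℂ) * ∑' k : ℤ, ∑' n : ℤ, W n k := by
    rw [← tsum_mul_left]
    refine tsum_congr fun k => ?_
    have h2 := tsum_gaussian_eq (τ := α / t) (by positivity) (β * k)
    have hs : (√(α / t) : ℂ)⁻¹ = (√(t / α) : ℂ) := by
      rw [← ofReal_inv, ← Real.sqrt_inv, inv_div]
    calc _ = ∑' m : ℤ, cexp (-Real.pi / (t * α) * k ^ 2) *
          cexp (-Real.pi * (α / t : ℝ) * (m + (β * k : ℝ)) ^ 2) := by
          refine tsum_congr fun m => ?_
          rw [← Complex.exp_add]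
          congr 1
          push_cast
          field_simp
          ring
      _ = _ := by
          rw [tsum_mul_left, h2, mul_left_comm, ← tsum_mul_left, hs]
          congr 1
          refine tsum_congr fun n => ?_
          simp only [W]
          rw [← Complex.exp_add, ← Complex.exp_add]
          congr 1
          push_cast
          field_simp
          ring
  have hsq : (√(t / α) : ℂ) = t * (√(t * α) : ℂ)⁻¹ := by
    rw [← ofReal_inv, ← ofReal_mul, ofReal_inj, ← div_eq_mul_inv,
      eq_div_iff (Real.sqrt_pos.2 (by positivity)).ne', ← Real.sqrt_mul (by positivity)]
    rw [show t / α * (t * α) = t ^ 2 by field_simp, Real.sqrt_sq ht.le]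
  rw [h1, h3, hsq, mul_assoc, hW.tsum_comm]

/-- A reduced positive binary quadratic form `A x² + B x y + C y²`, up to the sign of `B`. -/
structure ReducedForm where
  A : ℕ
  B : ℕ
  C : ℕ
  A_pos : 0 < A
  B_le : B ≤ A
  A_le : A ≤ C

namespace ReducedForm

/-- The value of a reduced form at a lattice point. -/
def val (f : ReducedForm) (v : ℤ × ℤ) : ℕ :=
  ((f.A : ℤ) * v.1 ^ 2 + f.B * v.1 * v.2 + f.C * v.2 ^ 2).toNat

/-- The number of lattice points at which a reduced form takes the value `n`. -/
def rep (f : ReducedForm) (n : ℕ) : ℕ := Nat.card {v // f.val v = n}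

/-- The absolute value of the discriminant of a form. -/
def absDiscr (f : ReducedForm) : ℤ := 4 * f.A * f.C - f.B ^ 2

variable (f : ReducedForm)

theorem add_le_two_mul (v : ℤ × ℤ) :
    (f.A : ℤ) * v.1 ^ 2 + f.C * v.2 ^ 2 ≤
      2 * ((f.A : ℤ) * v.1 ^ 2 + f.B * v.1 * v.2 + f.C * v.2 ^ 2) := by
  have hB : (f.B : ℤ) ≤ f.A := by exact_mod_cast f.B_le
  have hA : (f.A : ℤ) ≤ f.C := by exact_mod_cast f.A_le
  have hB0 : (0 : ℤ) ≤ f.B := by positivity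
  nlinarith [mul_nonneg hB0 (sq_nonneg (v.1 + v.2)), mul_nonneg (sub_nonneg.2 hB) (sq_nonneg v.1),
    mul_nonneg (sub_nonneg.2 hB) (sq_nonneg v.2), mul_nonneg (sub_nonneg.2 hA) (sq_nonneg v.2)]

theorem coe_val (v : ℤ × ℤ) :
    (f.val v : ℤ) = (f.A : ℤ) * v.1 ^ 2 + f.B * v.1 * v.2 + f.C * v.2 ^ 2 := by
  refine Int.toNat_of_nonneg ?_
  have := f.add_le_two_mul v
  have : (0 : ℤ) ≤ (f.A : ℤ) * v.1 ^ 2 + f.C * v.2 ^ 2 := by positivity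
  linarith

theorem real_val (v : ℤ × ℤ) :
    (f.val v : ℝ) = f.A * v.1 ^ 2 + f.B * v.1 * v.2 + f.C * v.2 ^ 2 := by
  exact_mod_cast f.coe_val v

theorem sq_add_sq_le (v : ℤ × ℤ) : v.1 ^ 2 + v.2 ^ 2 ≤ 2 * (f.val v : ℤ) := by
  have h := f.add_le_two_mul v
  rw [← coe_val] at h
  have h1 : (1 : ℤ) ≤ f.A := by exact_mod_cast f.A_pos
  have h2 : (1 : ℤ) ≤ f.C := by exact_mod_cast f.A_pos.trans_le f.A_le
  nlinarith [mul_nonneg (sub_nonneg.2 h1) (sq_nonneg v.1),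
    mul_nonneg (sub_nonneg.2 h2) (sq_nonneg v.2)]

theorem val_eq_zero {v : ℤ × ℤ} : f.val v = 0 ↔ v = 0 := by
  constructor
  · intro h
    have h1 := f.sq_add_sq_le v
    rw [h] at h1
    simp only [Nat.cast_zero, mul_zero] at h1
    have h2 : v.1 = 0 := pow_eq_zero_iff two_ne_zero |>.1 <|
      le_antisymm (by linarith [sq_nonneg v.2]) (sq_nonneg v.1)
    have h3 : v.2 = 0 := pow_eq_zero_iff two_ne_zero |>.1 <|
      le_antisymm (by linarith [sq_nonneg v.1]) (sq_nonneg v.2)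
    exact Prod.ext h2 h3
  · rintro rfl
    simp [val]

theorem rep_zero : f.rep 0 = 1 := by
  simp [rep, val_eq_zero]

theorem absDiscr_pos : 0 < f.absDiscr := by
  have h1 : (1 : ℤ) ≤ f.A := by exact_mod_cast f.A_pos
  have hB : (f.B : ℤ) ≤ f.A := by exact_mod_cast f.B_le
  have hA : (f.A : ℤ) ≤ f.C := by exact_mod_cast f.A_le
  have hB0 : (0 : ℤ) ≤ f.B := by positivity
  unfold absDiscr
  nlinarith

theorem hasSum_rep_mul {F : ℕ → ℝ} (hF : Summable fun v => F (f.val v)) :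
    HasSum (fun n => f.rep n * F n) (∑' v, F (f.val v)) := by
  let e := Equiv.sigmaFiberEquiv f.val
  have h1 : HasSum (fun x : Σ n, {v // f.val v = n} => F x.1) (∑' v, F (f.val v)) := by
    have := (e.hasSum_iff (f := fun v => F (f.val v))).2 hF.hasSum
    refine this.congr_fun ?_
    rintro ⟨n, v, hv⟩
    simp [e, hv]
  have h2 := h1.sigma fun n => (h1.summable.sigma_factor n).hasSum
  refine h2.congr_fun fun n => ?_
  simp [rep, tsum_const]

theorem summable_exp {s : ℝ} (hs : 0 < s) : Summable fun v => Real.exp (-s * f.val v) := by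
  refine (summable_gaussian_prod (δ := s / 2) (ε := s / 2) (by positivity)
    (by positivity)).of_nonneg_of_le (fun _ => (Real.exp_pos _).le) fun v => ?_
  rw [← Real.exp_add, Real.exp_le_exp]
  have h : (v.1 : ℝ) ^ 2 + v.2 ^ 2 ≤ 2 * f.val v := by exact_mod_cast f.sq_add_sq_le v
  nlinarith

theorem tsum_exp_inv {t : ℝ} (ht : 0 < t) :
    ∑' v, Real.exp (-(2 * Real.pi / √f.absDiscr * (1 / t)) * f.val v) =
      t * ∑' v, Real.exp (-(2 * Real.pi / √f.absDiscr * t) * f.val v) := by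
  have hd : (0 : ℝ) < f.absDiscr := by exact_mod_cast f.absDiscr_pos
  have hs : 0 < √(f.absDiscr : ℝ) := Real.sqrt_pos.2 hd
  have hA : (0 : ℝ) < f.A := by exact_mod_cast f.A_pos
  have hss : √(f.absDiscr : ℝ) ^ 2 = 4 * f.A * f.C - f.B ^ 2 := by
    rw [Real.sq_sqrt hd.le, absDiscr]
    push_cast
    rfl
  set α : ℝ := 2 * f.A / √(f.absDiscr : ℝ) with hα
  set β : ℝ := f.B / (2 * f.A) with hβ
  have hα0 : 0 < α := by positivity
  have key : ∀ s : ℝ, 0 < s →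
      ((∑' v, Real.exp (-(2 * Real.pi / √f.absDiscr * s) * f.val v) : ℝ) : ℂ) =
      ∑' n : ℤ, ∑' m : ℤ, cexp (-Real.pi * s * (α * (m + β * n) ^ 2 + n ^ 2 / α)) := by
    intro s hs0
    have hsum := f.summable_exp (s := 2 * Real.pi / √f.absDiscr * s) (by positivity)
    rw [← (Equiv.prodComm ℤ ℤ).tsum_eq]
    have hsum' := (Equiv.prodComm ℤ ℤ).summable_iff.2 hsum
    simp only [Function.comp_def] at hsum'
    rw [hsum'.tsum_prod, ofReal_tsum]
    refine tsum_congr fun n => ?_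
    rw [ofReal_tsum]
    refine tsum_congr fun m => ?_
    rw [ofReal_exp, real_val]
    have : -(2 * Real.pi / √(f.absDiscr : ℝ) * s) * (f.A * m ^ 2 + f.B * m * n + f.C * n ^ 2) =
        -Real.pi * s * (α * (m + β * n) ^ 2 + n ^ 2 / α) := by
      have hC : (f.C : ℝ) = (√(f.absDiscr : ℝ) ^ 2 + f.B ^ 2) / (4 * f.A) := by
        rw [hss]; field_simp; ring
      rw [hC, hα, hβ]
      field_simp
      ring
    congr 1
    simp only [Equiv.prodComm_apply, Prod.swap_prod_mk]
    rw [this]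
    push_cast
    ring
  have h := tsum_tsum_gaussian_inv (β := β) hα0 ht
  have h1 := key (1 / t) (by positivity)
  have h2 := key t ht
  push_cast at h1 h2
  rw [← h2] at h
  rw [← ofReal_inj]
  push_cast
  rw [h1, ← h]

end ReducedForm

section Embedding

variable {K : Type} [Field K] [NumberField K]

theorem exists_equiv_algHom (hdeg : Module.finrank ℚ K = 2) (himag : NumberField.discr K < 0) :
    ∃ (σ : K →ₐ[ℚ] ℂ) (e : Fin 2 ≃ (K →ₐ[ℚ] ℂ)),
      (∀ x, e 0 x = σ x) ∧ ∀ x, e 1 x = starRingEnd ℂ (σ x) := by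
  have hr := InfinitePlace.card_add_two_mul_card_eq_rank K
  have hs := NumberField.sign_discr K
  rw [Int.sign_eq_neg_one_of_neg himag] at hs
  have hr1 : InfinitePlace.nrComplexPlaces K ≠ 0 := by
    intro h
    rw [h] at hs
    norm_num at hs
  have hr0 : InfinitePlace.nrRealPlaces K = 0 := by lia
  obtain ⟨φ⟩ : Nonempty (K →+* ℂ) := inferInstance
  have hφ : ¬ ComplexEmbedding.IsReal φ := by
    intro h
    have h1 : (InfinitePlace.mk φ).IsReal := ⟨φ, h, rfl⟩
    exact (Fintype.card_eq_zero_iff.1 hr0).false ⟨_, h1⟩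
  let σ : K →ₐ[ℚ] ℂ := RingHom.equivRatAlgHom K ℂ φ
  let τ : K →ₐ[ℚ] ℂ := RingHom.equivRatAlgHom K ℂ ((starRingEnd ℂ).comp φ)
  have hne : σ ≠ τ := by
    intro h
    refine hφ (RingHom.ext fun x => ?_)
    exact (DFunLike.congr_fun h x).symm
  have hcard : Fintype.card (K →ₐ[ℚ] ℂ) = 2 := by rw [AlgHom.card, hdeg]
  have hinj : Function.Injective ![σ, τ] := by
    intro i j hij
    fin_cases i <;> fin_cases j
    · rfl
    · exact absurd hij hne
    · exact absurd hij.symm hne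
    · rfl
  have hbij : Function.Bijective ![σ, τ] :=
    (Fintype.bijective_iff_injective_and_card _).2 ⟨hinj, by simp [hcard]⟩
  exact ⟨σ, Equiv.ofBijective _ hbij, fun x => rfl, fun x => rfl⟩

theorem exists_embedding (hdeg : Module.finrank ℚ K = 2) (himag : NumberField.discr K < 0) :
    ∃ φ : 𝓞 K →+* ℂ, Function.Injective φ ∧
      (∀ x, (Ideal.absNorm (Ideal.span {x}) : ℝ) = normSq (φ x)) ∧
      ∀ b : Module.Basis (Fin 2) ℤ (𝓞 K), (φ (b 0) * starRingEnd ℂ (φ (b 1)) -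
        starRingEnd ℂ (φ (b 0)) * φ (b 1)) ^ 2 = NumberField.discr K := by
  obtain ⟨σ, e, h0, h1⟩ := exists_equiv_algHom hdeg himag
  refine ⟨(σ : K →+* ℂ).comp (algebraMap (𝓞 K) K), ?_, fun x => ?_, fun b => ?_⟩
  · exact (σ : K →+* ℂ).injective.comp (RingOfIntegers.coe_injective)
  · have hn := Algebra.norm_eq_prod_embeddings ℚ ℂ (x : K)
    rw [← e.prod_comp, Fin.prod_univ_two, h0, h1, mul_conj] at hn
    rw [← Algebra.coe_norm_int] at hn
    have hn' : ((Algebra.norm ℤ x : ℤ) : ℝ) = normSq (σ x) := by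
      rw [← ofReal_inj, ← hn]
      simp
    rw [Ideal.absNorm_span_singleton, ← Int.cast_natCast, Int.natCast_natAbs, Int.cast_abs, hn',
      abs_of_nonneg (normSq_nonneg _)]
    rfl
  · have hb := NumberField.discr_eq_discr K b
    have hq : Algebra.discr ℚ _ = _ := Algebra.discr_localizationLocalization ℤ
        (nonZeroDivisors ℤ) K b
    rw [hb] at hq
    have hd := Algebra.discr_eq_det_embeddingsMatrixReindex_pow_two ℚ ℂ
      (b.localizationLocalization ℚ (nonZeroDivisors ℤ) K) e
    rw [hq, Matrix.det_fin_two] at hd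
    simp only [Algebra.embeddingsMatrixReindex, Algebra.embeddingsMatrix, Matrix.reindex_apply,
      Matrix.submatrix_apply, Equiv.refl_symm, Equiv.refl_apply, Matrix.of_apply, Equiv.symm_symm,
      h0, h1, Module.Basis.localizationLocalization_apply] at hd
    rw [show (NumberField.discr K : ℂ) = algebraMap ℚ ℂ (algebraMap ℤ ℚ (NumberField.discr K)) by
      simp, hd]
    simp only [RingHom.comp_apply]
    change (σ _ * starRingEnd ℂ (σ _) - starRingEnd ℂ (σ _) * σ _) ^ 2 = _
    ring

end Embedding

section Lattice

variable {K : Type} [Field K] [NumberField K]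

/-- A pair of generators of the lattice `J`, with the discriminant of a basis. -/
structure IsLatticePair (φ : 𝓞 K →+* ℂ) (J : Ideal (𝓞 K)) (e₁ e₂ : 𝓞 K) : Prop where
  fst_mem : e₁ ∈ J
  snd_mem : e₂ ∈ J
  exists_eq : ∀ α ∈ J, ∃ x y : ℤ, α = x * e₁ + y * e₂
  discr_eq : (φ e₁ * starRingEnd ℂ (φ e₂) - starRingEnd ℂ (φ e₁) * φ e₂) ^ 2 =
    (Ideal.absNorm J : ℂ) ^ 2 * NumberField.discr K

variable {φ : 𝓞 K →+* ℂ} {J : Ideal (𝓞 K)} {e₁ e₂ : 𝓞 K}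

theorem IsLatticePair.swap (h : IsLatticePair φ J e₁ e₂) : IsLatticePair φ J e₂ e₁ where
  fst_mem := h.snd_mem
  snd_mem := h.fst_mem
  exists_eq α hα := by
    obtain ⟨x, y, rfl⟩ := h.exists_eq α hα
    exact ⟨y, x, add_comm _ _⟩
  discr_eq := by rw [← h.discr_eq]; ring

theorem IsLatticePair.neg (h : IsLatticePair φ J e₁ e₂) : IsLatticePair φ J e₁ (-e₂) where
  fst_mem := h.fst_mem
  snd_mem := J.neg_mem h.snd_mem
  exists_eq α hα := by
    obtain ⟨x, y, rfl⟩ := h.exists_eq α hα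
    exact ⟨x, -y, by push_cast; ring⟩
  discr_eq := by rw [← h.discr_eq]; simp only [map_neg]; ring

theorem IsLatticePair.sub (h : IsLatticePair φ J e₁ e₂) : IsLatticePair φ J e₁ (e₂ - e₁) where
  fst_mem := h.fst_mem
  snd_mem := J.sub_mem h.snd_mem h.fst_mem
  exists_eq α hα := by
    obtain ⟨x, y, rfl⟩ := h.exists_eq α hα
    exact ⟨x + y, y, by push_cast; ring⟩
  discr_eq := by rw [← h.discr_eq]; simp only [map_sub]; ring

theorem exists_isLatticePair (hdeg : Module.finrank ℚ K = 2)
    (hφ : ∀ b : Module.Basis (Fin 2) ℤ (𝓞 K), (φ (b 0) * starRingEnd ℂ (φ (b 1)) -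
        starRingEnd ℂ (φ (b 0)) * φ (b 1)) ^ 2 = NumberField.discr K) (hJ : J ≠ ⊥) :
    ∃ e₁ e₂, IsLatticePair φ J e₁ e₂ := by
  have hcard : Module.finrank ℤ (𝓞 K) = 2 := by rw [RingOfIntegers.rank, hdeg]
  let b : Module.Basis (Fin 2) ℤ (𝓞 K) := Module.finBasisOfFinrankEq ℤ (𝓞 K) hcard
  let bJ := Ideal.selfBasis b J hJ
  refine ⟨bJ 0, bJ 1, (bJ 0).2, (bJ 1).2, fun α hα => ?_, ?_⟩
  · refine ⟨bJ.repr ⟨α, hα⟩ 0, bJ.repr ⟨α, hα⟩ 1, ?_⟩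
    have := congrArg Subtype.val (bJ.sum_repr ⟨α, hα⟩)
    rw [Fin.sum_univ_two] at this
    simpa using this.symm
  · have hdet := Ideal.natAbs_det_basis_change b J bJ
    rw [Module.Basis.det_apply, Matrix.det_fin_two] at hdet
    set P := b.toMatrix (Subtype.val ∘ bJ) with hP
    have h0 : ∀ i, φ (bJ i) = P 0 i * φ (b 0) + P 1 i * φ (b 1) := by
      intro i
      have := b.sum_toMatrix_smul_self (Subtype.val ∘ bJ) i
      rw [Fin.sum_univ_two] at this
      simp only [Function.comp_apply] at this
      rw [← this]
      simp [← hP]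
    have hN : (Ideal.absNorm J : ℂ) ^ 2 = (P 0 0 * P 1 1 - P 0 1 * P 1 0 : ℂ) ^ 2 := by
      rw [← hdet]
      have := congrArg (Int.cast : ℤ → ℂ) (Int.natAbs_sq (P 0 0 * P 1 1 - P 0 1 * P 1 0))
      rw [Nat.cast_natAbs]
      push_cast at this ⊢
      exact this
    rw [hN, ← hφ b, h0, h0]
    simp only [map_add, map_mul, map_intCast]
    ring

theorem exists_reducedForm (hdeg : Module.finrank ℚ K = 2)
    (hnorm : ∀ x, (Ideal.absNorm (Ideal.span {x}) : ℝ) = normSq (φ x))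
    (hφ : ∀ b : Module.Basis (Fin 2) ℤ (𝓞 K), (φ (b 0) * starRingEnd ℂ (φ (b 1)) -
        starRingEnd ℂ (φ (b 0)) * φ (b 1)) ^ 2 = NumberField.discr K)
    (himag : NumberField.discr K < 0) (hJ : J ≠ ⊥) :
    ∃ (f : ReducedForm) (e₁ e₂ : 𝓞 K), IsLatticePair φ J e₁ e₂ ∧
      (f.absDiscr : ℤ) = -NumberField.discr K ∧
      ∀ v : ℤ × ℤ, Ideal.absNorm (Ideal.span {v.1 * e₁ + v.2 * e₂}) =
        Ideal.absNorm J * f.val v := by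
  set N : 𝓞 K → ℕ := fun x => Ideal.absNorm (Ideal.span {x}) with hN
  have hNreal : ∀ x, (N x : ℝ) = normSq (φ x) := hnorm
  have hJ0 : 0 < Ideal.absNorm J := Nat.pos_of_ne_zero (by rwa [Ne, Ideal.absNorm_eq_zero_iff])
  have hJr : (0 : ℝ) < Ideal.absNorm J := by exact_mod_cast hJ0
  have hdvd : ∀ x ∈ J, Ideal.absNorm J ∣ N x := fun x hx =>
    Ideal.absNorm_dvd_absNorm_of_le ((Ideal.span_singleton_le_iff_mem J).2 hx)
  have hneg : ∀ x, N (-x) = N x := fun x => by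
    simp only [hN, Ideal.span_singleton_neg]
  -- a pair minimising the sum of the norms
  have hex : ∃ m, ∃ e₁ e₂, IsLatticePair φ J e₁ e₂ ∧ N e₁ + N e₂ = m := by
    obtain ⟨e₁, e₂, h⟩ := exists_isLatticePair hdeg hφ hJ
    exact ⟨_, e₁, e₂, h, rfl⟩
  have hmin : ∀ e₁ e₂, IsLatticePair φ J e₁ e₂ → Nat.find hex ≤ N e₁ + N e₂ :=
    fun e₁ e₂ h => Nat.find_min' hex ⟨e₁, e₂, h, rfl⟩
  obtain ⟨e₁, e₂, h, hm, hle⟩ : ∃ e₁ e₂, IsLatticePair φ J e₁ e₂ ∧ N e₁ + N e₂ = Nat.find hex ∧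
      N e₁ ≤ N e₂ := by
    obtain ⟨e₁, e₂, h, hm⟩ := Nat.find_spec hex
    rcases le_total (N e₁) (N e₂) with hle | hle
    · exact ⟨e₁, e₂, h, hm, hle⟩
    · exact ⟨e₂, e₁, h.swap, by rw [add_comm, hm], hle⟩
  have hpar : ∀ x y, (N (x + y) : ℤ) + N (x - y) = 2 * N x + 2 * N y := by
    intro x y
    have : (N (x + y) : ℝ) + N (x - y) = 2 * N x + 2 * N y := by
      simp only [hNreal, map_add, map_sub, normSq_apply, add_re, sub_re, add_im, sub_im]
      ring
    exact_mod_cast this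
  obtain ⟨e₁, e₂, h, hm, hle, hB⟩ : ∃ e₁ e₂, IsLatticePair φ J e₁ e₂ ∧
      N e₁ + N e₂ = Nat.find hex ∧ N e₁ ≤ N e₂ ∧ N e₁ + N e₂ ≤ N (e₁ + e₂) := by
    by_cases hB : N e₁ + N e₂ ≤ N (e₁ + e₂)
    · exact ⟨e₁, e₂, h, hm, hle, hB⟩
    · refine ⟨e₁, -e₂, h.neg, by rw [hneg, hm], by rwa [hneg], ?_⟩
      have := hpar e₁ e₂
      rw [hneg, ← sub_eq_add_neg]
      lia
  obtain ⟨A, hA⟩ := hdvd e₁ h.fst_mem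
  obtain ⟨C, hC⟩ := hdvd e₂ h.snd_mem
  obtain ⟨S, hS⟩ := hdvd (e₁ + e₂) (J.add_mem h.fst_mem h.snd_mem)
  have hAC : A + C ≤ S := by
    rw [hA, hC, hS, ← mul_add] at hB
    exact Nat.le_of_mul_le_mul_left hB hJ0
  have hle' : A ≤ C := by
    rw [hA, hC] at hle
    exact Nat.le_of_mul_le_mul_left hle hJ0
  have hBA : S - (A + C) ≤ A := by
    have h1 := hmin _ _ h.sub
    rw [← hm] at h1
    have h2 := hpar e₁ e₂
    have h3 : N (e₂ - e₁) = N (e₁ - e₂) := by rw [← hneg, neg_sub]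
    have h4 : Ideal.absNorm J * S ≤ Ideal.absNorm J * (2 * A + C) := by
      rw [← hS]
      have e3 : Ideal.absNorm J * (2 * A + C) = 2 * N e₁ + N e₂ := by rw [hA, hC]; ring
      lia
    have := Nat.le_of_mul_le_mul_left h4 hJ0
    lia
  have hA' : (Ideal.absNorm J : ℝ) * A = normSq (φ e₁) := by rw [← hNreal, hA]; push_cast; rfl
  have hC' : (Ideal.absNorm J : ℝ) * C = normSq (φ e₂) := by rw [← hNreal, hC]; push_cast; rfl
  have hB' : (Ideal.absNorm J : ℝ) * (S - (A + C) : ℕ) =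
      2 * ((φ e₁).re * (φ e₂).re + (φ e₁).im * (φ e₂).im) := by
    rw [Nat.cast_sub hAC, mul_sub, Nat.cast_add, mul_add, hA', hC',
      show (Ideal.absNorm J : ℝ) * S = N (e₁ + e₂) by rw [hS]; push_cast; rfl, hNreal, map_add]
    simp only [normSq_apply, add_re, add_im]
    ring
  have hdisc : (Ideal.absNorm J : ℝ) ^ 2 * NumberField.discr K =
      -4 * ((φ e₁).re * (φ e₂).im - (φ e₁).im * (φ e₂).re) ^ 2 := by
    have h1 := congrArg Complex.re h.discr_eq
    have e1 : ((Ideal.absNorm J : ℂ) ^ 2 * NumberField.discr K) =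
        (((Ideal.absNorm J : ℝ) ^ 2 * NumberField.discr K : ℝ) : ℂ) := by push_cast; rfl
    rw [e1, ofReal_re] at h1
    rw [← h1]
    simp [pow_two]
    ring
  have hA0 : A ≠ 0 := by
    rintro rfl
    rw [Nat.cast_zero, mul_zero] at hA'
    have h2 := normSq_eq_zero.1 hA'.symm
    rw [h2] at hdisc
    simp only [zero_re, zero_im] at hdisc
    have : (NumberField.discr K : ℝ) < 0 := by exact_mod_cast himag
    nlinarith [pow_pos hJr 2]
  refine ⟨⟨A, S - (A + C), C, Nat.pos_of_ne_zero hA0, hBA, hle'⟩, e₁, e₂, h, ?_, ?_⟩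
  · have h2 : (Ideal.absNorm J : ℝ) ^ 2 * ((4 * A * C - (S - (A + C) : ℕ) ^ 2 : ℤ) : ℝ) =
        (Ideal.absNorm J : ℝ) ^ 2 * ((-NumberField.discr K : ℤ) : ℝ) := by
      rw [Int.cast_neg, mul_neg, hdisc]
      push_cast
      rw [show (Ideal.absNorm J : ℝ) ^ 2 * (4 * A * C - ((S - (A + C) : ℕ) : ℝ) ^ 2) =
        4 * (Ideal.absNorm J * A) * (Ideal.absNorm J * C) -
          (Ideal.absNorm J * ((S - (A + C) : ℕ) : ℝ)) ^ 2 by ring, hA', hC', hB']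
      simp only [normSq_apply]
      ring
    have h3 := mul_left_cancel₀ (pow_pos hJr 2).ne' h2
    simp only [ReducedForm.absDiscr]
    exact Int.cast_injective h3
  · intro v
    have : (Ideal.absNorm (Ideal.span {v.1 * e₁ + v.2 * e₂}) : ℝ) =
        Ideal.absNorm J * ReducedForm.val ⟨A, S - (A + C), C, Nat.pos_of_ne_zero hA0, hBA, hle'⟩
            v := by
      rw [ReducedForm.real_val, hnorm, mul_add, mul_add]
      simp only
      rw [show (Ideal.absNorm J : ℝ) * (A * v.1 ^ 2) = (Ideal.absNorm J * A) * v.1 ^ 2 by ring,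
        show (Ideal.absNorm J : ℝ) * (C * v.2 ^ 2) = (Ideal.absNorm J * C) * v.2 ^ 2 by ring,
        show (Ideal.absNorm J : ℝ) * ((S - (A + C) : ℕ) * v.1 * v.2) =
          (Ideal.absNorm J * (S - (A + C) : ℕ)) * v.1 * v.2 by ring, hA', hB', hC']
      simp only [map_add, map_mul, map_intCast, normSq_apply, add_re, add_im, mul_re, mul_im,
        intCast_re, intCast_im]
      ring
    exact_mod_cast this

end Lattice

section ClassForms

variable {K : Type} [Field K] [NumberField K]

theorem card_mem_absNorm_eq {J : Ideal (𝓞 K)} (hJ : J ≠ ⊥) {n : ℕ} (hn : n ≠ 0) :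
    Nat.card {α : 𝓞 K // α ∈ J ∧ Ideal.absNorm (Ideal.span {α}) = Ideal.absNorm J * n} =
      Nat.card (𝓞 K)ˣ * {I ∈ idealsOfNorm K n | (I * J).IsPrincipal}.card := by
  have hJ0 : Ideal.absNorm J ≠ 0 := by rwa [Ne, Ideal.absNorm_eq_zero_iff]
  have hgen : ∀ I : {I // I ∈ {I ∈ idealsOfNorm K n | (I * J).IsPrincipal}},
      ∃ g : 𝓞 K, Ideal.span {g} = I.1 * J := by
    rintro ⟨I, hI⟩
    obtain ⟨g, hg⟩ := ((Finset.mem_filter.1 hI).2).principal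
    exact ⟨g, hg.symm⟩
  choose g hg using hgen
  have hnorm : ∀ I, Ideal.absNorm (Ideal.span {g I}) = Ideal.absNorm J * n := by
    rintro ⟨I, hI⟩
    rw [hg, map_mul, mul_comm]
    congr 1
    simpa using (Finset.mem_filter.1 hI).1
  have hg0 : ∀ I, g I ≠ 0 := by
    intro I h0
    have := hnorm I
    rw [h0] at this
    simp [hJ0] at this
    exact hn this
  have hspan : ∀ (u : (𝓞 K)ˣ) (x : 𝓞 K), Ideal.span {u * x} = Ideal.span {x} := fun u x =>
    Ideal.span_singleton_mul_left_unit u.isUnit x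
  rw [← Nat.card_eq_finsetCard, ← Nat.card_prod]
  refine (Nat.card_congr (Equiv.ofBijective (fun p : (𝓞 K)ˣ × _ =>
    (⟨p.1 * g p.2, ?_, ?_⟩ : {α : 𝓞 K // α ∈ J ∧ Ideal.absNorm (Ideal.span {α}) =
      Ideal.absNorm J * n})) ⟨?_, ?_⟩)).symm
  · rw [← Ideal.span_singleton_le_iff_mem, hspan, hg]
    exact Ideal.mul_le_right
  · rw [hspan, hnorm]
  · rintro ⟨u, I⟩ ⟨v, I'⟩ h
    have h1 := congrArg Subtype.val h
    simp only at h1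
    have h2 : I = I' := by
      have h3 := congrArg (fun x : 𝓞 K => Ideal.span {x}) h1
      simp only [hspan, hg] at h3
      exact Subtype.ext (mul_right_cancel₀ hJ h3)
    subst h2
    rw [Units.ext (mul_right_cancel₀ (hg0 I) h1)]
  · rintro ⟨α, hα, hα'⟩
    obtain ⟨I, hI⟩ := Ideal.dvd_iff_le.2 ((Ideal.span_singleton_le_iff_mem J).2 hα)
    have hI' : I ∈ {I ∈ idealsOfNorm K n | (I * J).IsPrincipal} := by
      rw [Finset.mem_filter, mem_idealsOfNorm]
      refine ⟨?_, ⟨⟨α, by rw [mul_comm, ← hI]⟩⟩⟩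
      rw [hI, map_mul] at hα'
      exact mul_left_cancel₀ hJ0 hα'
    obtain ⟨u, hu⟩ := Ideal.span_singleton_eq_span_singleton.1
      (show Ideal.span {g ⟨I, hI'⟩} = Ideal.span {α} by rw [hg, hI, mul_comm])
    exact ⟨⟨u, ⟨I, hI'⟩⟩, Subtype.ext ((mul_comm _ _).trans hu)⟩

/-- A lattice pair in `J` on which the norm form is `N(J)` times the reduced form `f`. -/
structure IsFormBasis (φ : 𝓞 K →+* ℂ) (J : Ideal (𝓞 K)) (f : ReducedForm) (e₁ e₂ : 𝓞 K) :
    Prop extends IsLatticePair φ J e₁ e₂ where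
  ne_bot : J ≠ ⊥
  absNorm_eq : ∀ v : ℤ × ℤ, Ideal.absNorm (Ideal.span {v.1 * e₁ + v.2 * e₂}) =
        Ideal.absNorm J * f.val v

namespace IsFormBasis

variable {φ : 𝓞 K →+* ℂ} {J J' : Ideal (𝓞 K)} {f : ReducedForm} {e₁ e₂ e₁' e₂' : 𝓞 K}

theorem rep_eq (h : IsFormBasis φ J f e₁ e₂) {n : ℕ} (hn : n ≠ 0) :
    f.rep n = Nat.card (𝓞 K)ˣ * {I ∈ idealsOfNorm K n | (I * J).IsPrincipal}.card := by
  have hJ0 : Ideal.absNorm J ≠ 0 := by rw [Ne, Ideal.absNorm_eq_zero_iff]; exact h.ne_bot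
  rw [← card_mem_absNorm_eq h.ne_bot hn]
  refine Nat.card_congr (Equiv.ofBijective (fun v => ⟨v.1.1 * e₁ + v.1.2 * e₂, ?_, ?_⟩) ⟨?_, ?_⟩)
  · exact J.add_mem (J.mul_mem_left _ h.fst_mem) (J.mul_mem_left _ h.snd_mem)
  · rw [h.absNorm_eq, v.2]
  · rintro ⟨v, hv⟩ ⟨v', hv'⟩ hvv
    have h1 := congrArg Subtype.val hvv
    simp only at h1
    have h2 := h.absNorm_eq (v - v')
    have h3 : ((v - v').1 * e₁ + (v - v').2 * e₂ : 𝓞 K) = 0 := by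
      rw [Prod.fst_sub, Prod.snd_sub]
      push_cast
      linear_combination h1
    rw [h3] at h2
    simp [hJ0, f.val_eq_zero, sub_eq_zero] at h2
    exact Subtype.ext h2
  · rintro ⟨α, hα, hα'⟩
    obtain ⟨x, y, rfl⟩ := h.exists_eq α hα
    refine ⟨⟨(x, y), ?_⟩, rfl⟩
    have := h.absNorm_eq (x, y)
    simp only at this
    rw [this] at hα'
    exact mul_left_cancel₀ hJ0 hα'

theorem isPrincipal_of_A_eq_one (h : IsFormBasis φ J f e₁ e₂) (hA : f.A = 1) :
    J.IsPrincipal := by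
  have h1 := h.absNorm_eq (1, 0)
  have h2 : f.val (1, 0) = 1 := by simp [ReducedForm.val, hA]
  rw [h2] at h1
  simp only [Int.cast_one, one_mul, Int.cast_zero, zero_mul, add_zero, mul_one] at h1
  have h3 : Ideal.span {e₁} ≤ J := (Ideal.span_singleton_le_iff_mem J).2 h.fst_mem
  obtain ⟨I, hI⟩ := Ideal.dvd_iff_le.2 h3
  have hJ0 : Ideal.absNorm J ≠ 0 := by rw [Ne, Ideal.absNorm_eq_zero_iff]; exact h.ne_bot
  rw [hI, map_mul] at h1
  have h4 : Ideal.absNorm I = 1 := mul_left_cancel₀ hJ0 (by rw [h1, mul_one])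
  rw [Ideal.absNorm_eq_one_iff] at h4
  rw [h4, Ideal.mul_top] at hI
  exact ⟨⟨e₁, hI.symm⟩⟩

theorem normSq_fst (h : IsFormBasis φ J f e₁ e₂)
    (hnorm : ∀ x, (Ideal.absNorm (Ideal.span {x}) : ℝ) = normSq (φ x)) :
    normSq (φ e₁) = Ideal.absNorm J * f.A := by
  have := h.absNorm_eq (1, 0)
  simp only [Int.cast_one, one_mul, Int.cast_zero, zero_mul, add_zero] at this
  rw [← hnorm, this]
  push_cast
  rw [ReducedForm.real_val]
  simp

theorem normSq_snd (h : IsFormBasis φ J f e₁ e₂)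
    (hnorm : ∀ x, (Ideal.absNorm (Ideal.span {x}) : ℝ) = normSq (φ x)) :
    normSq (φ e₂) = Ideal.absNorm J * f.C := by
  have := h.absNorm_eq (0, 1)
  simp only [Int.cast_one, one_mul, Int.cast_zero, zero_mul, zero_add] at this
  rw [← hnorm, this]
  push_cast
  rw [ReducedForm.real_val]
  simp

theorem two_mul_re (h : IsFormBasis φ J f e₁ e₂)
    (hnorm : ∀ x, (Ideal.absNorm (Ideal.span {x}) : ℝ) = normSq (φ x)) :
    2 * (φ e₂ * starRingEnd ℂ (φ e₁)).re = Ideal.absNorm J * f.B := by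
  have h1 := h.absNorm_eq (1, 1)
  simp only [Int.cast_one, one_mul] at h1
  have h2 := hnorm (e₁ + e₂)
  rw [h1, map_add] at h2
  push_cast at h2
  rw [ReducedForm.real_val] at h2
  have h3 := h.normSq_fst hnorm
  have h4 := h.normSq_snd hnorm
  simp only [normSq_apply, add_re, add_im] at h2 h3 h4
  simp only [mul_re, conj_re, conj_im]
  push_cast at h2
  linear_combination -h3 - h4 - h2

theorem four_mul_im_sq (h : IsFormBasis φ J f e₁ e₂)
    (hnorm : ∀ x, (Ideal.absNorm (Ideal.span {x}) : ℝ) = normSq (φ x)) :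
    4 * (φ e₂ * starRingEnd ℂ (φ e₁)).im ^ 2 = (Ideal.absNorm J : ℝ) ^ 2 * f.absDiscr := by
  have h2 := h.two_mul_re hnorm
  have h3 := h.normSq_fst hnorm
  have h4 := h.normSq_snd hnorm
  have h5 : normSq (φ e₂ * starRingEnd ℂ (φ e₁)) = normSq (φ e₂) * normSq (φ e₁) := by
    rw [map_mul, normSq_conj]
  rw [normSq_apply, h3, h4] at h5
  rw [ReducedForm.absDiscr]
  push_cast
  linear_combination 4 * h5 -
    (2 * (φ e₂ * starRingEnd ℂ (φ e₁)).re + Ideal.absNorm J * f.B) * h2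

theorem mul_eq_mul (h : IsFormBasis φ J f e₁ e₂) (h' : IsFormBasis φ J' f e₁' e₂')
    (hinj : Function.Injective φ)
    (hnorm : ∀ x, (Ideal.absNorm (Ideal.span {x}) : ℝ) = normSq (φ x))
    (hs : 0 ≤ (φ e₂ * starRingEnd ℂ (φ e₁)).im ↔ 0 ≤ (φ e₂' * starRingEnd ℂ (φ e₁')).im) :
    e₂ * e₁' = e₂' * e₁ := by
  have hA : (f.A : ℝ) ≠ 0 := by exact_mod_cast f.A_pos.ne'
  have hJ0 : (0 : ℝ) < Ideal.absNorm J := by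
    exact_mod_cast Nat.pos_of_ne_zero (by rw [Ne, Ideal.absNorm_eq_zero_iff]; exact h.ne_bot)
  have hJ0' : (0 : ℝ) < Ideal.absNorm J' := by
    exact_mod_cast Nat.pos_of_ne_zero (by rw [Ne, Ideal.absNorm_eq_zero_iff]; exact h'.ne_bot)
  have h3 := h.normSq_fst hnorm
  have h3' := h'.normSq_fst hnorm
  have hp : φ e₁ ≠ 0 := fun h0 => by
    rw [h0, map_zero] at h3
    exact mul_ne_zero hJ0.ne' hA h3.symm
  have hp' : φ e₁' ≠ 0 := fun h0 => by
    rw [h0, map_zero] at h3'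
    exact mul_ne_zero hJ0'.ne' hA h3'.symm
  have hre := h.two_mul_re hnorm
  have hre' := h'.two_mul_re hnorm
  have him := h.four_mul_im_sq hnorm
  have him' := h'.four_mul_im_sq hnorm
  set u := φ e₂ * starRingEnd ℂ (φ e₁)
  set u' := φ e₂' * starRingEnd ℂ (φ e₁')
  have e1 : (Ideal.absNorm J' : ℝ) * u.re = Ideal.absNorm J * u'.re := by
    linear_combination (Ideal.absNorm J' : ℝ) / 2 * hre - (Ideal.absNorm J : ℝ) / 2 * hre'
  have e2 : (Ideal.absNorm J' : ℝ) * u.im = Ideal.absNorm J * u'.im := by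
    have hsq : ((Ideal.absNorm J' : ℝ) * u.im) ^ 2 = (Ideal.absNorm J * u'.im) ^ 2 := by
      linear_combination (Ideal.absNorm J' : ℝ) ^ 2 / 4 * him - (Ideal.absNorm J : ℝ) ^ 2 / 4 * him'
    rcases le_or_gt 0 u.im with h0 | h0
    · exact (pow_left_inj₀ (mul_nonneg hJ0'.le h0) (mul_nonneg hJ0.le (hs.1 h0)) two_ne_zero).1 hsq
    · have h1 : u'.im < 0 := not_le.1 fun h1 => not_le.2 h0 (hs.2 h1)
      have := (pow_left_inj₀ (a := -((Ideal.absNorm J' : ℝ) * u.im))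
        (b := -(Ideal.absNorm J * u'.im)) (by nlinarith) (by nlinarith) two_ne_zero).1
        (by rw [neg_sq, neg_sq, hsq])
      linarith
  have e3 : (Ideal.absNorm J' : ℂ) * u = Ideal.absNorm J * u' := by
    apply Complex.ext
    · simpa using e1
    · simpa using e2
  have e4 : φ e₁ * starRingEnd ℂ (φ e₁) = Ideal.absNorm J * f.A := by
    rw [mul_conj, h3]; push_cast; rfl
  have e4' : φ e₁' * starRingEnd ℂ (φ e₁') = Ideal.absNorm J' * f.A := by
    rw [mul_conj, h3']; push_cast; rfl
  apply hinj
  rw [map_mul, map_mul]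
  have hc : starRingEnd ℂ (φ e₁) * starRingEnd ℂ (φ e₁') ≠ 0 :=
    mul_ne_zero ((map_ne_zero _).2 hp) ((map_ne_zero _).2 hp')
  refine mul_right_cancel₀ hc ?_
  calc _ = u * (φ e₁' * starRingEnd ℂ (φ e₁')) := by simp only [u]; ring
    _ = u' * (φ e₁ * starRingEnd ℂ (φ e₁)) := by rw [e4, e4']; linear_combination f.A * e3
    _ = _ := by simp only [u']; ring

theorem fst_ne_zero (h : IsFormBasis φ J f e₁ e₂)
    (hnorm : ∀ x, (Ideal.absNorm (Ideal.span {x}) : ℝ) = normSq (φ x)) : e₁ ≠ 0 := by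
  rintro rfl
  have h3 := h.normSq_fst hnorm
  rw [map_zero, map_zero, eq_comm, mul_eq_zero, Nat.cast_eq_zero, Nat.cast_eq_zero,
    Ideal.absNorm_eq_zero_iff] at h3
  exact h3.elim h.ne_bot f.A_pos.ne'

theorem span_mul_le (h : IsFormBasis φ J f e₁ e₂) (h' : IsFormBasis φ J' f e₁' e₂')
    (he : e₂ * e₁' = e₂' * e₁) : Ideal.span {e₁'} * J ≤ Ideal.span {e₁} * J' := by
  refine Ideal.mul_le.2 fun r hr s hs => ?_
  obtain ⟨c, rfl⟩ := Ideal.mem_span_singleton'.1 hr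
  obtain ⟨x, y, rfl⟩ := h.exists_eq s hs
  have : c * e₁' * (x * e₁ + y * e₂) = e₁ * (c * (x * e₁' + y * e₂')) := by
    linear_combination c * y * he
  rw [this]
  exact Ideal.mul_mem_mul (Ideal.mem_span_singleton_self _) (J'.mul_mem_left _
    (J'.add_mem (J'.mul_mem_left _ h'.fst_mem) (J'.mul_mem_left _ h'.snd_mem)))

end IsFormBasis

theorem exists_formSystem (hdeg : Module.finrank ℚ K = 2) (himag : NumberField.discr K < 0) :
    ∃ (f : ClassGroup (𝓞 K) → ReducedForm) (s : ClassGroup (𝓞 K) → Bool),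
      Function.Injective (fun i => (f i, s i)) ∧
      (∀ i, (f i).absDiscr = -NumberField.discr K) ∧ (∀ i, (f i).A = 1 → i = 1) ∧
      ∀ n, n ≠ 0 → ∑ i, (f i).rep n = Nat.card (𝓞 K)ˣ * (idealsOfNorm K n).card := by
  obtain ⟨φ, hinj, hnorm, hφ⟩ := exists_embedding hdeg himag
  choose J hJ using ClassGroup.mk0_surjective (R := 𝓞 K)
  have hJ0 : ∀ i, (J i : Ideal (𝓞 K)) ≠ ⊥ := fun i => nonZeroDivisors.coe_ne_zero _
  choose f e₁ e₂ h1 h2 h3 using fun i => exists_reducedForm hdeg hnorm hφ himag (hJ0 i)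
  have h : ∀ i, IsFormBasis φ (J i) (f i) (e₁ i) (e₂ i) := fun i =>
    { h1 i with ne_bot := hJ0 i, absNorm_eq := h3 i }
  refine ⟨f, fun i => decide (0 ≤ (φ (e₂ i) * starRingEnd ℂ (φ (e₁ i))).im), ?_, h2, ?_, ?_⟩
  · intro i j hij
    simp only [Prod.mk.injEq, decide_eq_decide] at hij
    have hj := h j
    rw [← hij.1] at hj
    have he := (h i).mul_eq_mul hj hinj hnorm hij.2
    rw [← hJ i, ← hJ j, ClassGroup.mk0_eq_mk0_iff]
    exact ⟨e₁ j, e₁ i, hj.fst_ne_zero hnorm, (h i).fst_ne_zero hnorm,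
      le_antisymm ((h i).span_mul_le hj he) (hj.span_mul_le (h i) he.symm)⟩
  · intro i hi
    have := (h i).isPrincipal_of_A_eq_one hi
    rw [← hJ i]
    exact (ClassGroup.mk0_eq_one_iff (J i).2).2 this
  · intro n hn
    simp_rw [fun i => (h i).rep_eq hn]
    rw [← Finset.mul_sum]
    congr 1
    have hnz : ∀ I ∈ idealsOfNorm K n, I ∈ nonZeroDivisors (Ideal (𝓞 K)) := by
      intro I hI
      rw [mem_nonZeroDivisors_iff_ne_zero]
      rintro rfl
      rw [mem_idealsOfNorm, Ideal.zero_eq_bot, Ideal.absNorm_bot] at hI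
      exact hn hI.symm
    let c : Ideal (𝓞 K) → ClassGroup (𝓞 K) := fun I =>
      if hI : I ∈ nonZeroDivisors (Ideal (𝓞 K)) then (ClassGroup.mk0 ⟨I, hI⟩)⁻¹ else 1
    rw [Finset.card_eq_sum_card_fiberwise (f := c) (t := Finset.univ) (fun _ _ => by simp)]
    refine Finset.sum_congr rfl fun i _ => congrArg _ (Finset.filter_congr fun I hI => ?_)
    have hI' := hnz I hI
    simp only [c, hI', dif_pos]
    have e : ((ClassGroup.mk0 ⟨I, hI'⟩)⁻¹ = i) ↔ ClassGroup.mk0 (⟨I, hI'⟩ * J i) = 1 := by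
      rw [map_mul, hJ, inv_eq_iff_mul_eq_one]
    rw [e]
    exact (ClassGroup.mk0_eq_one_iff (mul_mem hI' (J i).2)).symm

end ClassForms

namespace ReducedForm

variable (f : ReducedForm)

theorem mem_box_of_val_eq {n b : ℕ} (hb : 2 * n < (b + 1) ^ 2) {v : ℤ × ℤ} (hv : f.val v = n) :
    v ∈ Finset.Icc (-b : ℤ) b ×ˢ Finset.Icc (-b : ℤ) b := by
  have h := f.sq_add_sq_le v
  rw [hv] at h
  have hb' : 2 * (n : ℤ) < (b + 1) ^ 2 := by exact_mod_cast hb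
  have key : ∀ x : ℤ, x ^ 2 < (b + 1) ^ 2 → x ∈ Finset.Icc (-b : ℤ) b := by
    intro x hx
    have := abs_lt_of_sq_lt_sq hx (by positivity)
    rw [abs_lt] at this
    rw [Finset.mem_Icc]
    constructor <;> lia
  rw [Finset.mem_product]
  exact ⟨key _ (by nlinarith [sq_nonneg v.2]), key _ (by nlinarith [sq_nonneg v.1])⟩

theorem rep_eq_card {n b : ℕ} (hb : 2 * n < (b + 1) ^ 2) :
    f.rep n = ((Finset.Icc (-b : ℤ) b ×ˢ Finset.Icc (-b : ℤ) b).filter (f.val · = n)).card := by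
  rw [rep, ← Nat.card_eq_finsetCard]
  refine Nat.card_congr (Equiv.subtypeEquivRight fun v => ?_)
  rw [Finset.mem_filter]
  exact ⟨fun h => ⟨f.mem_box_of_val_eq hb h, h⟩, fun h => h.2⟩

theorem rep_pos (v : ℤ × ℤ) : 0 < f.rep (f.val v) := by
  have hb : 2 * f.val v < (2 * f.val v + 1) ^ 2 := by nlinarith
  rw [f.rep_eq_card hb]
  exact Finset.card_pos.2 ⟨v, Finset.mem_filter.2 ⟨f.mem_box_of_val_eq hb rfl, rfl⟩⟩

theorem rep_one_eq_zero (hA : 2 ≤ f.A) : f.rep 1 = 0 := by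
  rw [rep, Nat.card_eq_zero]
  left
  refine ⟨fun ⟨v, hv⟩ => ?_⟩
  have h := f.add_le_two_mul v
  rw [← f.coe_val, hv] at h
  have h1 : (2 : ℤ) ≤ f.A := by exact_mod_cast hA
  have h2 : (2 : ℤ) ≤ f.C := by exact_mod_cast hA.trans f.A_le
  have h3 : v.1 ^ 2 + v.2 ^ 2 ≤ 1 := by
    push_cast at h
    nlinarith [mul_nonneg (sub_nonneg.2 h1) (sq_nonneg v.1),
      mul_nonneg (sub_nonneg.2 h2) (sq_nonneg v.2)]
  have hc := f.coe_val v
  rw [hv] at hc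
  have hz : v.1 = 0 ∨ v.2 = 0 := by
    by_contra! hne
    have h4 : 0 < v.1 ^ 2 := by have := hne.1; positivity
    have h5 : 0 < v.2 ^ 2 := by have := hne.2; positivity
    lia
  push_cast at hc
  rcases hz with h0 | h0
  · rw [h0] at hc
    have : v.2 ^ 2 = 0 ∨ 1 ≤ v.2 ^ 2 := by have := sq_nonneg v.2; lia
    rcases this with h4 | h4 <;> nlinarith
  · rw [h0] at hc
    have : v.1 ^ 2 = 0 ∨ 1 ≤ v.1 ^ 2 := by have := sq_nonneg v.1; lia
    rcases this with h4 | h4 <;> nlinarith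

end ReducedForm

section FormSystem

/-- The combinatorial data attached to an imaginary quadratic field: one reduced form for each
ideal class, whose representation numbers add up to `w` times the number of ideals. -/
structure FormSystem (ι : Type) [Fintype ι] (a : ℕ → ℝ) (d : ℤ) (w : ℕ) where
  form : ι → ReducedForm
  sign : ι → Bool
  one : ι
  injective : Function.Injective fun i => (form i, sign i)
  absDiscr_eq : ∀ i, (form i).absDiscr = -d
  eq_one : ∀ i, (form i).A = 1 → i = one
  sum_rep : ∀ n, n ≠ 0 → (∑ i, (form i).rep n : ℝ) = w * a n

variable {ι : Type} [Fintype ι] {a : ℕ → ℝ} {d : ℤ} {w : ℕ} (F : FormSystem ι a d w)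

include F

theorem FormSystem.w_pos : 0 < w := by
  have h := (F.form F.one).rep_pos (1, 0)
  set n := (F.form F.one).val (1, 0) with hn
  have hn0 : n ≠ 0 := by
    rw [hn, Ne, ReducedForm.val_eq_zero]
    simp
  refine Nat.pos_of_ne_zero fun h0 => ?_
  have := F.sum_rep n hn0
  have hw : (w : ℝ) = 0 := by exact_mod_cast h0
  rw [hw, zero_mul, Finset.sum_eq_zero_iff_of_nonneg fun _ _ => by positivity] at this
  have := this F.one (Finset.mem_univ _)
  norm_cast at this
  exact h.ne' this

theorem FormSystem.rep_one_of_ne {i : ι} (hi : i ≠ F.one) : (F.form i).rep 1 = 0 := by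
  refine ReducedForm.rep_one_eq_zero _ ?_
  have := (F.form i).A_pos
  have h2 : (F.form i).A ≠ 1 := fun h => hi (F.eq_one i h)
  lia

theorem FormSystem.rep_one (ha : a 1 = 1) : (F.form F.one).rep 1 = w := by
  have := F.sum_rep 1 one_ne_zero
  rw [Finset.sum_eq_single F.one (fun i _ hi => by rw [F.rep_one_of_ne hi, Nat.cast_zero])
    (fun h => absurd (Finset.mem_univ _) h), ha, mul_one] at this
  exact_mod_cast this

theorem FormSystem.A_one (ha : a 1 = 1) : (F.form F.one).A = 1 := by
  by_contra h
  have h1 := (F.form F.one).A_pos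
  have h2 := (F.form F.one).rep_one_eq_zero (by lia)
  rw [F.rep_one ha] at h2
  exact F.w_pos.ne' h2

theorem FormSystem.hasSum_mul {G : ℕ → ℝ} (ha : a 0 = 0)
    (hG : ∀ i, Summable fun v => G ((F.form i).val v)) :
    HasSum (fun n => w * (a n * G n)) (∑ i, ((∑' v, G ((F.form i).val v)) - G 0)) := by
  have h1 : ∀ i, HasSum (fun n => ((F.form i).rep n : ℝ) * G n - if n = 0 then G 0 else 0)
      ((∑' v, G ((F.form i).val v)) - G 0) := fun i =>
    ((F.form i).hasSum_rep_mul (hG i)).sub (hasSum_ite_eq 0 (G 0))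
  refine (hasSum_sum fun i _ => h1 i).congr_fun fun n => ?_
  rcases eq_or_ne n 0 with rfl | hn
  · simp [ha, ReducedForm.rep_zero]
  · simp only [hn, if_false, sub_zero]
    rw [← Finset.sum_mul, F.sum_rep n hn, mul_assoc]

theorem FormSystem.hasSum_exp (ha : a 0 = 0) {s : ℝ} (hs : 0 < s) :
    HasSum (fun n : ℕ => w * (a n * Real.exp (-s * n)))
      (∑ i, (∑' v, Real.exp (-s * (F.form i).val v)) - Fintype.card ι) := by
  have h := F.hasSum_mul (G := fun n : ℕ => Real.exp (-s * n)) ha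
    fun i => (F.form i).summable_exp hs
  simpa only [Finset.sum_sub_distrib, Nat.cast_zero, mul_zero, Real.exp_zero, Finset.sum_const,
    Finset.card_univ, nsmul_eq_mul, mul_one] using h

theorem FormSystem.thetaSum_inv (ha : a 0 = 0) {t : ℝ} (ht : 0 < t) :
    thetaSum a (√(-d : ℤ) / (2 * Real.pi)) (Fintype.card ι / w) (1 / t) =
      t * thetaSum a (√(-d : ℤ) / (2 * Real.pi)) (Fintype.card ι / w) t := by
  have hw : (w : ℝ) ≠ 0 := by exact_mod_cast F.w_pos.ne'
  have hd : (0 : ℝ) < (-d : ℤ) := by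
    rw [← F.absDiscr_eq F.one]
    exact_mod_cast ReducedForm.absDiscr_pos _
  have hs : 0 < √((-d : ℤ) : ℝ) := Real.sqrt_pos.2 hd
  have key : ∀ s, 0 < s → w * thetaSum a (√(-d : ℤ) / (2 * Real.pi)) (Fintype.card ι / w) s =
      ∑ i, ∑' v, Real.exp (-(2 * Real.pi / √(-d : ℤ) * s) * (F.form i).val v) := by
    intro s hs0
    have hs1 : 0 < 2 * Real.pi / √(-d : ℤ) * s :=
      mul_pos (div_pos Real.two_pi_pos hs) hs0
    have h1 := F.hasSum_exp ha hs1
    rw [thetaSum, mul_add, mul_div_cancel₀ _ hw, ← tsum_mul_left]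
    have h2 : ∀ n : ℕ, (w : ℝ) * (a n * Real.exp (-(n / (√(-d : ℤ) / (2 * Real.pi))) * s)) =
        w * (a n * Real.exp (-(2 * Real.pi / √(-d : ℤ) * s) * n)) := by
      intro n
      congr 3
      field_simp
    rw [tsum_congr h2, h1.tsum_eq, add_sub_cancel]
  have h3 : w * thetaSum a (√(-d : ℤ) / (2 * Real.pi)) (Fintype.card ι / w) (1 / t) =
      t * (w * thetaSum a (√(-d : ℤ) / (2 * Real.pi)) (Fintype.card ι / w) t) := by
    rw [key _ (by positivity), key t ht, Finset.mul_sum]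
    refine Finset.sum_congr rfl fun i _ => ?_
    have := (F.form i).tsum_exp_inv ht
    rwa [F.absDiscr_eq i] at this
  refine mul_left_cancel₀ hw ?_
  rw [h3]
  ring

end FormSystem

section NumberField

variable {K : Type} [Field K] [NumberField K]

/-- The form system of an imaginary quadratic field. -/
theorem nonempty_formSystem (hdeg : Module.finrank ℚ K = 2) (himag : NumberField.discr K < 0) :
    Nonempty (FormSystem (ClassGroup (𝓞 K)) (idealCount K) (NumberField.discr K)
      (Nat.card (𝓞 K)ˣ)) := by
  obtain ⟨f, s, h1, h2, h3, h4⟩ := exists_formSystem hdeg himag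
  refine ⟨⟨f, s, 1, h1, h2, h3, fun n hn => ?_⟩⟩
  rw [idealCount, if_neg hn]
  exact_mod_cast h4 n hn

theorem FormSystem.zetaPair {ι : Type} [Fintype ι] {w : ℕ}
    (F : FormSystem ι (idealCount K) (NumberField.discr K) w) :
    ZetaPair (idealCount K) (moebiusSum K)
      (√(-NumberField.discr K : ℤ) / (2 * Real.pi)) (Fintype.card ι / w) where
  D_pos := by
    have hd : (0 : ℝ) < (-NumberField.discr K : ℤ) := by
      rw [← F.absDiscr_eq F.one]
      exact_mod_cast ReducedForm.absDiscr_pos _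
    positivity
  r_pos := by
    have h1 : 0 < Fintype.card ι := Fintype.card_pos_iff.2 ⟨F.one⟩
    have h2 := F.w_pos
    positivity
  a_zero := by simp [idealCount]
  a_one := idealCount_one
  nonneg := idealCount_nonneg
  abs_le := abs_moebiusSum_le
  summable := fun s hs => summable_idealCount hs
  mul := fun s hs => lseries_idealCount_mul_moebiusSum hs
  theta := fun t ht => F.thetaSum_inv (by simp [idealCount]) ht

end NumberField

section Mertens

variable {K : Type} [Field K] [NumberField K]

theorem mertensK_add_half (n : ℕ) :
    mertensK K (n + 1 / 2) = ∑ k ∈ Finset.Icc 1 n, moebiusSum K k := by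
  have hne : ∀ m : ℕ, (m : ℝ) ≠ n + 1 / 2 := by
    intro m h
    have h1 : (2 * m : ℝ) = 2 * n + 1 := by linarith
    have h2 : 2 * m = 2 * n + 1 := by exact_mod_cast h1
    lia
  have hlt : ∀ m : ℕ, (m : ℝ) < n + 1 / 2 ↔ m ≤ n := by
    intro m
    constructor
    · intro h
      by_contra! hc
      have : (n + 1 : ℝ) ≤ m := by exact_mod_cast hc
      linarith
    · intro h
      have : (m : ℝ) ≤ n := by exact_mod_cast h
      linarith
  have hmem : ∀ I : Ideal (𝓞 K), (I ≠ ⊥ ∧ (Ideal.absNorm I : ℝ) < n + 1 / 2) ↔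
      I ∈ (Finset.Icc 1 n).biUnion (idealsOfNorm K) := by
    intro I
    rw [hlt, Finset.mem_biUnion]
    constructor
    · rintro ⟨h1, h2⟩
      have h0 : Ideal.absNorm I ≠ 0 := fun h => h1 (Ideal.absNorm_eq_zero_iff.1 h)
      exact ⟨_, Finset.mem_Icc.2 ⟨Nat.one_le_iff_ne_zero.2 h0, h2⟩, mem_idealsOfNorm.2 rfl⟩
    · rintro ⟨k, hk, hI⟩
      rw [Finset.mem_Icc] at hk
      have h0 : k ≠ 0 := by lia
      rw [mem_idealsOfNorm] at hI
      refine ⟨?_, by lia⟩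
      rintro rfl
      rw [Ideal.absNorm_bot] at hI
      exact h0 hI.symm
  rw [mertensK, tsum_eq_sum (s := (Finset.Icc 1 n).biUnion (idealsOfNorm K))]
  · rw [Finset.sum_biUnion]
    · refine Finset.sum_congr rfl fun k hk => ?_
      rw [moebiusSum, if_neg (Nat.pos_iff_ne_zero.1 (Finset.mem_Icc.1 hk).1)]
      refine Finset.sum_congr rfl fun I hI => if_pos ?_
      exact (hmem I).2 (Finset.mem_biUnion.2 ⟨k, hk, hI⟩)
    · intro j hj k hk hjk
      rw [Function.onFun, Finset.disjoint_left]
      intro I h1 h2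
      rw [mem_idealsOfNorm] at h1 h2
      exact hjk (h1.symm.trans h2)
  · intro I hI
    rw [if_neg fun h => hI ((hmem I).1 h), if_neg fun h => hne _ h.2]

theorem NaiveMertensConj.eventually_abs_le (h : NaiveMertensConj K) {δ : ℝ} (hδ : 0 < δ) :
    ∀ᶠ x : ℝ in atTop, |mertensK K x| ≤ (1 + δ) * √x := by
  obtain ⟨h1, -, h2⟩ := h
  have h3 : ((-(1 + δ) : ℝ) : EReal) < MKminus K := by
    refine lt_of_lt_of_le ?_ h1
    rw [show (-1 : EReal) = ((-1 : ℝ) : EReal) by norm_num, EReal.coe_lt_coe_iff]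
    linarith
  have h4 : MKplus K < ((1 + δ : ℝ) : EReal) := by
    refine lt_of_le_of_lt h2 ?_
    rw [← EReal.coe_one, EReal.coe_lt_coe_iff]
    linarith
  filter_upwards [eventually_lt_of_lt_liminf h3, eventually_lt_of_limsup_lt h4,
    eventually_gt_atTop 0] with x h5 h6 hx
  rw [EReal.coe_lt_coe_iff] at h5 h6
  have hs : 0 < √x := Real.sqrt_pos.2 hx
  rw [lt_div_iff₀ hs] at h5
  rw [div_lt_iff₀ hs] at h6
  rw [abs_le]
  constructor <;> linarith

theorem NaiveMertensConj.exists_abs_sum_le (h : NaiveMertensConj K) (ε : ℝ) (hε : 0 < ε) :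
    ∃ N : ℕ, ∀ n, N ≤ n → |∑ k ∈ Finset.Icc 1 n, moebiusSum K k| ≤ (1 + ε) * √n := by
  obtain ⟨X, hX⟩ := eventually_atTop.1 (h.eventually_abs_le (half_pos hε))
  obtain ⟨N₁, hN₁⟩ := exists_nat_ge X
  obtain ⟨N₂, hN₂⟩ := exists_nat_ge ((2 + ε) / ε)
  refine ⟨max N₁ (max N₂ 1), fun n hn => ?_⟩
  have hn1 : (N₁ : ℝ) ≤ n := by exact_mod_cast (le_max_left _ _).trans hn
  have hn2 : (N₂ : ℝ) ≤ n := by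
    exact_mod_cast ((le_max_left _ _).trans (le_max_right _ _)).trans hn
  have hn3 : (1 : ℝ) ≤ n := by
    exact_mod_cast ((le_max_right _ _).trans (le_max_right _ _)).trans hn
  have hX' := hX (n + 1 / 2) (by linarith)
  rw [mertensK_add_half] at hX'
  refine hX'.trans ?_
  have h1 : √((n : ℝ) + 1 / 2) ≤ (1 + 1 / n) * √n := by
    rw [Real.sqrt_le_left (by positivity), mul_pow, Real.sq_sqrt (by positivity)]
    have : (1 + 1 / (n : ℝ)) ^ 2 * n = n + 2 + 1 / n := by field_simp; ring
    rw [this]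
    have : 0 < 1 / (n : ℝ) := by positivity
    linarith
  have h2 : (1 + ε / 2) * (1 + 1 / (n : ℝ)) ≤ 1 + ε := by
    have h3 := hN₂.trans hn2
    rw [div_le_iff₀ hε] at h3
    have h4 : (1 + ε / 2) * (1 / (n : ℝ)) ≤ ε / 2 := by
      rw [mul_one_div, div_le_iff₀ (by positivity)]
      linarith
    linarith
  calc (1 + ε / 2) * √((n : ℝ) + 1 / 2) ≤ (1 + ε / 2) * ((1 + 1 / n) * √n) := by gcongr
    _ = ((1 + ε / 2) * (1 + 1 / n)) * √n := by ring
    _ ≤ (1 + ε) * √n := by gcongr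

end Mertens

theorem mul_pow_le_factorial (k : ℕ) :
    108 * 16 ^ k ≤ ((k + 3 : ℕ) : ℝ) * ((k + 3).factorial : ℝ) ^ 2 := by
  induction k with
  | zero => norm_num [Nat.factorial]
  | succ k ih =>
    rw [show k + 1 + 3 = (k + 3) + 1 by ring, Nat.factorial_succ]
    push_cast at ih ⊢
    have hk : (0 : ℝ) ≤ k := by positivity
    have h1 : (16 : ℝ) ≤ (k + 3 + 1) ^ 2 := by nlinarith
    have h2 : (0 : ℝ) < ((k + 3).factorial : ℝ) ^ 2 := by positivity
    calc (108 : ℝ) * 16 ^ (k + 1) = 108 * 16 ^ k * 16 := by ring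
      _ ≤ ((k + 3) * ((k + 3).factorial : ℝ) ^ 2) * (k + 3 + 1) ^ 2 := by gcongr
      _ ≤ (k + 3 + 1) * ((k + 3).factorial : ℝ) ^ 2 * (k + 3 + 1) ^ 2 := by
        gcongr ?_ * _ * _
        linarith
      _ = _ := by ring

namespace ZetaPair

variable {a c : ℕ → ℝ} {D r : ℝ}

theorem abs_residueTerm_le (h : ZetaPair a c D r) {k : ℕ} (hk : k ≠ 0) {N : ℕ} :
    |residueCoeff a D r k / (N : ℝ) ^ k| ≤
      1 / D * ((1 / (D ^ 2 * N)) ^ k / (k * (k.factorial : ℝ) ^ 2)) := by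
  have hD := h.D_pos
  rw [abs_div, abs_of_nonneg (by positivity : (0 : ℝ) ≤ (N : ℝ) ^ k)]
  calc |residueCoeff a D r k| / (N : ℝ) ^ k
      ≤ 1 / D * ((1 / D ^ 2) ^ k / (k * (k.factorial : ℝ) ^ 2)) / (N : ℝ) ^ k := by
        gcongr
        exact h.abs_residueCoeff_le hk
    _ = _ := by
        rw [← div_div 1 (D ^ 2), div_pow _ (N : ℝ)]
        ring

theorem exists_tsum_residueTerm (h : ZetaPair a c D r) {N : ℕ} (hN : 1 ≤ N)
    (hz : 1 / (D ^ 2 * N) ≤ 3 / 2) :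
    ∃ t, |t| ≤ 1 / D * ((1 / (D ^ 2 * N)) ^ 3 / 97) ∧
      ∑' k, residueCoeff a D r k / (N : ℝ) ^ k = -1 / r +
        1 / D * ((1 / (D ^ 2 * N)) / zetaNat a 2) -
        1 / D * ((1 / (D ^ 2 * N)) ^ 2 / (8 * zetaNat a 3)) + t := by
  have hD := h.D_pos
  set z := 1 / (D ^ 2 * (N : ℝ)) with hzdef
  have hN0 : (0 : ℝ) < N := by exact_mod_cast hN
  have hz0 : 0 < z := by positivity
  have hbound : ∀ k : ℕ, |residueCoeff a D r (k + 3) / (N : ℝ) ^ (k + 3)| ≤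
      1 / D * (z ^ 3 / 108) * (z / 16) ^ k := by
    intro k
    refine (h.abs_residueTerm_le (by lia)).trans ?_
    have h1 := mul_pow_le_factorial k
    rw [← hzdef, mul_assoc]
    gcongr
    calc z ^ (k + 3) / (((k + 3 : ℕ) : ℝ) * ((k + 3).factorial : ℝ) ^ 2)
        ≤ z ^ (k + 3) / (108 * 16 ^ k) := by gcongr
      _ = _ := by
        rw [div_pow z 16, div_mul_div_comm, ← pow_add, add_comm 3 k]
  have hgeo : HasSum (fun k : ℕ => 1 / D * (z ^ 3 / 108) * (z / 16) ^ k)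
      (1 / D * (z ^ 3 / 108) * (1 - z / 16)⁻¹) :=
    (hasSum_geometric_of_lt_one (by positivity) (by linarith)).mul_left _
  have hs3 : Summable fun k : ℕ => residueCoeff a D r (k + 3) / (N : ℝ) ^ (k + 3) :=
    Summable.of_norm_bounded hgeo.summable hbound
  have hs : Summable fun k : ℕ => residueCoeff a D r k / (N : ℝ) ^ k :=
    (summable_nat_add_iff 3).1 hs3
  refine ⟨∑' k, residueCoeff a D r (k + 3) / (N : ℝ) ^ (k + 3), ?_, ?_⟩
  · rw [← Real.norm_eq_abs]
    refine (tsum_of_norm_bounded hgeo hbound).trans ?_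
    rw [mul_assoc]
    have h1 : (1 - z / 16)⁻¹ ≤ 108 / 97 := by
      rw [inv_le_comm₀ (by linarith) (by norm_num)]
      linarith
    calc 1 / D * (z ^ 3 / 108 * (1 - z / 16)⁻¹) ≤ 1 / D * (z ^ 3 / 108 * (108 / 97)) := by gcongr
      _ = _ := by ring
  · rw [← hs.sum_add_tsum_nat_add 3]
    congr 1
    have hZ2 := h.one_le_zetaNat (le_refl 2)
    have hZ3 := h.one_le_zetaNat (show 2 ≤ 3 by norm_num)
    simp only [Finset.sum_range_succ, Finset.sum_range_zero, residueCoeff, hzdef]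
    norm_num [Nat.factorial]
    field_simp
    ring

theorem tsum_residueTerm_le (h : ZetaPair a c D r) {N : ℕ} (hN : 1 ≤ N)
    (hz : 1 / (D ^ 2 * N) ≤ 3 / 2) :
    ∑' k, residueCoeff a D r k / (N : ℝ) ^ k ≤ -1 / r +
      1 / D * ((1 / (D ^ 2 * N)) / zetaNat a 2 + (1 / (D ^ 2 * N)) ^ 3 / 97) := by
  obtain ⟨t, h1, h2⟩ := h.exists_tsum_residueTerm hN hz
  have hD := h.D_pos
  have hZ3 := h.one_le_zetaNat (show 2 ≤ 3 by norm_num)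
  have h3 : 0 ≤ 1 / D * ((1 / (D ^ 2 * N)) ^ 2 / (8 * zetaNat a 3)) := by positivity
  rw [h2, mul_add]
  linarith [le_abs_self t]

theorem le_tsum_residueTerm (h : ZetaPair a c D r) {N : ℕ} (hN : 1 ≤ N)
    (hz : 1 / (D ^ 2 * N) ≤ 3 / 2) :
    -1 / r - 1 / D * ((1 / (D ^ 2 * N)) ^ 2 / 7) ≤
      ∑' k, residueCoeff a D r k / (N : ℝ) ^ k := by
  obtain ⟨t, h1, h2⟩ := h.exists_tsum_residueTerm hN hz
  have hD := h.D_pos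
  have hN0 : (0 : ℝ) < N := by exact_mod_cast hN
  have hZ2 := h.one_le_zetaNat (le_refl 2)
  have hZ3 := h.one_le_zetaNat (show 2 ≤ 3 by norm_num)
  set z := 1 / (D ^ 2 * (N : ℝ)) with hzdef
  have hz0 : 0 < z := by positivity
  have h3 : 0 ≤ 1 / D * (z / zetaNat a 2) := by positivity
  have h4 : 1 / D * (z ^ 2 / (8 * zetaNat a 3)) ≤ 1 / D * (z ^ 2 / 8) := by
    gcongr
    linarith
  have h5 : 1 / D * (z ^ 2 / 8) + 1 / D * (z ^ 3 / 97) ≤ 1 / D * (z ^ 2 / 7) := by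
    rw [← mul_add]
    gcongr
    nlinarith [sq_nonneg z]
  rw [h2]
  linarith [neg_abs_le t]

end ZetaPair

section Dirichlet

theorem sum_divisorsAntidiagonal_eq_sum_div {R : Type*} [CommRing R] (f g : ℕ → R) (N : ℕ) :
    ∑ n ∈ Finset.Icc 1 N, ∑ p ∈ n.divisorsAntidiagonal, f p.1 * g p.2 =
      ∑ n ∈ Finset.Icc 1 N, f n * ∑ m ∈ Finset.Icc 1 (N / n), g m := by
  have key : ∀ f : ℕ → R, ∃ f' : ArithmeticFunction R, ∀ n, n ≠ 0 → f' n = f n := fun f =>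
    ⟨⟨fun n => if n = 0 then 0 else f n, if_pos rfl⟩, fun n hn => if_neg hn⟩
  obtain ⟨f', hf⟩ := key f
  obtain ⟨g', hg⟩ := key g
  have h := ArithmeticFunction.sum_Ioc_mul_eq_sum_sum f' g' N
  have hI : ∀ M : ℕ, Finset.Ioc 0 M = Finset.Icc 1 M := fun M => rfl
  simp only [hI, ArithmeticFunction.mul_apply] at h
  convert h using 1
  · refine Finset.sum_congr rfl fun n _ => Finset.sum_congr rfl fun p hp => ?_
    rw [hf _ (Nat.ne_zero_of_mem_divisorsAntidiagonal hp).1,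
      hg _ (Nat.ne_zero_of_mem_divisorsAntidiagonal hp).2]
  · refine Finset.sum_congr rfl fun n hn => ?_
    rw [hf _ (Nat.pos_iff_ne_zero.1 (Finset.mem_Icc.1 hn).1)]
    congr 1
    refine Finset.sum_congr rfl fun m hm => ?_
    rw [hg _ (Nat.pos_iff_ne_zero.1 (Finset.mem_Icc.1 hm).1)]

/-- The summatory function of the Dirichlet inverse of `A`, with recursion depth `k`. -/
def mertensOf (A : ℕ → ℕ) : ℕ → ℕ → ℤ
  | 0, _ => 0
  | k + 1, N => if N = 0 then 0 else
      1 - ((List.range' 2 (N - 1)).map fun j => A j * mertensOf A k (N / j)).sum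

theorem mertensOf_eq {a c : ℕ → ℝ} {A : ℕ → ℕ} {N₀ : ℕ} (ha : ∀ n, 1 ≤ n → n < N₀ → a n = A n)
    (ha1 : a 1 = 1) (hac : ∀ n, n ≠ 0 → ∑ p ∈ n.divisorsAntidiagonal, a p.1 * c p.2 =
      if n = 1 then 1 else 0) (k : ℕ) :
    ∀ N, N < N₀ → N < 2 ^ k → (mertensOf A k N : ℝ) = ∑ n ∈ Finset.Icc 1 N, c n := by
  induction k with
  | zero =>
    intro N _ hN
    obtain rfl : N = 0 := by simpa using hN
    simp [mertensOf]
  | succ k ih =>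
    intro N hN₀ hN
    rw [mertensOf]
    split_ifs with h0
    · simp [h0]
    have h1 := sum_divisorsAntidiagonal_eq_sum_div a c N
    have hN1 : 1 ≤ N := Nat.one_le_iff_ne_zero.2 h0
    rw [Finset.sum_congr rfl fun n hn => hac n (Nat.pos_iff_ne_zero.1 (Finset.mem_Icc.1 hn).1),
      Finset.sum_ite_eq' _ 1, if_pos (Finset.mem_Icc.2 ⟨le_rfl, hN1⟩),
      ← Finset.add_sum_Ioc_eq_sum_Icc hN1, ha1, one_mul, Nat.div_one] at h1
    have h2 : ((List.range' 2 (N - 1)).map fun j => (A j : ℤ) * mertensOf A k (N / j)).sum =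
        ∑ j ∈ Finset.Ioc 1 N, (A j : ℤ) * mertensOf A k (N / j) := by
      rw [← List.sum_toFinset _ List.nodup_range']
      congr 1
      ext j
      simp only [List.mem_toFinset, List.mem_range'_1, Finset.mem_Ioc]
      lia
    rw [h2]
    push_cast
    rw [eq_sub_of_add_eq h1.symm]
    congr 1
    refine Finset.sum_congr rfl fun j hj => ?_
    rw [Finset.mem_Ioc] at hj
    have h3 : N / j ≤ N / 2 := Nat.div_le_div_left hj.1 two_pos
    rw [ih _ (by lia) (by rw [pow_succ] at hN; lia), ha j (by lia) (by lia)]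

end Dirichlet

/-- The number of representations of `n` by the form `(A, B, C)` in a box of size `b`, with all
quantities shifted to natural numbers. -/
def formCount (A B C b n : ℕ) : ℕ :=
  ((List.range (2 * b + 1)).map fun i => (List.range (2 * b + 1)).countP fun j =>
    Nat.beq (A * (i * i + b * b) + (B * (i * j + b * b) + C * (j * j + b * b)))
      (n + b * (2 * A * i + (B * (i + j) + 2 * C * j)))).sum

theorem countP_range (p : ℕ → Bool) (m : ℕ) :
    (List.range m).countP p = ∑ j ∈ Finset.range m, if p j = true then 1 else 0 := by
  induction m with
  | zero => rfl
  | succ m ih => rw [List.range_succ, List.countP_append, ih, Finset.sum_range_succ]; simp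

theorem ReducedForm.rep_eq_formCount (f : ReducedForm) {b n : ℕ} (hb : 2 * n < (b + 1) ^ 2) :
    f.rep n = formCount f.A f.B f.C b n := by
  have h1 : ∀ F : ℕ → ℕ, ((List.range (2 * b + 1)).map F).sum =
    ∑ i ∈ Finset.range (2 * b + 1), F i := fun F => rfl
  rw [f.rep_eq_card hb, formCount, h1]
  simp only [countP_range]
  rw [← Finset.sum_product', ← Finset.card_filter]
  have key : ∀ i j : ℕ, f.val ((i : ℤ) - b, (j : ℤ) - b) = n ↔
      Nat.beq (f.A * (i * i + b * b) + (f.B * (i * j + b * b) + f.C * (j * j + b * b)))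
      (n + b * (2 * f.A * i + (f.B * (i + j) + 2 * f.C * j))) = true := by
    intro i j
    have h := f.coe_val ((i : ℤ) - b, (j : ℤ) - b)
    rw [Nat.beq_eq, ← Int.natCast_inj, h, ← Int.natCast_inj]
    push_cast
    constructor <;> intro h <;> linear_combination h
  refine Finset.card_nbij' (fun v => ((v.1 + b).toNat, (v.2 + b).toNat))
    (fun v => ((v.1 : ℤ) - b, (v.2 : ℤ) - b)) ?_ ?_ ?_ ?_
  · intro v hv
    simp only [Finset.coe_filter, Finset.mem_product, Finset.mem_Icc, Set.mem_ofPred_eq,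
      Finset.mem_range] at hv ⊢
    refine ⟨by lia, (key _ _).1 ?_⟩
    rw [← hv.2]
    congr 1
    ext <;> simp only [] <;> lia
  · intro v hv
    simp only [Finset.coe_filter, Finset.mem_product, Finset.mem_Icc, Set.mem_ofPred_eq,
      Finset.mem_range] at hv ⊢
    exact ⟨by lia, (key _ _).2 hv.2⟩
  · intro v hv
    simp only [Finset.coe_filter, Finset.mem_product, Finset.mem_Icc, Set.mem_ofPred_eq] at hv
    ext <;> simp only [] <;> lia
  · intro v hv
    ext <;> simp only [] <;> lia

theorem ReducedForm.rep_one_eq_two (f : ReducedForm) (hA : f.A = 1) (hd : 4 < f.absDiscr) :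
    f.rep 1 = 2 := by
  have h : ∀ v : ℤ × ℤ, f.val v = 1 ↔ v ∈ ({(1, 0), (-1, 0)} : Finset (ℤ × ℤ)) := by
    intro v
    rw [← Int.natCast_inj, f.coe_val, hA]
    simp only [Finset.mem_insert, Finset.mem_singleton, Prod.ext_iff]
    push_cast
    constructor
    · intro h1
      rw [absDiscr, hA] at hd
      push_cast at hd
      have h2 : v.2 = 0 := by
        by_contra hne
        have h3 : 0 < v.2 ^ 2 := by positivity
        nlinarith [sq_nonneg (2 * v.1 + f.B * v.2)]
      rw [h2] at h1
      have h3 : v.1 ^ 2 = 1 := by linarith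
      rcases sq_eq_one_iff.1 h3 with h4 | h4
      · exact Or.inl ⟨h4, h2⟩
      · exact Or.inr ⟨h4, h2⟩
    · rintro (⟨h1, h2⟩ | ⟨h1, h2⟩) <;> simp [h1, h2]
  rw [rep, Nat.card_congr (Equiv.subtypeEquivRight h), Nat.card_eq_finsetCard]
  rfl

/-- The coefficients of a form. -/
def ReducedForm.triple (f : ReducedForm) : ℕ × ℕ × ℕ := (f.A, f.B, f.C)

theorem ReducedForm.triple_injective : Function.Injective ReducedForm.triple := by
  rintro ⟨A, B, C, _, _, _⟩ ⟨A', B', C', _, _, _⟩ h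
  simp only [triple, Prod.mk.injEq] at h
  obtain ⟨rfl, rfl, rfl⟩ := h
  rfl

/-- The reduced triples of discriminant `-δ`, for `δ ≤ 48`. -/
def reducedTriples (δ : ℕ) : List (ℕ × ℕ × ℕ) :=
  (List.range' 1 4 ×ˢ (List.range 5 ×ˢ List.range' 1 12)).filter fun f =>
    decide (f.2.1 ≤ f.1 ∧ f.1 ≤ f.2.2 ∧ 4 * f.1 * f.2.2 = f.2.1 * f.2.1 + δ)

theorem mem_reducedTriples {δ : ℕ} {f : ℕ × ℕ × ℕ} (hf : f ∈ reducedTriples δ) :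
    f.2.1 ≤ f.1 ∧ f.1 ≤ f.2.2 ∧ 4 * f.1 * f.2.2 = f.2.1 * f.2.1 + δ :=
  of_decide_eq_true (List.mem_filter.1 hf).2

theorem nodup_reducedTriples (δ : ℕ) : (reducedTriples δ).Nodup :=
  (List.Nodup.product List.nodup_range' (List.nodup_range.product List.nodup_range')).filter _

theorem ReducedForm.triple_mem (f : ReducedForm) {δ : ℕ} (hδ : δ ≤ 48) (hf : f.absDiscr = δ) :
    f.triple ∈ reducedTriples δ := by
  have h1 := f.A_pos
  have h2 := f.B_le
  have h3 := f.A_le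
  have h4 : 4 * f.A * f.C = f.B * f.B + δ := by
    rw [absDiscr] at hf
    have : ((4 * f.A * f.C : ℕ) : ℤ) = ((f.B * f.B + δ : ℕ) : ℤ) := by
      push_cast
      linarith
    exact_mod_cast this
  have h5 : f.A ≤ 4 := by
    by_contra! h
    nlinarith [Nat.mul_le_mul h2 h2, Nat.mul_le_mul_left f.A h3]
  have h6 : f.C ≤ 12 := by
    by_contra! h
    nlinarith [Nat.mul_le_mul h2 h2, Nat.mul_le_mul_left f.A h3]
  refine List.mem_filter.2 ⟨?_, decide_eq_true ⟨h2, h3, h4⟩⟩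
  simp only [triple, List.mem_product, List.mem_range'_1, List.mem_range]
  lia

/-- The possible multiplicities with which reduced forms occur. -/
def multChoices : List (ℕ × ℕ × ℕ) → List (List ((ℕ × ℕ × ℕ) × ℕ))
  | [] => [[]]
  | f :: L => (if f.1 = 1 then [1] else [0, 1, 2]).flatMap fun k =>
      (multChoices L).map fun t => (f, k) :: t

theorem map_mem_multChoices (k : ℕ × ℕ × ℕ → ℕ) (L : List (ℕ × ℕ × ℕ))
    (h1 : ∀ f ∈ L, f.1 = 1 → k f = 1) (h2 : ∀ f ∈ L, k f ≤ 2) :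
    (L.map fun f => (f, k f)) ∈ multChoices L := by
  induction L with
  | nil => simp [multChoices]
  | cons f L ih =>
    rw [multChoices, List.mem_flatMap, List.map_cons]
    refine ⟨k f, ?_, List.mem_map.2 ⟨_, ih (fun g hg => h1 g (List.mem_cons_of_mem _ hg))
      (fun g hg => h2 g (List.mem_cons_of_mem _ hg)), rfl⟩⟩
    split_ifs with hf
    · simp [h1 f List.mem_cons_self hf]
    · have := h2 f List.mem_cons_self
      interval_cases k f <;> simp

/-- The largest `b` with `b ^ 2 ≤ 2 * n`, for small `n`. -/
def boxSize (n : ℕ) : ℕ := (List.range 12).countP fun b => decide ((b + 1) * (b + 1) ≤ 2 * n)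

theorem two_mul_lt_boxSize {n : ℕ} (hn : n < 64) : 2 * n < (boxSize n + 1) ^ 2 := by
  have : ∀ n < 64, 2 * n < (boxSize n + 1) ^ 2 := by decide +kernel
  exact this n hn

/-- The number of ideals of norm `n` for a given choice of multiplicities. -/
def coeffOf (t : List ((ℕ × ℕ × ℕ) × ℕ)) (n : ℕ) : ℕ :=
  (t.map fun p => p.2 * formCount p.1.1 p.1.2.1 p.1.2.2 (boxSize n) n).sum / 2

/-- Whether the value `M` of the Mertens function at `N` violates the bound implied by the
conjecture, when the class number is `h`, the number of units is `2` and `2 * π /√|d| ≤ q`. -/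
def violates (q : ℚ) (h N : ℕ) (M : ℤ) : Bool :=
  let z := q * q / N
  let u := M + 2 / h - (z + z * z * z / 97) * q
  let v := -M - 2 / h - z * z / 7 * q
  decide (z ≤ 3 / 2 ∧ ((0 < u ∧ N < u * u) ∨ (0 < v ∧ N < v * v)))

/-- Whether for each choice of multiplicities there is a violation at some element of `Ns`. -/
def tableCheck (δ m : ℕ) (Ns : List ℕ) : Bool :=
  decide (39478500 ≤ m * m * δ ∧ ∀ N ∈ Ns, 1 ≤ N ∧ N < 64) &&
    (multChoices (reducedTriples δ)).all fun t => Ns.any fun N =>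
      violates (m / 1000) (t.map Prod.snd).sum N (mertensOf (coeffOf t) 6 N)

section FormSystem

variable {ι : Type} [Fintype ι] {a : ℕ → ℝ} {d : ℤ} {w : ℕ} (F : FormSystem ι a d w)

include F

theorem FormSystem.w_eq_two (ha : a 1 = 1) (hd : 4 < -d) : w = 2 := by
  rw [← F.rep_one ha, ReducedForm.rep_one_eq_two _ (F.A_one ha) (by rwa [F.absDiscr_eq])]

/-- The number of ideal classes with a given form. -/
def FormSystem.mult (f : ℕ × ℕ × ℕ) : ℕ := (Finset.univ.filter fun i => (F.form i).triple = f).card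

theorem FormSystem.mult_le_two (f : ℕ × ℕ × ℕ) : F.mult f ≤ 2 := by
  rw [mult]
  refine (Finset.card_le_card_of_injOn (t := (Finset.univ : Finset Bool)) F.sign
      (fun _ _ => by simp)
    fun i hi j hj hij => F.injective (Prod.ext (ReducedForm.triple_injective ?_) hij)).trans_eq rfl
  simp only [Finset.coe_filter, Finset.mem_univ, true_and, Set.mem_ofPred_eq] at hi hj
  exact hi.trans hj.symm

theorem FormSystem.mult_eq_one (ha : a 1 = 1) {δ : ℕ} (hδ : -d = δ) {f : ℕ × ℕ × ℕ}
    (hf : f ∈ reducedTriples δ) (hf1 : f.1 = 1) : F.mult f = 1 := by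
  rw [mult, Finset.card_eq_one]
  refine ⟨F.one, ?_⟩
  ext i
  simp only [Finset.mem_filter, Finset.mem_univ, true_and, Finset.mem_singleton]
  constructor
  · intro hi
    refine F.eq_one i ?_
    rw [← hi] at hf1
    exact hf1
  · rintro rfl
    obtain ⟨h1, h2, h3⟩ := mem_reducedTriples hf
    have h4 := F.A_one ha
    have h5 := (F.form F.one).B_le
    have h6 := F.absDiscr_eq F.one
    rw [hδ, ReducedForm.absDiscr, h4] at h6
    rw [h4] at h5
    rw [hf1] at h1 h3
    have h7 : 4 * (F.form F.one).C = (F.form F.one).B * (F.form F.one).B + δ := by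
      zify
      push_cast at h6
      linarith
    have h8 : (F.form F.one).B = f.2.1 := by
      interval_cases (F.form F.one).B <;> interval_cases f.2.1 <;> lia
    rw [ReducedForm.triple]
    ext
    · exact h4.trans hf1.symm
    · exact h8
    · change (F.form F.one).C = f.2.2
      rw [h8] at h7
      lia

theorem FormSystem.sum_comp_triple {δ : ℕ} (hδ : -d = δ) (hδ' : δ ≤ 48) (G : ℕ × ℕ × ℕ → ℕ) :
    ((reducedTriples δ).map fun f => F.mult f * G f).sum = ∑ i, G (F.form i).triple := by
  rw [← List.sum_toFinset _ (nodup_reducedTriples δ),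
    ← Finset.sum_fiberwise_of_maps_to (g := fun i => (F.form i).triple)
        (t := (reducedTriples δ).toFinset)
      fun i _ => List.mem_toFinset.2 ((F.form i).triple_mem hδ' ((F.absDiscr_eq i).trans hδ))]
  refine Finset.sum_congr rfl fun f _ => ?_
  rw [Finset.sum_congr rfl (g := fun _ => G f) fun i hi => by rw [(Finset.mem_filter.1 hi).2],
    Finset.sum_const, smul_eq_mul, mult]

theorem FormSystem.exists_multChoice (ha : a 1 = 1) (hnat : ∀ n, ∃ m : ℕ, a n = m) {δ : ℕ}
    (hδ : -d = δ) (h4 : 4 < δ) (hδ' : δ ≤ 48) :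
    ∃ t ∈ multChoices (reducedTriples δ), (t.map Prod.snd).sum = Fintype.card ι ∧
      ∀ n, 1 ≤ n → n < 64 → a n = coeffOf t n := by
  refine ⟨_, map_mem_multChoices F.mult _ (fun f hf => F.mult_eq_one ha hδ hf)
    (fun f _ => F.mult_le_two f), ?_, fun n hn1 hn => ?_⟩
  · have := F.sum_comp_triple hδ hδ' (fun _ => 1)
    simp only [mul_one, Finset.sum_const, Finset.card_univ, smul_eq_mul] at this
    rw [List.map_map, ← this]
    rfl
  · have h1 := F.sum_comp_triple hδ hδ' fun f => formCount f.1 f.2.1 f.2.2 (boxSize n) n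
    have h2 := F.sum_rep n (Nat.pos_iff_ne_zero.1 hn1)
    have hw : (w : ℝ) = 2 := by exact_mod_cast F.w_eq_two ha (by rw [hδ]; exact_mod_cast h4)
    rw [hw] at h2
    obtain ⟨m, hm⟩ := hnat n
    rw [hm] at h2 ⊢
    have h3 : ∑ i, (F.form i).rep n = 2 * m := by exact_mod_cast h2
    rw [coeffOf, List.map_map]
    simp only [Function.comp_def]
    rw [h1]
    have h4 : ∑ i, formCount (F.form i).triple.1 (F.form i).triple.2.1 (F.form i).triple.2.2
        (boxSize n) n = ∑ i, (F.form i).rep n :=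
      Finset.sum_congr rfl fun i _ => ((F.form i).rep_eq_formCount (two_mul_lt_boxSize hn)).symm
    rw [h4, h3, Nat.mul_div_cancel_left _ two_pos]

end FormSystem

theorem two_pi_div_sqrt_le {δ m : ℕ} (hδ : 0 < δ) (hm : 39478500 ≤ m * m * δ) :
    1 / (√δ / (2 * Real.pi)) ≤ m / 1000 := by
  have hs : 0 < √(δ : ℝ) := Real.sqrt_pos.2 (by exact_mod_cast hδ)
  rw [one_div_div, div_le_iff₀ hs, ← Real.sqrt_sq (by positivity : (0 : ℝ) ≤ m / 1000),
    ← Real.sqrt_mul (by positivity)]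
  refine Real.le_sqrt_of_sq_le ?_
  have h1 : (39478500 : ℝ) ≤ m * m * δ := by exact_mod_cast hm
  have h2 := Real.pi_lt_d6
  have h3 := Real.pi_pos
  have h4 : Real.pi ^ 2 ≤ 3.141593 ^ 2 := by gcongr
  calc (2 * Real.pi) ^ 2 = 4 * Real.pi ^ 2 := by ring
    _ ≤ 39478500 / 1000 ^ 2 := by norm_num at h4 ⊢; linarith
    _ ≤ _ := by rw [div_pow, div_mul_eq_mul_div]; gcongr; linarith

theorem ZetaPair.violates_eq_false {a c : ℕ → ℝ} {D : ℝ} {h m N : ℕ} (P : ZetaPair a c D (h / 2))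
    (hlim : ∀ ε > 0, ∃ N : ℕ, ∀ n, N ≤ n → |∑ k ∈ Finset.Icc 1 n, c k| ≤ (1 + ε) * √n)
    (hN : 1 ≤ N) (hD : 1 / D ≤ m / 1000) {M : ℤ} (hM : (M : ℝ) = ∑ k ∈ Finset.Icc 1 N, c k) :
    violates (m / 1000) h N M = false := by
  rw [← Bool.not_eq_true]
  intro hv
  have hv' := of_decide_eq_true hv
  set q : ℚ := m / 1000 with hq
  obtain ⟨h1, h2⟩ := hv'
  have hq' : 1 / D ≤ (q : ℝ) := by rw [hq]; push_cast; exact hD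
  have hD0 := P.D_pos
  have hN0 : (0 : ℝ) < N := by exact_mod_cast hN
  have hqz : 1 / (D ^ 2 * N) ≤ (q : ℝ) * q / N := by
    rw [← div_div, ← one_div_pow, pow_two]
    gcongr
  have h1' : (q : ℝ) * q / N ≤ 3 / 2 := by
    have := (Rat.cast_le (K := ℝ)).2 h1
    push_cast at this
    exact this
  have hz := hqz.trans h1'
  have hz0 : 0 < 1 / (D ^ 2 * N) := by positivity
  have key := P.abs_sum_sub_tsum_residue_le hlim hN
  rw [← hM, _root_.abs_le] at key
  have e1 := P.tsum_residueTerm_le hN hz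
  have e2 := P.le_tsum_residueTerm hN hz
  have hr : -1 / ((h : ℝ) / 2) = - (2 / h) := by
    rw [neg_div, one_div_div]
  rw [hr] at e1 e2
  have hZ := P.one_le_zetaNat (le_refl 2)
  have hs := Real.sq_sqrt hN0.le
  have hs0 := Real.sqrt_nonneg (N : ℝ)
  set z := 1 / (D ^ 2 * (N : ℝ)) with hzdef
  set Z : ℝ := (q : ℝ) * q / N with hZdef
  rcases h2 with ⟨h3, h4⟩ | ⟨h3, h4⟩
  · have h3' : (0 : ℝ) < M + 2 / h - (Z + Z * Z * Z / 97) * q := by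
      have := (Rat.cast_lt (K := ℝ)).2 h3
      push_cast at this
      exact this
    have h4' : (N : ℝ) < (M + 2 / h - (Z + Z * Z * Z / 97) * q) *
      (M + 2 / h - (Z + Z * Z * Z / 97) * q) := by
      have := (Rat.cast_lt (K := ℝ)).2 h4
      push_cast at this
      exact this
    have h5 : 1 / D * (z / zetaNat a 2 + z ^ 3 / 97) ≤ q * (Z + Z * Z * Z / 97) := by
      have : z / zetaNat a 2 ≤ Z := (div_le_self hz0.le hZ).trans hqz
      have : z ^ 3 ≤ Z * Z * Z := by
        rw [show Z * Z * Z = Z ^ 3 by ring]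
        gcongr
      gcongr
    nlinarith
  · have h3' : (0 : ℝ) < -M - 2 / h - Z * Z / 7 * q := by
      have := (Rat.cast_lt (K := ℝ)).2 h3
      push_cast at this
      exact this
    have h4' : (N : ℝ) < (-M - 2 / h - Z * Z / 7 * q) * (-M - 2 / h - Z * Z / 7 * q) := by
      have := (Rat.cast_lt (K := ℝ)).2 h4
      push_cast at this
      exact this
    have h5 : 1 / D * (z ^ 2 / 7) ≤ q * (Z * Z / 7) := by
      have : z ^ 2 ≤ Z * Z := by
        rw [pow_two]
        gcongr
      gcongr
    nlinarith

theorem FormSystem.tableCheck_eq_false {ι : Type} [Fintype ι] {a c : ℕ → ℝ} {d : ℤ} {w δ m : ℕ}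
    (F : FormSystem ι a d w) (hδ : -d = δ) (h4 : 4 < δ) (hδ' : δ ≤ 48)
    (P : ZetaPair a c (√(-d : ℤ) / (2 * Real.pi)) (Fintype.card ι / w))
    (hnat : ∀ n, ∃ m : ℕ, a n = m)
    (hac : ∀ n, n ≠ 0 → ∑ p ∈ n.divisorsAntidiagonal, a p.1 * c p.2 = if n = 1 then 1 else 0)
    (hlim : ∀ ε > 0, ∃ N : ℕ, ∀ n, N ≤ n → |∑ k ∈ Finset.Icc 1 n, c k| ≤ (1 + ε) * √n)
    (Ns : List ℕ) : tableCheck δ m Ns = false := by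
  rw [← Bool.not_eq_true, tableCheck, Bool.and_eq_true, decide_eq_true_iff, List.all_eq_true]
  rintro ⟨⟨h1, h2⟩, h3⟩
  obtain ⟨t, ht, hth, hta⟩ := F.exists_multChoice P.a_one hnat hδ h4 hδ'
  obtain ⟨N, hN, hv⟩ := List.any_eq_true.1 (h3 t ht)
  have hw : (w : ℝ) = 2 := by exact_mod_cast F.w_eq_two P.a_one (by rw [hδ]; exact_mod_cast h4)
  have hd : ((-d : ℤ) : ℝ) = δ := by rw [hδ, Int.cast_natCast]
  rw [hw, hd] at P
  rw [hth, P.violates_eq_false hlim (h2 N hN).1 (two_pi_div_sqrt_le (by lia) h1)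
    (mertensOf_eq hta P.a_one hac 6 N (h2 N hN).2 (h2 N hN).2)] at hv
  exact absurd hv (by simp)

/-- A bound `m` with `2 * π /√δ ≤ m/1000` and integers at which the conjectured bound fails. -/
def table : ℕ → ℕ × List ℕ
  | 7 => (2375, [22])
  | 8 => (2222, [57])
  | 11 => (1895, [20])
  | 12 => (1814, [3, 4, 7])
  | 15 => (1623, [2, 10, 30])
  | 16 => (1571, [2, 8, 10])
  | 19 => (1442, [2])
  | 20 => (1405, [2, 3, 21])
  | 23 => (1311, [2, 3, 24])
  | 24 => (1283, [2, 3, 7])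
  | 27 => (1210, [1, 3, 7])
  | 28 => (1188, [1, 11, 18])
  | 31 => (1129, [1, 7, 10])
  | 32 => (1111, [1, 3, 4, 6, 8, 9])
  | 35 => (1063, [1, 3, 7])
  | 36 => (1048, [1, 2, 3, 4, 5, 9])
  | 39 => (1007, [1, 2, 3, 4, 5, 11])
  | 40 => (994, [1, 4])
  | 43 => (959, [1])
  | 44 => (948, [1, 3, 4, 5, 9])
  | 47 => (917, [1, 3, 4, 8, 36])
  | 48 => (907, [1, 3, 4, 6, 8, 39])
  | _ => (0, [])

theorem tableCheck_table {δ : ℕ} (h4 : 4 < δ) (h48 : δ ≤ 48) (hδ : δ % 4 = 0 ∨ δ % 4 = 3) :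
    tableCheck δ (table δ).1 (table δ).2 = true := by
  have : ∀ δ ≤ 48, 4 < δ → δ % 4 = 0 ∨ δ % 4 = 3 →
      tableCheck δ (table δ).1 (table δ).2 = true := by decide +kernel
  exact this δ h48 h4 hδ

namespace ReducedForm

variable (f : ReducedForm)

theorem sum_le_sum_rep_mul {S : Finset (ℤ × ℤ)} {X : ℕ} (hS : ∀ v ∈ S, f.val v ∈ Finset.Icc 1 X)
    {G : ℕ → ℝ} (hG : ∀ n, 0 ≤ G n) :
    ∑ v ∈ S, G (f.val v) ≤ ∑ n ∈ Finset.Icc 1 X, f.rep n * G n := by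
  rw [← Finset.sum_fiberwise_of_maps_to hS]
  refine Finset.sum_le_sum fun n _ => ?_
  rw [Finset.sum_congr rfl (g := fun _ => G n) fun v hv => by rw [(Finset.mem_filter.1 hv).2],
    Finset.sum_const, nsmul_eq_mul]
  refine mul_le_mul_of_nonneg_right (Nat.cast_le.2 ?_) (hG n)
  have hb : 2 * n < (2 * n + 1) ^ 2 := by nlinarith
  rw [f.rep_eq_card hb]
  refine Finset.card_le_card fun v hv => ?_
  have := (Finset.mem_filter.1 hv).2
  exact Finset.mem_filter.2 ⟨f.mem_box_of_val_eq hb this, this⟩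

theorem nine_mul_le (f : ReducedForm) : (9 : ℝ) ≤
    f.absDiscr * (1 / (f.A : ℝ) ^ 2 + 1 / (f.C : ℝ) ^ 2 + 1 / ((f.A : ℝ) + f.C - f.B) ^ 2) := by
  have hA : (0 : ℝ) < f.A := by exact_mod_cast f.A_pos
  obtain ⟨s, hs⟩ : ∃ s : ℝ, s = f.A - f.B := ⟨_, rfl⟩
  obtain ⟨t, ht⟩ : ∃ t : ℝ, t = f.C - f.A := ⟨_, rfl⟩
  obtain ⟨z, hz⟩ : ∃ z : ℝ, z = f.B / 2 := ⟨_, rfl⟩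
  have hs0 : 0 ≤ s := by rw [hs, sub_nonneg]; exact_mod_cast f.B_le
  have ht0 : 0 ≤ t := by rw [ht, sub_nonneg]; exact_mod_cast f.A_le
  have hz0 : 0 ≤ z := by rw [hz]; positivity
  have eA : (f.A : ℝ) = 2 * z + s := by rw [hs, hz]; ring
  have eC : (f.C : ℝ) = 2 * z + s + t := by rw [ht, hs, hz]; ring
  have eB : (f.B : ℝ) = 2 * z := by rw [hz]; ring
  have ed : (f.absDiscr : ℝ) = 4 * (2 * z + s) * (2 * z + s + t) - (2 * z) ^ 2 := by
    rw [absDiscr]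
    push_cast
    rw [eA, eB, eC]
  rw [ed, eA, eB, eC, show 2 * z + s + (2 * z + s + t) - 2 * z = 2 * z + 2 * s + t by ring]
  have ha : 0 < 2 * z + s := eA ▸ hA
  have hb : 0 < 2 * z + s + t := by linarith
  have hc : 0 < 2 * z + 2 * s + t := by linarith
  have aux : ∀ {a b c : ℝ}, 0 < a → 0 < b → 0 < c → 1 / a ^ 2 + 1 / b ^ 2 + 1 / c ^ 2 =
      (b ^ 2 * c ^ 2 + a ^ 2 * c ^ 2 + a ^ 2 * b ^ 2) / (a ^ 2 * b ^ 2 * c ^ 2) := by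
    intro a b c ha hb hc
    field_simp
  rw [aux ha hb hc, ← mul_div_assoc, le_div_iff₀ (by positivity), ← sub_nonneg]
  refine le_of_le_of_eq (b := 32*z^4*s^2 + 32*z^4*s*t + 32*z^4*t^2 + 64*z^3*s^3 + 96*z^3*s^2*t +
    160*z^3*s*t^2 + 40*z^2*s^4 + 80*z^2*s^3*t + 216*z^2*s^2*t^2 + 64*z^3*t^3 + 176*z^2*s*t^3 +
    40*z^2*t^4 + 8*z*s^5 + 20*z*s^4*t + 104*z*s^3*t^2 + 136*z*s^2*t^3 + 60*z*s*t^4 + 15*s^4*t^2 +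
    30*s^3*t^3 + 19*s^2*t^4 + 8*z*t^5 + 4*s*t^5) (by positivity) (by ring)

theorem le_sum_rep_div_sq {X : ℕ} (hX : f.A + f.C ≤ X) :
    (18 : ℝ) / f.absDiscr ≤ ∑ n ∈ Finset.Icc 1 X, (f.rep n : ℝ) * (1 / (n : ℝ) ^ 2) := by
  have hA := f.A_pos
  have hAC := f.A_le
  have hB := f.B_le
  have v1 : f.val (1, 0) = f.A := by simp [val]
  have v2 : f.val (-1, 0) = f.A := by simp [val]
  have v3 : f.val (0, 1) = f.C := by simp [val]
  have v4 : f.val (0, -1) = f.C := by simp [val]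
  have v5 : f.val (1, -1) = f.A + f.C - f.B := by
    zify [show f.B ≤ f.A + f.C by lia]
    rw [coe_val]
    ring
  have v6 : f.val (-1, 1) = f.A + f.C - f.B := by
    zify [show f.B ≤ f.A + f.C by lia]
    rw [coe_val]
    ring
  have key := f.sum_le_sum_rep_mul
    (S := {(1, 0), (-1, 0), (0, 1), (0, -1), (1, -1), (-1, 1)}) (X := X) (by
      simp only [Finset.mem_insert, Finset.mem_singleton, Finset.mem_Icc]
      rintro v (rfl | rfl | rfl | rfl | rfl | rfl) <;>
        simp only [v1, v2, v3, v4, v5, v6] <;> lia) (G := fun n => 1 / (n : ℝ) ^ 2)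
      fun n => by positivity
  refine le_trans ?_ key
  rw [Finset.sum_insert (by decide), Finset.sum_insert (by decide), Finset.sum_insert (by decide),
    Finset.sum_insert (by decide), Finset.sum_insert (by decide), Finset.sum_singleton,
    v1, v2, v3, v4, v5, v6, Nat.cast_sub (show f.B ≤ f.A + f.C by lia), Nat.cast_add]
  have hd : (0 : ℝ) < f.absDiscr := by exact_mod_cast f.absDiscr_pos
  rw [div_le_iff₀ hd]
  linarith [f.nine_mul_le]

theorem le_sum_rep_div_sq_of_one (hA : f.A = 1) {X : ℕ} (hX : 4 ≤ X) :
    17 / 8 ≤ ∑ n ∈ Finset.Icc 1 X, (f.rep n : ℝ) * (1 / (n : ℝ) ^ 2) := by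
  have v1 : f.val (1, 0) = 1 := by simp [val, hA]
  have v2 : f.val (-1, 0) = 1 := by simp [val, hA]
  have v3 : f.val (2, 0) = 4 := by simp [val, hA]
  have v4 : f.val (-2, 0) = 4 := by simp [val, hA]
  have key := f.sum_le_sum_rep_mul
    (S := {(1, 0), (-1, 0), (2, 0), (-2, 0)}) (X := X) (by
      simp only [Finset.mem_insert, Finset.mem_singleton, Finset.mem_Icc]
      rintro v (rfl | rfl | rfl | rfl) <;>
        simp only [v1, v2, v3, v4] <;> lia) (G := fun n => 1 / (n : ℝ) ^ 2)
      fun n => by positivity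
  refine le_trans ?_ key
  rw [Finset.sum_insert (by decide), Finset.sum_insert (by decide), Finset.sum_insert (by decide),
    Finset.sum_singleton, v1, v2, v3, v4]
  norm_num

/-- The pairs `(A, B)` with `A ≥ 2` for which there can be a reduced form of discriminant `-δ`. -/
def pairs (b δ : ℕ) : Finset (ℕ × ℕ) :=
  (Finset.Icc 2 b ×ˢ Finset.range (b + 1)).filter fun p =>
    p.2 ≤ p.1 ∧ (δ + p.2 * p.2) % (4 * p.1) = 0 ∧ 4 * p.1 * p.1 ≤ δ + p.2 * p.2

theorem mem_pairs {b δ : ℕ} (hb : δ < 3 * (b + 1) ^ 2) (hf : f.absDiscr = δ) (hA : f.A ≠ 1) :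
    (f.A, f.B) ∈ pairs b δ := by
  have h1 := f.A_pos
  have h2 := f.B_le
  have h3 := f.A_le
  have h4 : 4 * f.A * f.C = δ + f.B * f.B := by
    rw [absDiscr] at hf
    zify
    linarith
  have h5 : f.A ≤ b := by
    by_contra! h
    nlinarith [Nat.mul_le_mul h2 h2, Nat.mul_le_mul_left f.A h3, Nat.mul_le_mul h h]
  rw [pairs, Finset.mem_filter, Finset.mem_product, Finset.mem_Icc, Finset.mem_range]
  refine ⟨⟨⟨by lia, h5⟩, by lia⟩, h2, ?_, ?_⟩
  · change (δ + f.B * f.B) % (4 * f.A) = 0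
    rw [← h4, Nat.mul_mod_right]
  · change 4 * f.A * f.A ≤ δ + f.B * f.B
    rw [← h4]
    gcongr

theorem eq_of_pair_eq {g : ReducedForm} (hd : f.absDiscr = g.absDiscr) (hA : f.A = g.A)
    (hB : f.B = g.B) : f = g := by
  have hA0 := f.A_pos
  have hC : f.C = g.C := by
    rw [absDiscr, absDiscr, ← hA, ← hB] at hd
    have h1 : (4 * f.A : ℤ) * f.C = 4 * f.A * g.C := by linarith
    have h2 : (4 * f.A : ℤ) ≠ 0 := by positivity
    exact_mod_cast mul_left_cancel₀ h2 h1
  cases f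
  cases g
  simp_all

end ReducedForm

section FormSystem

variable {ι : Type} [Fintype ι] {a : ℕ → ℝ} {d : ℤ} {w : ℕ} (F : FormSystem ι a d w)

include F

theorem FormSystem.card_le {b δ : ℕ} (hδ : -d = δ) (hb : δ < 3 * (b + 1) ^ 2) :
    Fintype.card ι ≤ 2 * (ReducedForm.pairs b δ).card + 1 := by
  rw [← Finset.card_univ, ← Finset.card_erase_add_one (Finset.mem_univ F.one), mul_comm,
    ← Fintype.card_bool, ← Finset.card_univ, ← Finset.card_product]
  refine Nat.add_le_add_right (Finset.card_le_card_of_injOn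
    (fun i => (((F.form i).A, (F.form i).B), F.sign i)) (fun i hi => ?_) fun i _ j _ hij => ?_) 1
  · refine Finset.mem_product.2 ⟨(F.form i).mem_pairs hb ((F.absDiscr_eq i).trans hδ) fun h =>
      Finset.ne_of_mem_erase hi (F.eq_one i h), Finset.mem_univ _⟩
  · simp only [Prod.mk.injEq] at hij
    refine F.injective (Prod.ext ((F.form i).eq_of_pair_eq ?_ hij.1.1 hij.1.2) hij.2)
    rw [F.absDiscr_eq, F.absDiscr_eq]

theorem FormSystem.le_zetaNat_two (hs : Summable fun n : ℕ => a n / (n : ℝ) ^ 2)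
    (hpos : ∀ n, 0 ≤ a n) (ha : a 1 = 1) {δ : ℕ} (hδ : -d = δ) (h49 : 49 ≤ δ) :
    17 / 16 + 9 * ((Fintype.card ι : ℝ) - 1) / δ ≤ zetaNat a 2 := by
  have hw : (w : ℝ) = 2 := by exact_mod_cast F.w_eq_two ha (by rw [hδ]; exact_mod_cast by lia)
  obtain ⟨X, hX⟩ : ∃ X, ∀ i, (F.form i).A + (F.form i).C ≤ X :=
    ⟨_, fun i => Finset.single_le_sum (f := fun i => (F.form i).A + (F.form i).C)
      (fun _ _ => Nat.zero_le _) (Finset.mem_univ i)⟩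
  have hd : ∀ i, ((F.form i).absDiscr : ℝ) = δ := fun i => by
    rw [F.absDiscr_eq, hδ, Int.cast_natCast]
  have h1 : ∑ n ∈ Finset.Icc 1 (X + 4), a n / (n : ℝ) ^ 2 ≤ zetaNat a 2 :=
    hs.sum_le_tsum _ fun n _ => by have := hpos n; positivity
  have h2 : 2 * ∑ n ∈ Finset.Icc 1 (X + 4), a n / (n : ℝ) ^ 2 =
      ∑ i, ∑ n ∈ Finset.Icc 1 (X + 4), ((F.form i).rep n : ℝ) * (1 / (n : ℝ) ^ 2) := by
    rw [Finset.sum_comm, Finset.mul_sum]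
    refine Finset.sum_congr rfl fun n hn => ?_
    rw [← Finset.sum_mul, F.sum_rep n (Nat.pos_iff_ne_zero.1 (Finset.mem_Icc.1 hn).1), hw]
    ring
  have h3 : 17 / 8 + ((Fintype.card ι : ℝ) - 1) * (18 / δ) ≤
      ∑ i, ∑ n ∈ Finset.Icc 1 (X + 4), ((F.form i).rep n : ℝ) * (1 / (n : ℝ) ^ 2) := by
    rw [← Finset.add_sum_erase _ _ (Finset.mem_univ F.one)]
    refine add_le_add ((F.form F.one).le_sum_rep_div_sq_of_one (F.A_one ha)
      (by lia)) ?_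
    have h4 : (((Finset.univ.erase F.one).card : ℕ) : ℝ) = (Fintype.card ι : ℝ) - 1 := by
      rw [Finset.card_erase_of_mem (Finset.mem_univ _), Finset.card_univ,
        Nat.cast_sub (Fintype.card_pos_iff.2 ⟨F.one⟩), Nat.cast_one]
    rw [← h4, ← nsmul_eq_mul]
    refine Finset.card_nsmul_le_sum _ _ _ fun i _ => ?_
    rw [← hd i]
    exact (F.form i).le_sum_rep_div_sq (by have := hX i; lia)
  have h5 : 9 * ((Fintype.card ι : ℝ) - 1) / δ = ((Fintype.card ι : ℝ) - 1) * (18 / δ) / 2 := by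
    ring
  rw [h5]
  linarith

end FormSystem

/-- A rational upper bound for half of the residue at a nonnegative integer. -/
def largeBound (δ h : ℕ) : ℚ :=
  h * (39.4785 / δ / (17 / 16 + 9 * (h - 1) / δ) + (39.4785 / δ) ^ 3 / 97)

theorem sq_largeBound_lt_of_lt {δ h : ℕ} (h49 : 49 ≤ δ) (hδ : δ < 196)
    (hh : h ≤ 2 * (ReducedForm.pairs 8 δ).card + 1) : 39.4785 / δ * largeBound δ h ^ 2 < 4 := by
  have : ∀ δ < 196, 49 ≤ δ → ∀ h < 2 * (ReducedForm.pairs 8 δ).card + 2,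
    39.4785 / δ * largeBound δ h ^ 2 < 4 := by decide +kernel
  exact this δ hδ h49 h (by lia)

theorem sq_largeBound_lt {δ h : ℕ} (h49 : 49 ≤ δ)
    (hh : ∀ b, δ < 3 * (b + 1) ^ 2 → h ≤ 2 * (ReducedForm.pairs b δ).card + 1) :
    39.4785 / δ * largeBound δ h ^ 2 < 4 := by
  obtain hδ | hδ := lt_or_ge δ 196
  · exact sq_largeBound_lt_of_lt h49 hδ (hh 8 (by lia))
  have hh' : h ≤ 2 * δ := by
    have h1 := hh (Nat.sqrt (δ / 3)) (by
      have := Nat.lt_succ_sqrt (δ / 3)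
      rw [Nat.succ_eq_add_one] at this
      rw [pow_two]
      lia)
    have h2 : (ReducedForm.pairs (Nat.sqrt (δ / 3)) δ).card ≤
        Nat.sqrt (δ / 3) * (Nat.sqrt (δ / 3) + 1) := by
      refine (Finset.card_filter_le _ _).trans ?_
      rw [Finset.card_product, Nat.card_Icc, Finset.card_range]
      gcongr
      lia
    have h3 := Nat.sqrt_le (δ / 3)
    have h4 := Nat.sqrt_le_self (δ / 3)
    rw [mul_add] at h2
    lia
  have hδ0 : (196 : ℚ) ≤ δ := by exact_mod_cast hδ
  have hδ1 : (0 : ℚ) < δ := by linarith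
  have hh1 : (h : ℚ) ≤ 2 * δ := by exact_mod_cast hh'
  have hh0 : (0 : ℚ) ≤ h := h.cast_nonneg
  obtain ⟨z, hz⟩ : ∃ z : ℚ, z = 39.4785 / δ := ⟨_, rfl⟩
  have hz0 : 0 < z := by rw [hz]; positivity
  have hz1 : z ≤ 0.20143 := by
    rw [hz, div_le_iff₀ hδ1]
    linarith
  have hzδ : z * δ = 39.4785 := by rw [hz, div_mul_cancel₀ _ hδ1.ne']
  have hζ : 9 * h / δ ≤ 17 / 16 + 9 * ((h : ℚ) - 1) / δ := by
    rw [mul_sub, sub_div, mul_one]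
    have : 9 / (δ : ℚ) ≤ 17 / 16 := by rw [div_le_iff₀ hδ1]; linarith
    linarith
  have hB : 0 ≤ largeBound δ h ∧ largeBound δ h ≤ 4.43 := by
    rw [largeBound, ← hz]
    have h17 : 0 < 17 / 16 + 9 * ((h : ℚ) - 1) / δ := by
      rw [mul_sub, sub_div, mul_one]
      have : 9 / (δ : ℚ) ≤ 1 := by rw [div_le_iff₀ hδ1]; linarith
      have : 0 ≤ 9 * (h : ℚ) / δ := by positivity
      linarith
    refine ⟨by positivity, ?_⟩
    rw [mul_add]
    have e1 : h * (z / (17 / 16 + 9 * ((h : ℚ) - 1) / δ)) ≤ z * δ / 9 := by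
      rw [← mul_div_assoc, div_le_iff₀ h17]
      calc (h : ℚ) * z = z * δ / 9 * (9 * h / δ) := by field_simp
        _ ≤ _ := by gcongr
    have e2 : h * (z ^ 3 / 97) ≤ 2 * (z * δ) * z ^ 2 / 97 := by
      calc (h : ℚ) * (z ^ 3 / 97) ≤ 2 * δ * (z ^ 3 / 97) := by gcongr
        _ = _ := by ring
    rw [hzδ] at e1 e2
    have e3 : z ^ 2 ≤ 0.20143 ^ 2 := by gcongr
    norm_num at e1 e2 e3 ⊢
    linarith
  rw [← hz]
  calc z * largeBound δ h ^ 2 ≤ 0.20143 * 4.43 ^ 2 := by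
        have := hB.1
        have := hB.2
        gcongr
    _ < 4 := by norm_num

theorem FormSystem.false_of_large {ι : Type} [Fintype ι] {a c : ℕ → ℝ} {d : ℤ} {w δ : ℕ}
    (F : FormSystem ι a d w) (hδ : -d = δ) (h49 : 49 ≤ δ)
    (P : ZetaPair a c (√(-d : ℤ) / (2 * Real.pi)) (Fintype.card ι / w))
    (hac : ∀ n, n ≠ 0 → ∑ p ∈ n.divisorsAntidiagonal, a p.1 * c p.2 = if n = 1 then 1 else 0)
    (hlim : ∀ ε > 0, ∃ N : ℕ, ∀ n, N ≤ n → |∑ k ∈ Finset.Icc 1 n, c k| ≤ (1 + ε) * √n) :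
    False := by
  have hw : (w : ℝ) = 2 := by exact_mod_cast F.w_eq_two P.a_one (by rw [hδ]; exact_mod_cast by lia)
  have hd : ((-d : ℤ) : ℝ) = δ := by rw [hδ, Int.cast_natCast]
  have hζ := F.le_zetaNat_two (P.summable_nat le_rfl) P.nonneg P.a_one hδ h49
  have hh0 : 0 < Fintype.card ι := Fintype.card_pos_iff.2 ⟨F.one⟩
  have hB := sq_largeBound_lt h49 fun _ hb => F.card_le hδ hb
  rw [hw, hd] at P
  set h := Fintype.card ι
  have hδ1 : (49 : ℝ) ≤ δ := by exact_mod_cast h49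
  have hδ0 : (0 : ℝ) < δ := by linarith
  have hh1 : (1 : ℝ) ≤ h := by exact_mod_cast hh0
  have hD := P.D_pos
  set D : ℝ := √δ / (2 * Real.pi) with hDdef
  have hc1 : c 1 = 1 := by simpa [P.a_one] using hac 1 one_ne_zero
  have key := P.abs_sum_sub_tsum_residue_le hlim le_rfl
  rw [Finset.Icc_self, Finset.sum_singleton, hc1, Nat.cast_one, Real.sqrt_one, _root_.abs_le] at key
  have hpi : (2 * Real.pi) ^ 2 ≤ 39.4785 := by
    have h2 := Real.pi_lt_d6
    have h3 := Real.pi_pos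
    have h4 : Real.pi ^ 2 ≤ 3.141593 ^ 2 := by gcongr
    rw [mul_pow]
    norm_num at h4 ⊢
    linarith
  have hz : 1 / D ^ 2 ≤ 39.4785 / δ := by
    rw [hDdef, div_pow, Real.sq_sqrt hδ0.le, one_div_div]
    gcongr
  set Z : ℝ := 39.4785 / δ with hZ
  have hZ1 : Z ≤ 3 / 2 := by
    rw [hZ, div_le_iff₀ hδ0]
    linarith
  have hz0 : 0 < 1 / D ^ 2 := by positivity
  have e1 := P.tsum_residueTerm_le le_rfl (by rw [Nat.cast_one, mul_one]; exact hz.trans hZ1)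
  rw [Nat.cast_one, mul_one] at e1
  have hζ0 : 0 < 17 / 16 + 9 * ((h : ℝ) - 1) / δ := by
    have : 0 ≤ 9 * ((h : ℝ) - 1) / δ := by
      have : 0 ≤ (h : ℝ) - 1 := by linarith
      positivity
    linarith
  set R : ℝ := Z / (17 / 16 + 9 * ((h : ℝ) - 1) / δ) + Z ^ 3 / 97 with hR
  have hR0 : 0 ≤ R := by positivity
  have h2 : 1 / D ^ 2 / zetaNat a 2 + (1 / D ^ 2) ^ 3 / 97 ≤ R := by
    rw [hR]
    gcongr
  have h3 : 2 / (h : ℝ) ≤ 1 / D * R := by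
    have : 1 / D * (1 / D ^ 2 / zetaNat a 2 + (1 / D ^ 2) ^ 3 / 97) ≤ 1 / D * R := by gcongr
    have hr : -1 / ((h : ℝ) / 2) = - (2 / h) := by rw [neg_div, one_div_div]
    rw [hr] at e1
    linarith [key.2]
  have h4 : 2 ≤ 1 / D * (h * R) := by
    rw [div_le_iff₀ (by linarith)] at h3
    linarith
  have h5 : 4 ≤ 1 / D ^ 2 * (h * R) ^ 2 := by
    calc (4 : ℝ) = 2 ^ 2 := by norm_num
      _ ≤ (1 / D * (h * R)) ^ 2 := by gcongr
      _ = _ := by ring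
  have h6 : Z * (h * R) ^ 2 < 4 := by
    have := (Rat.cast_lt (K := ℝ)).2 hB
    rw [largeBound] at this
    push_cast at this
    exact this
  have h7 : 1 / D ^ 2 * (h * R) ^ 2 ≤ Z * (h * R) ^ 2 := by gcongr
  linarith

section GaussianCount

/-- The number of Gaussian integers of norm `n`. -/
def gaussCount (n : ℕ) : ℕ := {z : GaussianInt | z.norm = n}.ncard

theorem finite_gaussianInt_norm_eq (n : ℕ) : {z : GaussianInt | z.norm = n}.Finite := by
  refine Set.Finite.of_injOn (f := fun z : GaussianInt => (z.re, z.im)) (fun z hz => ?_)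
    (fun z _ w _ h => ?_) ((Set.finite_Icc (-n : ℤ) n).prod (Set.finite_Icc (-n : ℤ) n))
  · rw [Set.mem_ofPred_eq, Zsqrtd.norm_def] at hz
    simp only [Set.mem_prod, Set.mem_Icc]
    refine ⟨⟨?_, ?_⟩, ?_, ?_⟩ <;>
      nlinarith [Int.le_self_sq z.re, Int.le_self_sq (-z.re), Int.le_self_sq z.im,
        Int.le_self_sq (-z.im), sq_nonneg z.re, sq_nonneg z.im]
  · simp only [Prod.mk.injEq] at h
    exact Zsqrtd.ext h.1 h.2

theorem gaussCount_one : gaussCount 1 = 4 := by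
  have h : {z : GaussianInt | z.norm = (1 : ℕ)} =
      (({⟨1, 0⟩, ⟨-1, 0⟩, ⟨0, 1⟩, ⟨0, -1⟩} : Finset GaussianInt) : Set GaussianInt) := by
    ext ⟨x, y⟩
    simp only [Set.mem_ofPred_eq, Zsqrtd.norm_def, Finset.coe_insert, Finset.coe_singleton,
      Set.mem_insert_iff, Set.mem_singleton_iff, Zsqrtd.mk.injEq]
    constructor
    · intro h
      have hx : x ≤ 1 := by push_cast at h; nlinarith [mul_self_nonneg y]
      have hx' : -1 ≤ x := by push_cast at h; nlinarith [mul_self_nonneg y]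
      have hy : y ≤ 1 := by push_cast at h; nlinarith [mul_self_nonneg x]
      have hy' : -1 ≤ y := by push_cast at h; nlinarith [mul_self_nonneg x]
      interval_cases x <;> interval_cases y <;> simp_all
    · rintro (⟨rfl, rfl⟩ | ⟨rfl, rfl⟩ | ⟨rfl, rfl⟩ | ⟨rfl, rfl⟩) <;> simp
  rw [gaussCount, h, Set.ncard_coe_finset]
  rfl

theorem ncard_image_mul {π : GaussianInt} (hπ : π ≠ 0) (n : ℕ) :
    ((π * ·) '' {z : GaussianInt | z.norm = n}).ncard = gaussCount n :=
  Set.ncard_image_of_injective _ (mul_right_injective₀ hπ)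

theorem norm_eq_mul_iff {p : ℕ} (hp : p ≠ 0) {π w : GaussianInt} (hπ : π.norm = p) (m : ℕ) :
    (π * w).norm = (p * m : ℕ) ↔ w.norm = m := by
  rw [Zsqrtd.norm_mul, hπ, Nat.cast_mul]
  exact mul_right_inj' (Nat.cast_ne_zero.2 hp)

theorem mem_image_mul_iff {p : ℕ} (hp : p ≠ 0) {π z : GaussianInt} (hπ : π.norm = p) (m : ℕ) :
    z ∈ (π * ·) '' {z : GaussianInt | z.norm = m} ↔ z.norm = (p * m : ℕ) ∧ π ∣ z := by
  constructor
  · rintro ⟨w, hw, rfl⟩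
    exact ⟨(norm_eq_mul_iff hp hπ m).2 hw, dvd_mul_right _ _⟩
  · rintro ⟨h, w, rfl⟩
    exact ⟨w, (norm_eq_mul_iff hp hπ m).1 h, rfl⟩

theorem ncard_norm_eq_and_dvd {p : ℕ} (hp : p.Prime) (m : ℕ) :
    {z : GaussianInt | z.norm = (p * m : ℕ) ∧ (p : GaussianInt) ∣ z}.ncard =
      if p ∣ m then gaussCount (m / p) else 0 := by
  have h2 : (p : GaussianInt).norm = (p * p : ℕ) := by
    rw [← Int.cast_natCast, Zsqrtd.norm_intCast]; push_cast; rfl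
  split_ifs with h
  · obtain ⟨k, rfl⟩ := h
    rw [Nat.mul_div_cancel_left k hp.pos, ← ncard_image_mul (π := (p : GaussianInt))
      (Nat.cast_ne_zero.2 hp.ne_zero)]
    congr 1
    ext z
    rw [mem_image_mul_iff (mul_ne_zero hp.ne_zero hp.ne_zero) h2, mul_assoc]
    rfl
  · rw [Set.ncard_eq_zero (Set.Finite.subset (finite_gaussianInt_norm_eq _) fun z hz => hz.1)]
    ext z
    simp only [Set.mem_ofPred_eq, Set.mem_empty_iff_false, iff_false, not_and]
    rintro hz ⟨w, rfl⟩
    rw [Zsqrtd.norm_mul, h2] at hz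
    push_cast at hz
    rw [mul_assoc] at hz
    have h3 := mul_left_cancel₀ (Nat.cast_ne_zero.2 hp.ne_zero) hz
    exact h (Int.natCast_dvd_natCast.1 ⟨_, h3.symm⟩)

theorem gaussCount_two_mul (m : ℕ) : gaussCount (2 * m) = gaussCount m := by
  have h2 : (⟨1, 1⟩ : GaussianInt).norm = (2 : ℕ) := rfl
  rw [← ncard_image_mul (π := ⟨1, 1⟩) (by simp [Zsqrtd.ext_iff]) m, gaussCount]
  congr 1
  ext z
  rw [mem_image_mul_iff two_ne_zero h2, Set.mem_ofPred_eq, iff_self_and]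
  intro h
  rw [Zsqrtd.norm_def] at h
  have h3 : (z.re + z.im) % 2 = 0 := by
    have := congrArg (· % 2) h
    simp only [Nat.cast_mul, Nat.cast_ofNat, Int.mul_emod_right] at this
    rcases Int.emod_two_eq_zero_or_one z.re with h1 | h1 <;>
      rcases Int.emod_two_eq_zero_or_one z.im with h2 | h2 <;>
      simp [Int.add_emod, Int.mul_emod, h1, h2] at this ⊢
  refine ⟨⟨(z.re + z.im) / 2, (z.im - z.re) / 2⟩, ?_⟩
  ext
  · simp; lia
  · simp; lia

theorem gaussCount_mul_of_mod_four_eq_three {p : ℕ} (hp : p.Prime) (h3 : p % 4 = 3) (m : ℕ) :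
    gaussCount (p * m) = if p ∣ m then gaussCount (m / p) else 0 := by
  rw [← ncard_norm_eq_and_dvd hp, gaussCount]
  congr 1
  ext z
  rw [Set.mem_ofPred_eq, Set.mem_ofPred_eq, iff_self_and]
  intro h
  have := Fact.mk hp
  have hP := GaussianInt.prime_of_nat_prime_of_mod_four_eq_three p h3
  have h4 : (p : GaussianInt) ∣ z * star z := by
    rw [← Zsqrtd.norm_eq_mul_conj, h]
    push_cast
    exact dvd_mul_right _ _
  rcases hP.dvd_or_dvd h4 with h5 | ⟨w, hw⟩
  · exact h5
  · refine ⟨star w, ?_⟩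
    rw [← star_star z, hw, star_mul, star_natCast, mul_comm]

theorem dvd_or_star_dvd {p : ℕ} (hp : p.Prime) {π z : GaussianInt} (hπ : π.norm = p)
    (hz : (p : ℤ) ∣ z.norm) : π ∣ z ∨ star π ∣ z := by
  have hπ0 : π ≠ 0 := by rintro rfl; simp at hπ; exact hp.ne_zero (by exact_mod_cast hπ.symm)
  have key : ∀ π : GaussianInt, π.norm = p → (p : ℤ) ∣ z.re * π.re + z.im * π.im → π ∣ z := by
    intro π hπ h
    have hπ0 : star π ≠ 0 := by
      rintro h0
      rw [star_eq_zero] at h0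
      subst h0; simp at hπ; exact hp.ne_zero (by exact_mod_cast hπ.symm)
    have h1 : (p : ℤ) ∣ (z.im * π.re - z.re * π.im) ^ 2 := by
      have : (z.im * π.re - z.re * π.im) ^ 2 =
          z.norm * π.norm - (z.re * π.re + z.im * π.im) * (z.re * π.re + z.im * π.im) := by
        rw [Zsqrtd.norm_def, Zsqrtd.norm_def]; ring
      rw [this]
      exact dvd_sub (hz.mul_right _) (h.mul_right _)
    obtain ⟨a, ha⟩ := h
    obtain ⟨b, hb⟩ := (Nat.prime_iff_prime_int.1 hp).dvd_of_dvd_pow h1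
    refine ⟨⟨a, b⟩, ?_⟩
    apply mul_right_cancel₀ hπ0
    rw [mul_right_comm, ← Zsqrtd.norm_eq_mul_conj, hπ]
    ext
    · simp; linarith
    · simp; linarith
  have h2 : (p : ℤ) ∣ (z.re * π.re + z.im * π.im) * (z.re * π.re - z.im * π.im) := by
    have : (z.re * π.re + z.im * π.im) * (z.re * π.re - z.im * π.im) =
        z.re ^ 2 * π.norm - π.im ^ 2 * z.norm := by
      rw [Zsqrtd.norm_def, Zsqrtd.norm_def]; ring
    rw [this, hπ]
    exact dvd_sub (dvd_mul_left _ _) (hz.mul_left _)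
  rcases (Nat.prime_iff_prime_int.1 hp).dvd_or_dvd h2 with h | h
  · exact Or.inl (key π hπ h)
  · refine Or.inr (key (star π) (by rwa [Zsqrtd.norm_conj]) ?_)
    simpa [sub_eq_add_neg] using h

theorem gaussCount_mul_of_mod_four_eq_one {p : ℕ} (hp : p.Prime) (h1 : p % 4 = 1) (m : ℕ) :
    gaussCount (p * m) + (if p ∣ m then gaussCount (m / p) else 0) = 2 * gaussCount m := by
  have := Fact.mk hp
  obtain ⟨u, v, huv⟩ := Nat.Prime.sq_add_sq (p := p) (by lia)
  set π : GaussianInt := ⟨u, v⟩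
  have hπ : π.norm = p := by
    rw [← huv, Zsqrtd.norm_def]; simp only [π]; push_cast; ring
  have hπ' : (star π).norm = p := by rwa [Zsqrtd.norm_conj]
  have hπ0 : π ≠ 0 := by
    rintro h
    rw [h] at hπ
    simp at hπ
    exact hp.ne_zero (by exact_mod_cast hπ.symm)
  have hπ0' : star π ≠ 0 := by rwa [Ne, star_eq_zero]
  have hmul : π * star π = p := by rw [← Zsqrtd.norm_eq_mul_conj, hπ]; simp
  have hco : IsCoprime π (star π) := by
    have h0 : ¬ p ∣ 2 * u := by
      intro h
      rcases (Nat.Prime.dvd_mul hp).1 h with h | h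
      · have := (Nat.prime_dvd_prime_iff_eq hp Nat.prime_two).1 h
        lia
      · have hu : u ≠ 0 := by
          rintro rfl
          have : IsSquare p := ⟨v, by rw [← huv]; ring⟩
          exact (Nat.prime_iff.1 hp).irreducible.not_isSquare this
        have := Nat.le_of_dvd (Nat.pos_of_ne_zero hu) h
        have := hp.two_le
        nlinarith [sq_nonneg v]
    have h2 : IsCoprime (2 * u : ℤ) (p : ℤ) := by
      have := Nat.isCoprime_iff_coprime.2 ((Nat.Prime.coprime_iff_not_dvd hp).2 h0).symm
      simpa using this
    obtain ⟨α, β, h⟩ := h2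
    refine ⟨α + β * star π, α, ?_⟩
    have h3 : π + star π = (2 * u : ℤ) := by
      ext <;> simp [π]; ring
    have h4 : ((α * (2 * u) + β * p : ℤ) : GaussianInt) = 1 := by rw [h]; simp
    rw [Int.cast_add, Int.cast_mul, ← h3, Int.cast_mul, Int.cast_natCast, ← hmul] at h4
    linear_combination h4
  rw [← ncard_norm_eq_and_dvd hp, gaussCount, two_mul]
  nth_rewrite 1 [← ncard_image_mul hπ0]
  rw [← ncard_image_mul hπ0', ← Set.ncard_union_add_ncard_inter _ _
    ((finite_gaussianInt_norm_eq m).image _) ((finite_gaussianInt_norm_eq m).image _)]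
  congr 2
  · ext z
    rw [Set.mem_union, mem_image_mul_iff hp.ne_zero hπ, mem_image_mul_iff hp.ne_zero hπ',
      ← and_or_left, Set.mem_ofPred_eq, iff_self_and]
    intro h
    exact dvd_or_star_dvd hp hπ (h ▸ by push_cast; exact dvd_mul_right _ _)
  · ext z
    rw [Set.mem_inter_iff, mem_image_mul_iff hp.ne_zero hπ, mem_image_mul_iff hp.ne_zero hπ',
      ← and_and_left, Set.mem_ofPred_eq, ← hmul]
    refine and_congr_right fun _ => ⟨fun h => ⟨(dvd_mul_right _ _).trans h,
      (dvd_mul_left _ _).trans h⟩, fun h => hco.mul_dvd h.1 h.2⟩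

theorem sum_divisors_χ₄_prime_mul {p m : ℕ} (hp : p.Prime) (hm : m ≠ 0) :
    ∑ d ∈ (p * m).divisors, ZMod.χ₄ d + ZMod.χ₄ p * (if p ∣ m then ∑ d ∈ (m / p).divisors,
      ZMod.χ₄ d else 0) = (1 + ZMod.χ₄ p) * ∑ d ∈ m.divisors, ZMod.χ₄ d := by
  have hinj : ∀ s : Finset ℕ, Set.InjOn (p * ·) (s : Set ℕ) := fun s =>
    (mul_right_injective₀ hp.ne_zero).injOn
  have himg : ∀ n : ℕ, ∑ d ∈ n.divisors.image (p * ·), ZMod.χ₄ d =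
      ZMod.χ₄ p * ∑ d ∈ n.divisors, ZMod.χ₄ d := by
    intro n
    rw [Finset.sum_image (hinj _), Finset.mul_sum]
    exact Finset.sum_congr rfl fun d _ => by rw [Nat.cast_mul, map_mul]
  have hU : (p * m).divisors = m.divisors ∪ m.divisors.image (p * ·) := by
    ext d
    simp only [Nat.mem_divisors, Finset.mem_union, Finset.mem_image, ne_eq, mul_eq_zero,
      hp.ne_zero, hm, or_self, not_false_eq_true, and_true]
    constructor
    · intro h
      by_cases hd : p ∣ d
      · obtain ⟨e, rfl⟩ := hd
        exact Or.inr ⟨e, Nat.dvd_of_mul_dvd_mul_left hp.pos h, rfl⟩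
      · exact Or.inl (((Nat.Prime.coprime_iff_not_dvd hp).2 hd).symm.dvd_of_dvd_mul_left h)
    · rintro (h | ⟨e, h, rfl⟩)
      · exact h.mul_left p
      · exact mul_dvd_mul_left p h
  have hI : ∑ d ∈ m.divisors ∩ m.divisors.image (p * ·), ZMod.χ₄ d =
      ZMod.χ₄ p * (if p ∣ m then ∑ d ∈ (m / p).divisors, ZMod.χ₄ d else 0) := by
    split_ifs with h
    · rw [← himg]
      congr 1
      obtain ⟨k, rfl⟩ := h
      rw [Nat.mul_div_cancel_left k hp.pos]
      have hk : k ≠ 0 := right_ne_zero_of_mul hm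
      ext d
      simp only [Finset.mem_inter, Finset.mem_image, Nat.mem_divisors]
      constructor
      · rintro ⟨⟨h1, _⟩, e, _, rfl⟩
        exact ⟨e, ⟨Nat.dvd_of_mul_dvd_mul_left hp.pos h1, hk⟩, rfl⟩
      · rintro ⟨e, ⟨h1, _⟩, rfl⟩
        exact ⟨⟨mul_dvd_mul_left p h1, hm⟩, e, ⟨h1.mul_left p, hm⟩, rfl⟩
    · rw [mul_zero]
      refine Finset.sum_eq_zero fun d hd => absurd ?_ h
      simp only [Finset.mem_inter, Finset.mem_image, Nat.mem_divisors] at hd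
      obtain ⟨⟨h1, _⟩, e, _, rfl⟩ := hd
      exact (dvd_mul_right _ _).trans h1
  rw [hU, ← hI, Finset.sum_union_inter, himg]
  ring

theorem gaussCount_eq (n : ℕ) (hn : n ≠ 0) :
    (gaussCount n : ℤ) = 4 * ∑ d ∈ n.divisors, ZMod.χ₄ d := by
  induction n using Nat.strong_induction_on with
  | _ n ih =>
    by_cases h1 : n = 1
    · subst h1
      simp [gaussCount_one]
    obtain ⟨p, hp, m, rfl⟩ := Nat.exists_prime_and_dvd h1
    have hm : m ≠ 0 := right_ne_zero_of_mul hn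
    have hlt : m < p * m := lt_mul_left (Nat.pos_of_ne_zero hm) hp.one_lt
    have key : ((if p ∣ m then gaussCount (m / p) else 0 : ℕ) : ℤ) =
        4 * (if p ∣ m then ∑ d ∈ (m / p).divisors, ZMod.χ₄ d else 0) := by
      split_ifs with h
      · exact ih _ ((Nat.div_le_self m p).trans_lt hlt)
          (Nat.div_ne_zero_iff_of_dvd h |>.2 ⟨hm, hp.ne_zero⟩)
      · simp
    have hr := sum_divisors_χ₄_prime_mul hp hm
    have him := ih m hlt hm
    rcases hp.eq_two_or_odd with rfl | hodd
    · rw [gaussCount_two_mul, him]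
      have : ZMod.χ₄ (2 : ℕ) = 0 := by decide
      rw [this] at hr
      linear_combination -4 * hr
    · rcases Nat.odd_mod_four_iff.1 hodd with h | h
      · have hc := gaussCount_mul_of_mod_four_eq_one hp h m
        rw [ZMod.χ₄_nat_one_mod_four h] at hr
        replace hc := congrArg (Nat.cast (R := ℤ)) hc
        rw [Nat.cast_add] at hc
        push_cast [-Nat.cast_ite] at hc
        rw [key] at hc
        linear_combination hc + 2 * him - 4 * hr
      · rw [gaussCount_mul_of_mod_four_eq_three hp h, key]
        rw [ZMod.χ₄_nat_three_mod_four h] at hr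
        linear_combination -4 * hr

end GaussianCount

section Hyperbola

variable {R : Type*} [CommRing R]

theorem sum_divisorsAntidiagonal_hyperbola (f g : ℕ → R) (v : ℕ) :
    ∑ n ∈ Finset.Icc 1 v, ∑ p ∈ n.divisorsAntidiagonal, f p.1 * g p.2 =
      ∑ j ∈ Finset.Icc 1 v.sqrt, f j * ∑ k ∈ Finset.Icc 1 (v / j), g k +
      ∑ k ∈ Finset.Icc 1 v.sqrt, g k * ∑ j ∈ Finset.Icc 1 (v / k), f j -
      (∑ j ∈ Finset.Icc 1 v.sqrt, f j) * ∑ k ∈ Finset.Icc 1 v.sqrt, g k := by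
  have hs := Nat.sqrt_le' v
  have hs' := Nat.lt_succ_sqrt' v
  set s := v.sqrt
  have hsv : s ≤ v := Nat.sqrt_le_self v
  have hI : ∀ M : ℕ, Finset.Icc 1 M = Finset.Ioc 0 M := fun M => rfl
  have hsplit : ∀ (h : ℕ → R) (t : ℕ), s ≤ t → ∑ n ∈ Finset.Icc 1 t, h n =
      ∑ n ∈ Finset.Icc 1 s, h n + ∑ n ∈ Finset.Ioc s t, h n := by
    intro h t hst
    rw [hI, hI, Finset.sum_Ioc_consecutive _ (Nat.zero_le s) hst]
  rw [sum_divisorsAntidiagonal_eq_sum_div, hsplit _ v hsv]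
  have h1 : ∑ j ∈ Finset.Ioc s v, f j * ∑ k ∈ Finset.Icc 1 (v / j), g k =
      ∑ k ∈ Finset.Icc 1 s, g k * ∑ j ∈ Finset.Ioc s (v / k), f j := by
    simp only [Finset.mul_sum]
    rw [Finset.sum_sigma', Finset.sum_sigma']
    refine Finset.sum_bij' (fun p _ => ⟨p.2, p.1⟩) (fun p _ => ⟨p.2, p.1⟩) ?_ ?_
      (fun _ _ => rfl) (fun _ _ => rfl) (fun _ _ => mul_comm _ _)
    · rintro ⟨j, k⟩ h
      simp only [Finset.mem_sigma, Finset.mem_Ioc, Finset.mem_Icc] at h ⊢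
      obtain ⟨⟨h1, h2⟩, h3, h4⟩ := h
      rw [Nat.le_div_iff_mul_le (by lia)] at h4
      refine ⟨⟨h3, ?_⟩, h1, ?_⟩
      · by_contra! hk
        have : (s + 1) * (s + 1) ≤ k * j := Nat.mul_le_mul hk h1
        rw [Nat.succ_eq_add_one, sq] at hs'
        lia
      · rw [Nat.le_div_iff_mul_le (by lia), mul_comm]
        exact h4
    · rintro ⟨k, j⟩ h
      simp only [Finset.mem_sigma, Finset.mem_Ioc, Finset.mem_Icc] at h ⊢
      obtain ⟨⟨h1, h2⟩, h3, h4⟩ := h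
      rw [Nat.le_div_iff_mul_le (by lia)] at h4
      refine ⟨⟨h3, (Nat.le_mul_of_pos_right j h1).trans h4⟩, h1, ?_⟩
      rw [Nat.le_div_iff_mul_le (by lia), mul_comm]
      exact h4
  have h2 : ∑ k ∈ Finset.Icc 1 s, g k * ∑ j ∈ Finset.Icc 1 (v / k), f j =
      ∑ k ∈ Finset.Icc 1 s, g k * ∑ j ∈ Finset.Ioc s (v / k), f j +
      (∑ j ∈ Finset.Icc 1 s, f j) * ∑ k ∈ Finset.Icc 1 s, g k := by
    rw [mul_comm, Finset.sum_mul, ← Finset.sum_add_distrib]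
    refine Finset.sum_congr rfl fun k hk => ?_
    rw [Finset.mem_Icc] at hk
    rw [hsplit f (v / k), mul_add, add_comm]
    rw [Nat.le_div_iff_mul_le (by lia)]
    exact (Nat.mul_le_mul_left s hk.2).trans (by rwa [← sq])
  rw [h1, h2]
  ring

theorem sum_Icc_eq_sum_odd {h : ℕ → R} (hh : ∀ n, n % 2 = 0 → h n = 0) (v : ℕ) :
    ∑ n ∈ Finset.Icc 1 v, h n = ∑ i ∈ Finset.range ((v + 1) / 2), h (2 * i + 1) := by
  induction v with
  | zero => simp
  | succ v ih =>
    rw [Finset.sum_Icc_succ_top (by lia), ih]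
    rcases Nat.mod_two_eq_zero_or_one v with h0 | h0
    · rw [show (v + 1 + 1) / 2 = (v + 1) / 2 + 1 by lia, Finset.sum_range_succ]
      congr 2
      lia
    · rw [show (v + 1 + 1) / 2 = (v + 1) / 2 by lia, hh (v + 1) (by lia), add_zero]

end Hyperbola

section GaussianMoebius

open ArithmeticFunction
open scoped ArithmeticFunction.zeta

/-- The Möbius function restricted to odd numbers. -/
def oddMoebius (n : ℕ) : ℤ := if n % 2 = 0 then 0 else ArithmeticFunction.moebius n

/-- The Möbius function twisted by `χ₄`. -/
def twistedMoebius (n : ℕ) : ℤ := ArithmeticFunction.moebius n * ZMod.χ₄ n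

theorem χ₄_of_even {n : ℕ} (hn : n % 2 = 0) : ZMod.χ₄ n = 0 := by
  rw [ZMod.χ₄_nat_eq_if_mod_four, if_pos hn]

theorem twistedMoebius_of_even {n : ℕ} (hn : n % 2 = 0) : twistedMoebius n = 0 := by
  rw [twistedMoebius, χ₄_of_even hn, mul_zero]

theorem moebius_two_mul (n : ℕ) : ArithmeticFunction.moebius (2 * n) = -oddMoebius n := by
  rw [oddMoebius]
  split_ifs with h
  · rw [neg_zero]
    refine ArithmeticFunction.moebius_eq_zero_of_not_squarefree fun hs => ?_
    have h2 : 2 * 2 ∣ 2 * n := mul_dvd_mul_left 2 (Nat.dvd_of_mod_eq_zero h)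
    exact absurd (hs 2 h2) (by simp)
  · rw [ArithmeticFunction.isMultiplicative_moebius.map_mul_of_coprime
      (Nat.coprime_two_left.2 (Nat.odd_iff.2 (by lia))),
      ArithmeticFunction.moebius_apply_prime Nat.prime_two, neg_one_mul]

/-- The summatory function of `oddMoebius * twistedMoebius`. -/
def oddMertens (v : ℕ) : ℤ :=
  ∑ n ∈ Finset.Icc 1 v, ∑ p ∈ n.divisorsAntidiagonal, oddMoebius p.1 * twistedMoebius p.2

theorem sum_moebius_mul_twistedMoebius (N : ℕ) :
    ∑ n ∈ Finset.Icc 1 N, ∑ p ∈ n.divisorsAntidiagonal,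
      ArithmeticFunction.moebius p.1 * twistedMoebius p.2 = oddMertens N - oddMertens (N / 2) := by
  rw [oddMertens, oddMertens,
    sum_divisorsAntidiagonal_eq_sum_div (fun n => ArithmeticFunction.moebius n) twistedMoebius,
    sum_divisorsAntidiagonal_eq_sum_div, sum_divisorsAntidiagonal_eq_sum_div, eq_sub_iff_add_eq]
  have key : ∀ (G : ℕ → ℤ) (N : ℕ), ∑ n ∈ Finset.Icc 1 N, (ArithmeticFunction.moebius n : ℤ) * G n +
      ∑ n ∈ Finset.Icc 1 (N / 2), oddMoebius n * G (2 * n) =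
      ∑ n ∈ Finset.Icc 1 N, oddMoebius n * G n := by
    intro G N
    induction N with
    | zero => simp
    | succ N ih =>
      rw [Finset.sum_Icc_succ_top (by lia), Finset.sum_Icc_succ_top (by lia), ← ih]
      rcases Nat.mod_two_eq_zero_or_one N with h0 | h0
      · rw [show (N + 1) / 2 = N / 2 by lia, oddMoebius, if_neg (by lia)]
        ring
      · have h1 : N + 1 = 2 * (N / 2 + 1) := by lia
        rw [show (N + 1) / 2 = N / 2 + 1 by lia, Finset.sum_Icc_succ_top (by lia)]
        nth_rewrite 1 [h1]
        rw [moebius_two_mul, ← h1, show oddMoebius (N + 1) = 0 from if_pos (by lia)]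
        ring
  rw [← key (fun n => ∑ m ∈ Finset.Icc 1 (N / n), twistedMoebius m) N]
  congr 1
  refine Finset.sum_congr rfl fun n _ => ?_
  rw [Nat.div_div_eq_div_mul]

theorem eq_sum_moebius_mul_twistedMoebius {a c : ℕ → ℝ}
    (ha : ∀ n, n ≠ 0 → a n = ((∑ d ∈ n.divisors, ZMod.χ₄ d : ℤ) : ℝ))
    (hac : ∀ n, n ≠ 0 → ∑ p ∈ n.divisorsAntidiagonal, a p.1 * c p.2 = if n = 1 then 1 else 0)
    {n : ℕ} (hn : n ≠ 0) :
    c n = ((∑ p ∈ n.divisorsAntidiagonal, ArithmeticFunction.moebius p.1 * twistedMoebius p.2 :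
      ℤ) : ℝ) := by
  let χ : ArithmeticFunction ℤ := ⟨fun n => ZMod.χ₄ n, by decide⟩
  let ν : ArithmeticFunction ℤ := ⟨twistedMoebius, by simp [twistedMoebius]⟩
  let C : ArithmeticFunction ℝ := ⟨fun n => if n = 0 then 0 else c n, if_pos rfl⟩
  have hχ : χ * ν = 1 := by
    ext n
    rw [mul_apply]
    have : ∀ p ∈ n.divisorsAntidiagonal, χ p.1 * ν p.2 =
        ZMod.χ₄ n * ((ζ : ArithmeticFunction ℤ) p.1 * ArithmeticFunction.moebius p.2) := by
      intro p hp
      have h1 := (Nat.mem_divisorsAntidiagonal.1 hp).1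
      have h2 := (Nat.ne_zero_of_mem_divisorsAntidiagonal hp).1
      change ZMod.χ₄ p.1 * (ArithmeticFunction.moebius p.2 * ZMod.χ₄ p.2) = _
      rw [natCoe_apply, zeta_apply, if_neg h2, ← h1, Nat.cast_mul, map_mul]
      push_cast
      ring
    rw [Finset.sum_congr rfl this, ← Finset.mul_sum, ← mul_apply, coe_zeta_mul_moebius, one_apply]
    split_ifs with h
    · subst h; simp
    · simp
  have hA : ((((ζ : ArithmeticFunction ℤ) * χ : ArithmeticFunction ℤ)) : ArithmeticFunction ℝ) *
      C = 1 := by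
    ext n
    by_cases hn : n = 0
    · subst hn; simp
    rw [mul_apply, one_apply, ← hac n hn]
    refine Finset.sum_congr rfl fun p hp => ?_
    have h2 := Nat.ne_zero_of_mem_divisorsAntidiagonal hp
    rw [intCoe_apply, coe_zeta_mul_apply, ha _ h2.1]
    congr 1
    exact if_neg h2.2
  have hB : (ζ : ArithmeticFunction ℤ) * χ * (ArithmeticFunction.moebius * ν) = 1 := by
    rw [mul_mul_mul_comm, coe_zeta_mul_moebius, hχ, one_mul]
  have hB' := congrArg (fun f : ArithmeticFunction ℤ => (f : ArithmeticFunction ℝ)) hB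
  simp only [intCoe_mul, intCoe_one] at hB' hA
  have hC : C = ((ArithmeticFunction.moebius * ν : ArithmeticFunction ℤ) :
      ArithmeticFunction ℝ) := by
    rw [intCoe_mul]
    exact left_inv_eq_right_inv (mul_comm C _ |>.trans hA) hB'
  have h := congrArg (fun f : ArithmeticFunction ℝ => f n) hC
  simp only [intCoe_apply, mul_apply] at h
  exact (if_neg hn).symm.trans h

end GaussianMoebius

namespace FormSystem

variable {ι : Type} [Fintype ι] {a c : ℕ → ℝ} {w : ℕ} (F : FormSystem ι a (-4) w)

include F

theorem form_eq_of_discr_eq_neg_four (i : ι) :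
    (F.form i).A = 1 ∧ (F.form i).B = 0 ∧ (F.form i).C = 1 := by
  have h := F.absDiscr_eq i
  have hB := (F.form i).B_le
  have hA := (F.form i).A_le
  have h0 := (F.form i).A_pos
  rw [ReducedForm.absDiscr] at h
  set A := (F.form i).A
  set B := (F.form i).B
  set C := (F.form i).C
  zify at hB hA h0
  have hB0 : (0 : ℤ) ≤ B := by positivity
  have hA1 : (A : ℤ) = 1 := by
    by_contra hne
    have h2 : (2 : ℤ) ≤ A := by lia
    have h3 : (A : ℤ) * A ≤ A * C := mul_le_mul_of_nonneg_left hA h0.le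
    have h4 : (B : ℤ) * B ≤ A * A := mul_self_le_mul_self hB0 hB
    nlinarith
  have hB2 : (B : ℤ) ≤ 1 := by lia
  have hBC : (B : ℤ) = 0 ∧ (C : ℤ) = 1 := by
    rw [hA1] at h
    interval_cases hb : (B : ℤ) <;> lia
  exact_mod_cast (⟨hA1, hBC⟩ : (A : ℤ) = 1 ∧ (B : ℤ) = 0 ∧ (C : ℤ) = 1)

theorem card_eq_one_of_discr_eq_neg_four : Fintype.card ι = 1 :=
  Fintype.card_eq_one_iff.2
    ⟨F.one, fun i => F.eq_one i (F.form_eq_of_discr_eq_neg_four i).1⟩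

theorem gaussCount_eq_of_discr_eq_neg_four {n : ℕ} (hn : n ≠ 0) :
    (gaussCount n : ℝ) = w * a n := by
  rw [← F.sum_rep n hn]
  have : Unique ι := ⟨⟨F.one⟩, fun i => F.eq_one i (F.form_eq_of_discr_eq_neg_four i).1⟩
  rw [Fintype.sum_unique]
  obtain ⟨hA, hB, hC⟩ := F.form_eq_of_discr_eq_neg_four default
  congr 1
  rw [gaussCount, ReducedForm.rep, ← Nat.card_coe_set_eq]
  refine Nat.card_congr ⟨fun z => ⟨(z.1.re, z.1.im), ?_⟩, fun v => ⟨⟨v.1.1, v.1.2⟩, ?_⟩,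
    fun _ => rfl, fun _ => rfl⟩
  · have h := z.2
    rw [Set.mem_ofPred_eq, Zsqrtd.norm_def] at h
    rw [← Int.natCast_inj, ReducedForm.coe_val, hA, hB, hC]
    push_cast
    linear_combination h
  · have h := congrArg (Nat.cast (R := ℤ)) v.2
    rw [ReducedForm.coe_val, hA, hB, hC] at h
    rw [Set.mem_ofPred_eq, Zsqrtd.norm_def, ← h]
    push_cast
    ring

theorem w_eq_four (ha : a 1 = 1) : w = 4 := by
  have h := F.gaussCount_eq_of_discr_eq_neg_four one_ne_zero
  rw [gaussCount_one, ha, mul_one] at h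
  exact_mod_cast h.symm

theorem sum_eq_oddMertens_sub (ha : a 1 = 1)
    (hac : ∀ n, n ≠ 0 → ∑ p ∈ n.divisorsAntidiagonal, a p.1 * c p.2 = if n = 1 then 1 else 0)
    (N : ℕ) : ∑ n ∈ Finset.Icc 1 N, c n = ((oddMertens N - oddMertens (N / 2) : ℤ) : ℝ) := by
  have hw := F.w_eq_four ha
  rw [← sum_moebius_mul_twistedMoebius, Int.cast_sum]
  refine Finset.sum_congr rfl fun n hn => eq_sum_moebius_mul_twistedMoebius (fun n hn => ?_) hac
    (Nat.pos_iff_ne_zero.1 (Finset.mem_Icc.1 hn).1)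
  have h := F.gaussCount_eq_of_discr_eq_neg_four hn
  have h' := congrArg (Int.cast (R := ℝ)) (gaussCount_eq n hn)
  rw [Int.cast_mul, Int.cast_natCast, h, hw] at h'
  exact mul_left_cancel₀ (by norm_num) h'

end FormSystem

/-! The definitions of this namespace compute `oddMertens` by the recursion over the hyperbola,
modulo `2 ^ 54 - 1` and with two sums (over the residue classes `1` and `3` modulo `4`) packed in
base `2 ^ 27`. They are written with the `Nat` operations and recursors the kernel evaluates
directly. -/
namespace GaussianMertens

/-- The part of an odd `n < 2 ^ 16` built from the primes below `256`, without multiplicity. -/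
def smoothPart (n : ℕ) : ℕ :=
  Nat.mul (Nat.mul (Nat.gcd n 15) (Nat.gcd n 1001)) (Nat.mul (Nat.gcd n 435656388001)
    (Nat.gcd n 4912291013238638017062389731791584291410159591853190162192019099864799926800582498341))

/-- The number of prime factors of a squarefree odd `n < 2 ^ 16`. -/
def omegaOdd (n : ℕ) : ℕ :=
  Nat.add (Nat.add (Nat.div (Nat.add (Nat.gcd n 15) 7) 10)
      (Nat.div (Nat.add (Nat.log2 (Nat.gcd n 1001)) 1) 3))
    (Nat.add (Nat.add (Nat.div (Nat.log2 (Nat.gcd n 435656388001)) 4)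
        (Nat.div (Nat.add (Nat.log2 (Nat.gcd n
          4912291013238638017062389731791584291410159591853190162192019099864799926800582498341)) 1) 6))
      (Nat.div (Nat.log2 (Nat.div n (smoothPart n))) 8))

/-- The indicator of squarefreeness for an odd `n < 2 ^ 16`. -/
def sqfreeOdd (n : ℕ) : ℕ := Nat.div 1 (Nat.gcd (Nat.div n (smoothPart n)) (smoothPart n))

/-- The value `μ(2 * i + 1) + 1`. -/
def moebDigit (i : ℕ) : ℕ :=
  Nat.sub (Nat.add 1 (sqfreeOdd (Nat.add (Nat.mul 2 i) 1)))
    (Nat.mul (Nat.mul 2 (sqfreeOdd (Nat.add (Nat.mul 2 i) 1)))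
      (Nat.mod (omegaOdd (Nat.add (Nat.mul 2 i) 1)) 2))

/-- The values of `f` on `[lo, lo + 2 ^ k)` as the digits of a number in base `2 ^ b`, the last
value being the lowest digit. -/
def pack (b : ℕ) (f : ℕ → ℕ) (k : ℕ) : ℕ → ℕ :=
  Nat.rec (fun lo => f lo) (fun k ih lo =>
    Nat.add (Nat.shiftLeft (ih lo) (Nat.mul b (Nat.pow 2 k))) (ih (Nat.add lo (Nat.pow 2 k)))) k

/-- The sum of `f` over `[lo, lo + n)`, split `k` times into halves. -/
def binSum (f : ℕ → ℕ) (k : ℕ) : ℕ → ℕ → ℕ :=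
  Nat.rec (fun lo n => Nat.rec 0 (fun i ih => Nat.add ih (f (Nat.add lo i))) n)
    (fun _ ih lo n => Nat.add (ih lo (Nat.div n 2))
      (ih (Nat.add lo (Nat.div n 2)) (Nat.sub n (Nat.div n 2)))) k

/-- The table of `moebDigit` in base `2 ^ 27`. -/
def fullPack : ℕ := pack 27 moebDigit 15 0

/-- The table of `moebDigit` in base `4`. -/
def smallPack : ℕ := pack 2 moebDigit 12 0

/-- The value `μ(2 * i + 1) + 1`, from the table. -/
def smallMoeb (i : ℕ) : ℕ :=
  Nat.mod (Nat.shiftRight smallPack (Nat.mul 2 (Nat.sub 4095 i))) 4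

/-- Exchange of the two packed sums, for odd `i` and modulo `2 ^ 54 - 1`. -/
def twist (i t : ℕ) : ℕ := Nat.shiftLeft t (Nat.mul 27 (Nat.mod i 2))

/-- The sum of the digits of `V` up to index `i`, alternately into the two packed sums; the table is
halved `k` times before it is reduced modulo `2 ^ 54 - 1`. -/
def splitLook (k : ℕ) : ℕ → ℕ → ℕ :=
  Nat.rec
    (fun V i => Nat.mod (Nat.shiftRight V (Nat.mul 27 (Nat.sub 2047 i))) 18014398509481983)
    (fun k ih V i => Bool.rec (ih (Nat.shiftRight V (Nat.mul 55296 (Nat.pow 2 k))) i)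
      (ih (Nat.add (Nat.shiftLeft
            (Nat.mod (Nat.shiftRight V (Nat.mul 55296 (Nat.pow 2 k))) 18014398509481983)
            (Nat.mul 55296 (Nat.pow 2 k)))
          (Nat.mod V (Nat.pow 2 (Nat.mul 55296 (Nat.pow 2 k)))))
        (Nat.sub i (Nat.mul 2048 (Nat.pow 2 k))))
      (Nat.ble (Nat.mul 2048 (Nat.pow 2 k)) i)) k

/-- The packed sums of `μ + 1` over the odd numbers up to `2 * i + 1`. -/
def smallQi (i : ℕ) : ℕ := Nat.mod (twist i (splitLook 4 fullPack i)) 18014398509481983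

/-- The packed sums of `μ + 1` over the odd numbers up to `w`, for small `w`. -/
def smallQ (w : ℕ) : ℕ := smallQi (Nat.div (Nat.sub w 1) 2)

/-- The packed numbers of integers up to `w` that are `1`, respectively `3`, modulo `4`. -/
def cntX (w : ℕ) : ℕ :=
  Nat.add (Nat.div (Nat.add w 3) 4) (Nat.mul 134217728 (Nat.div (Nat.add w 1) 4))

/-- The packed sums up to `x / b`, from the memo `m` of the values `x / A, x / (A - 2), …` or
from the table. -/
def lookup (x A m b : ℕ) : ℕ :=
  Bool.rec (smallQ (Nat.div x b))
    (Nat.mod (Nat.shiftRight m (Nat.mul 54 (Nat.div (Nat.sub A b) 2))) 18014398509481984)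
    (Nat.ble b A)

/-- A step of Newton's iteration for the square root. -/
def isqrtStep (v s : ℕ) : ℕ := Nat.div (Nat.add s (Nat.div v s)) 2

/-- The square root, up to rounding. -/
def isqrtCand (v : ℕ) : ℕ :=
  isqrtStep v (isqrtStep v (isqrtStep v (isqrtStep v
    (Nat.pow 2 (Nat.div (Nat.add 1 (Nat.log2 v)) 2)))))

/-- The square root, after a check of the candidate `s`. -/
def isqrtAux (v s : ℕ) : ℕ :=
  Bool.rec (Nat.sqrt v) s (Bool.and (Nat.ble (Nat.mul s s) v)
    (Nat.ble (Nat.add v 1) (Nat.mul (Nat.add s 1) (Nat.add s 1))))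

/-- The integral part of the square root. -/
def isqrt (v : ℕ) : ℕ :=
  isqrtAux v (Nat.sub (isqrtCand v)
    (Bool.rec 1 0 (Nat.ble (Nat.mul (isqrtCand v) (isqrtCand v)) v)))

/-- The term of `2 * i + 1` in the recursion for the packed sums up to `x / a`. -/
def leaf (x A m a i : ℕ) : ℕ :=
  twist i (Nat.add (lookup x A m (Nat.mul a (Nat.add (Nat.mul 2 i) 1)))
    (Nat.mul (Nat.add (smallMoeb i) 18014398509481981)
      (cntX (Nat.div x (Nat.mul a (Nat.add (Nat.mul 2 i) 1))))))

/-- The packed sums up to `x / a`, where `s` is the square root of `x / a`. -/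
def entryS (x A m a s : ℕ) : ℕ :=
  Nat.mod (Nat.add (Nat.add 1 (Nat.mul 18014398509481982
      (binSum (leaf x A m a) (Nat.log2 (Nat.div (Nat.sub s 1) 2)) 1 (Nat.div (Nat.sub s 1) 2))))
    (Nat.mul (cntX s) (Nat.add (smallQ s) (Nat.mul 18014398509481982 (cntX s)))))
    18014398509481983

/-- The packed sums up to `x / a`. -/
def entry (x A m a : ℕ) : ℕ := entryS x A m a (isqrt (Nat.div x a))

/-- The memo of `n` more entries. The two branches agree: the comparison forces the evaluation
of `m`. -/
def memo (x A : ℕ) (n : ℕ) : ℕ → ℕ → ℕ :=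
  Nat.rec (fun _ m => m) (fun _ ih k m =>
    Bool.rec
      (ih (Nat.add k 1)
        (Nat.add m (Nat.shiftLeft (entry x A m (Nat.sub A (Nat.mul 2 k))) (Nat.mul 54 k))))
      (ih (Nat.add k 1)
        (Nat.add m (Nat.shiftLeft (entry x A m (Nat.sub A (Nat.mul 2 k))) (Nat.mul 54 k))))
      (Nat.beq m (Nat.mul 0 k))) n

/-- The sum of `μ` over the integers up to `w` that are `1` modulo `4`, from the packed sums. -/
def partOne (q w : ℕ) : ℕ :=
  Nat.add (Nat.mod q 134217728) (Nat.mul 18014398509481982 (Nat.div (Nat.add w 3) 4))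

/-- The sum of `μ` over the integers up to `w` that are `3` modulo `4`, from the packed sums. -/
def partThree (q w : ℕ) : ℕ :=
  Nat.add (Nat.div q 134217728) (Nat.mul 18014398509481982 (Nat.div (Nat.add w 1) 4))

/-- The contribution of the packed sums `q` up to `w` at index `i`. -/
def signedPart (i q w : ℕ) : ℕ :=
  Nat.rec (Nat.mul 2 (partOne q w)) (fun _ _ => Nat.mul 36028797018963964 (partThree q w))
    (Nat.mod i 2)

/-- The term of `2 * i + 1` in the hyperbola method for `oddMertens x`. -/
def oddLeaf (x A m i : ℕ) : ℕ :=
  Nat.mul (Nat.add (smallMoeb i) 18014398509481982)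
    (signedPart i (lookup x A m (Nat.add (Nat.mul 2 i) 1))
      (Nat.div x (Nat.add (Nat.mul 2 i) 1)))

/-- The value `oddMertens x`, where `s` is the square root of `x`. -/
def oddSumS (x A m s : ℕ) : ℕ :=
  Nat.add (binSum (oddLeaf x A m) (Nat.log2 (Nat.div (Nat.add s 1) 2)) 0 (Nat.div (Nat.add s 1) 2))
    (Nat.mul 18014398509481982
      (Nat.mul (Nat.add (partOne (smallQ s) s) (partThree (smallQ s) s))
        (Nat.add (partOne (smallQ s) s) (Nat.mul 18014398509481982 (partThree (smallQ s) s)))))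

/-- The value `oddMertens x` modulo `2 ^ 54 - 1`. -/
def oddSum (x A n : ℕ) : ℕ := oddSumS x A (memo x A n 0 0) (isqrt x)

theorem le_of_prime_dvd_list_prod {l : List ℕ} {b : ℕ} (hl : ∀ q ∈ l, 0 < q ∧ q ≤ b) {p : ℕ}
    (hp : p.Prime) (h : p ∣ l.prod) : p ≤ b := by
  obtain ⟨q, hq, hpq⟩ := (Nat.Prime.prime hp).dvd_prod_iff.1 h
  exact (Nat.le_of_dvd (hl q hq).1 hpq).trans (hl q hq).2

theorem exists_moebius_eq_pow {P lo hi : ℕ} (hP : ∀ p, p.Prime → p ∣ P → lo ≤ p ∧ p ≤ hi)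
    (hsq : ∀ p, lo ≤ p → p ≤ hi → ¬ p * p ∣ P) {g : ℕ} (hg : g ∣ P) :
    ∃ k, ArithmeticFunction.moebius g = (-1) ^ k ∧ lo ^ k ≤ g ∧ g ≤ hi ^ k := by
  have hsf : Squarefree g := by
    refine Nat.squarefree_iff_prime_squarefree.2 fun p hp h => ?_
    have h' := h.trans hg
    have hb := hP p hp ((dvd_mul_right p p).trans h')
    exact hsq p hb.1 hb.2 h'
  have hprod := Nat.prod_primeFactors_of_squarefree hsf
  refine ⟨g.primeFactors.card, ?_, ?_, ?_⟩
  · rw [ArithmeticFunction.moebius_apply_of_squarefree hsf,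
      ← (ArithmeticFunction.cardDistinctFactors_eq_cardFactors_iff_squarefree hsf.ne_zero).2 hsf]
    rfl
  · conv_rhs => rw [← hprod]
    exact Finset.pow_card_le_prod _ _ _ fun p hp =>
      (hP p (Nat.prime_of_mem_primeFactors hp) ((Nat.dvd_of_mem_primeFactors hp).trans hg)).1
  · conv_lhs => rw [← hprod]
    exact Finset.prod_le_pow_card _ _ _ fun p hp =>
      (hP p (Nat.prime_of_mem_primeFactors hp) ((Nat.dvd_of_mem_primeFactors hp).trans hg)).2

theorem bounds_of_prime_dvd {P lo hi : ℕ} {l : List ℕ} (hl : l.prod = P)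
    (hb : ∀ q ∈ l, 0 < q ∧ q ≤ hi) (hlo : ∀ p < lo, 2 ≤ p → Nat.gcd p P = 1) (p : ℕ)
    (hp : p.Prime) (h : p ∣ P) : lo ≤ p ∧ p ≤ hi := by
  refine ⟨?_, le_of_prime_dvd_list_prod hb hp (hl ▸ h)⟩
  by_contra! hlt
  have h1 := hlo p hlt hp.two_le
  rw [Nat.gcd_eq_left h] at h1
  exact hp.one_lt.ne' h1

theorem moebius_of_dvd_15 {g : ℕ} (hg : g ∣ 15) :
    ArithmeticFunction.moebius g = (-1) ^ ((g + 7) / 10) := by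
  obtain ⟨k, hk, h1, h2⟩ := exists_moebius_eq_pow (lo := 3) (hi := 5)
    (bounds_of_prime_dvd (l := [3, 5]) (by decide) (by decide) (by decide)) (by decide +kernel) hg
  have hle := Nat.le_of_dvd (by norm_num) hg
  have hk3 : k < 3 := by
    by_contra! h
    have := Nat.pow_le_pow_right (show 0 < 3 by norm_num) h
    lia
  rw [hk]
  congr 1
  obtain ⟨c, hc⟩ := hg
  interval_cases k
  · lia
  · lia
  · have : c < 2 := by
      by_contra! h
      nlinarith
    have : c = 1 := by
      interval_cases c <;> lia
    subst this
    lia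

theorem moebius_of_dvd_1001 {g : ℕ} (hg : g ∣ 1001) :
    ArithmeticFunction.moebius g = (-1) ^ ((Nat.log2 g + 1) / 3) := by
  obtain ⟨k, hk, h1, h2⟩ := exists_moebius_eq_pow (lo := 7) (hi := 13)
    (bounds_of_prime_dvd (l := [7, 11, 13]) (by decide) (by decide) (by decide +kernel))
    (by decide +kernel) hg
  have hle := Nat.le_of_dvd (by norm_num) hg
  have hk3 : k < 4 := by
    by_contra! h
    have := Nat.pow_le_pow_right (show 0 < 7 by norm_num) h
    lia
  have h0 : g ≠ 0 := fun h => by simp [h] at hg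
  have hL := fun m => Nat.le_log2 (k := m) h0
  have hU := fun m => Nat.log2_lt (k := m) h0
  rw [hk]
  congr 1
  interval_cases k
  · have := (hU 1).2 (by lia)
    lia
  · have := (hU 4).2 (by lia)
    have := (hL 2).2 (by lia)
    lia
  · have := (hU 8).2 (by lia)
    have := (hL 5).2 (by lia)
    lia
  · have := (hU 10).2 (by lia)
    have := (hL 8).2 (by lia)
    lia

theorem moebius_of_dvd_435656388001 {g : ℕ} (hg : g ∣ 435656388001) (hle : g < 65536) :
    ArithmeticFunction.moebius g = (-1) ^ (Nat.log2 g / 4) := by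
  obtain ⟨k, hk, h1, h2⟩ := exists_moebius_eq_pow (lo := 17) (hi := 43)
    (bounds_of_prime_dvd (l := [17, 19, 23, 29, 31, 37, 41, 43]) (by norm_num) (by decide)
      (by decide +kernel)) (by decide +kernel) hg
  have hk3 : k < 4 := by
    by_contra! h
    have := Nat.pow_le_pow_right (show 0 < 17 by norm_num) h
    lia
  have h0 : g ≠ 0 := fun h => by simp [h] at hg
  have hL := fun m => Nat.le_log2 (k := m) h0
  have hU := fun m => Nat.log2_lt (k := m) h0
  rw [hk]
  congr 1
  interval_cases k
  · have := (hU 1).2 (by lia)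
    lia
  · have := (hU 6).2 (by lia)
    have := (hL 4).2 (by lia)
    lia
  · have := (hU 11).2 (by lia)
    have := (hL 8).2 (by lia)
    lia
  · have := (hU 16).2 (by lia)
    have := (hL 12).2 (by lia)
    lia

theorem moebius_of_dvd_prod_le_251 {g : ℕ}
    (hg : g ∣ 4912291013238638017062389731791584291410159591853190162192019099864799926800582498341)
    (hle : g < 65536) :
    ArithmeticFunction.moebius g = (-1) ^ ((Nat.log2 g + 1) / 6) := by
  obtain ⟨k, hk, h1, h2⟩ := exists_moebius_eq_pow (lo := 47) (hi := 251)
    (bounds_of_prime_dvd (l := [47, 53, 59, 61, 67, 71, 73, 79, 83, 89, 97, 101, 103, 107, 109,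
      113, 127, 131, 137, 139, 149, 151, 157, 163, 167, 173, 179, 181, 191, 193, 197, 199, 211,
      223, 227, 229, 233, 239, 241, 251]) (by norm_num) (by decide)
      (by decide +kernel)) (by decide +kernel) hg
  have hk3 : k < 3 := by
    by_contra! h
    have := Nat.pow_le_pow_right (show 0 < 47 by norm_num) h
    lia
  have h0 : g ≠ 0 := fun h => by simp [h] at hg
  have hL := fun m => Nat.le_log2 (k := m) h0
  have hU := fun m => Nat.log2_lt (k := m) h0
  rw [hk]
  congr 1
  interval_cases k
  · have := (hU 1).2 (by lia)
    lia
  · have := (hU 8).2 (by lia)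
    have := (hL 5).2 (by lia)
    lia
  · have := (hU 16).2 (by lia)
    have := (hL 11).2 (by lia)
    lia

theorem moebius_of_large_primeFactors {L : ℕ} (h0 : L ≠ 0) (hL : L < 65536)
    (h : ∀ p, p.Prime → p ∣ L → 257 ≤ p) :
    ArithmeticFunction.moebius L = (-1) ^ (Nat.log2 L / 8) := by
  by_cases h1 : L = 1
  · subst h1
    rw [ArithmeticFunction.moebius_apply_one]
    rfl
  have hm := h _ (Nat.minFac_prime h1) (Nat.minFac_dvd L)
  have hp : L.Prime := by
    by_contra hp
    have := Nat.minFac_sq_le_self (Nat.pos_of_ne_zero h0) hp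
    nlinarith
  have hge := h L hp dvd_rfl
  have := (Nat.le_log2 (k := 8) h0).2 (by lia)
  have := (Nat.log2_lt (k := 16) h0).2 (by lia)
  rw [ArithmeticFunction.moebius_apply_prime hp, show Nat.log2 L / 8 = 1 by lia, pow_one]

theorem exists_prime_dvd_of_lt_257 : ∀ p < 257, 2 ≤ p → Nat.gcd p (2 * (15 * 1001 * (435656388001 *
    4912291013238638017062389731791584291410159591853190162192019099864799926800582498341))) ≠ 1 := by
  decide +kernel

theorem omegaOdd_eq (n : ℕ) : omegaOdd n = (Nat.gcd n 15 + 7) / 10 + (Nat.log2 (Nat.gcd n 1001) +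
    1) / 3 + (Nat.log2 (Nat.gcd n 435656388001) / 4 + (Nat.log2 (Nat.gcd n
    4912291013238638017062389731791584291410159591853190162192019099864799926800582498341) + 1) / 6 +
    Nat.log2 (n / smoothPart n) / 8) := rfl

theorem sqfreeOdd_eq (n : ℕ) : sqfreeOdd n = 1 / Nat.gcd (n / smoothPart n) (smoothPart n) := rfl

theorem moebDigit_eq {i : ℕ} (hi : i < 32768) :
    (moebDigit i : ℤ) = ArithmeticFunction.moebius (2 * i + 1) + 1 := by
  have hodd : ¬ 2 ∣ 2 * i + 1 := by lia
  have hlt : 2 * i + 1 < 65536 := by lia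
  have h0 : 2 * i + 1 ≠ 0 := by lia
  rw [moebDigit]
  change ((1 + sqfreeOdd (2 * i + 1) - 2 * sqfreeOdd (2 * i + 1) * (omegaOdd (2 * i + 1) % 2) : ℕ)
    : ℤ) = _
  generalize 2 * i + 1 = n at *
  rw [omegaOdd_eq, sqfreeOdd_eq]
  set S := smoothPart n with hS
  have hS' : S = Nat.gcd n 15 * Nat.gcd n 1001 * (Nat.gcd n 435656388001 * Nat.gcd n
    4912291013238638017062389731791584291410159591853190162192019099864799926800582498341) := rfl
  have d1 := Nat.gcd_dvd_left n 15
  have e1 := Nat.gcd_dvd_right n 15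
  have d2 := Nat.gcd_dvd_left n 1001
  have e2 := Nat.gcd_dvd_right n 1001
  have d3 := Nat.gcd_dvd_left n 435656388001
  have e3 := Nat.gcd_dvd_right n 435656388001
  have d4 := Nat.gcd_dvd_left n
    4912291013238638017062389731791584291410159591853190162192019099864799926800582498341
  have e4 := Nat.gcd_dvd_right n
    4912291013238638017062389731791584291410159591853190162192019099864799926800582498341
  have m1 := moebius_of_dvd_15 e1
  have m2 := moebius_of_dvd_1001 e2
  have m3 := moebius_of_dvd_435656388001 e3 ((Nat.le_of_dvd (by lia) d3).trans_lt hlt)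
  have m4 := moebius_of_dvd_prod_le_251 e4 ((Nat.le_of_dvd (by lia) d4).trans_lt hlt)
  have c12 : Nat.Coprime (Nat.gcd n 15) (Nat.gcd n 1001) :=
    Nat.Coprime.of_dvd e1 e2 (by norm_num)
  have c34 : Nat.Coprime (Nat.gcd n 435656388001) (Nat.gcd n
      4912291013238638017062389731791584291410159591853190162192019099864799926800582498341) :=
    Nat.Coprime.of_dvd e3 e4 (by norm_num)
  have cc : Nat.Coprime (Nat.gcd n 15 * Nat.gcd n 1001) (Nat.gcd n 435656388001 * Nat.gcd n
      4912291013238638017062389731791584291410159591853190162192019099864799926800582498341) :=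
    Nat.Coprime.of_dvd (mul_dvd_mul e1 e2) (mul_dvd_mul e3 e4) (by norm_num)
  have hprime : ∀ p, p.Prime → p ∣ n → p < 257 → p ∣ S := by
    intro p hp hpn hlt
    have h1 := exists_prime_dvd_of_lt_257 p hlt hp.two_le
    rw [Ne, ← Nat.coprime_iff_gcd_eq_one, hp.coprime_iff_not_dvd, not_not, hp.dvd_mul, hp.dvd_mul,
      hp.dvd_mul, hp.dvd_mul] at h1
    rw [hS']
    rcases h1 with h1 | (h1 | h1) | (h1 | h1)
    · exact absurd (((Nat.prime_dvd_prime_iff_eq hp Nat.prime_two).1 h1) ▸ hpn) hodd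
    · exact ((Nat.dvd_gcd hpn h1).mul_right _).mul_right _
    · exact ((Nat.dvd_gcd hpn h1).mul_left _).mul_right _
    · exact ((Nat.dvd_gcd hpn h1).mul_right _).mul_left _
    · exact ((Nat.dvd_gcd hpn h1).mul_left _).mul_left _
  have hSn : S ∣ n := by
    rw [hS']
    exact cc.mul_dvd_of_dvd_of_dvd (c12.mul_dvd_of_dvd_of_dvd d1 d2)
      (c34.mul_dvd_of_dvd_of_dvd d3 d4)
  clear_value S
  have hμ := @ArithmeticFunction.isMultiplicative_moebius.map_mul_of_coprime
  have hmS := (congrArg ArithmeticFunction.moebius hS').trans ((hμ cc).trans (congrArg₂ (· * ·)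
    ((hμ c12).trans (congrArg₂ (· * ·) m1 m2)) ((hμ c34).trans (congrArg₂ (· * ·) m3 m4))))
  obtain ⟨L, hL⟩ := hSn
  have hS0 : 0 < S := Nat.pos_of_ne_zero fun h => h0 (by rw [hL, h, zero_mul])
  have hL0 : L ≠ 0 := fun h => h0 (by rw [hL, h, mul_zero])
  rw [show n / S = L by rw [hL, Nat.mul_div_cancel_left _ hS0]]
  by_cases hc : Nat.gcd L S = 1
  · have hmL : ArithmeticFunction.moebius L = _ :=
      moebius_of_large_primeFactors hL0 ((Nat.le_of_dvd (by lia) ⟨S, by lia⟩).trans_lt hlt)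
        fun p hp hpL => by
          by_contra! h
          have h1 := hprime p hp (hL ▸ hpL.mul_left S) h
          have h2 := Nat.dvd_gcd hpL h1
          rw [hc] at h2
          exact hp.one_lt.ne' (Nat.dvd_one.1 h2)
    have hmn := (congrArg ArithmeticFunction.moebius hL).trans ((hμ (Nat.Coprime.symm hc)).trans
      (congrArg₂ (· * ·) hmS hmL))
    simp only [← pow_add] at hmn
    have key : ∀ k : ℕ, ((1 + 1 / 1 - 2 * (1 / 1) * (k % 2) : ℕ) : ℤ) = (-1) ^ k + 1 := by
      intro k
      rcases Nat.even_or_odd k with hk | hk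
      · rw [hk.neg_one_pow, Nat.even_iff.1 hk]
        rfl
      · rw [hk.neg_one_pow, Nat.odd_iff.1 hk]
        rfl
    rw [hmn, hc, key, add_assoc (_ + _) (_ + _) (_ / 8)]
  · obtain ⟨p, hp, hpd⟩ := Nat.exists_prime_and_dvd hc
    have hns : ¬ Squarefree n := fun h => by
      refine hp.one_lt.ne' (Nat.isUnit_iff.1 (h p ?_))
      rw [hL]
      exact mul_dvd_mul (hpd.trans (Nat.gcd_dvd_right _ _)) (hpd.trans (Nat.gcd_dvd_left _ _))
    rw [ArithmeticFunction.moebius_eq_zero_of_not_squarefree hns]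
    have h1 : Nat.gcd L S ≠ 0 := fun h => hS0.ne' (Nat.eq_zero_of_gcd_eq_zero_right h)
    rw [Nat.div_eq_of_lt (show 1 < Nat.gcd L S by lia)]
    simp

/-- The value of the digits `f 0, …, f (n - 1)`, most significant first, in base `2 ^ b`. -/
def horner (b : ℕ) (f : ℕ → ℕ) : ℕ → ℕ
  | 0 => 0
  | n + 1 => horner b f n * 2 ^ b + f n

theorem horner_add (b : ℕ) (f : ℕ → ℕ) (m n : ℕ) :
    horner b f (m + n) = horner b f m * 2 ^ (b * n) + horner b (fun i => f (m + i)) n := by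
  induction n with
  | zero => simp [horner]
  | succ n ih =>
    rw [← add_assoc, horner, horner, ih]
    ring

theorem horner_lt {b : ℕ} {f : ℕ → ℕ} (hf : ∀ i, f i < 2 ^ b) (n : ℕ) :
    horner b f n < 2 ^ (b * n) := by
  induction n with
  | zero => simp [horner]
  | succ n ih =>
    rw [horner, Nat.mul_succ, pow_add]
    have := hf n
    have h2 : (horner b f n + 1) * 2 ^ b ≤ 2 ^ (b * n) * 2 ^ b := Nat.mul_le_mul_right _ ih
    lia

theorem horner_div {b : ℕ} {f : ℕ → ℕ} (hf : ∀ i, f i < 2 ^ b) (m n : ℕ) :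
    horner b f (m + n) / 2 ^ (b * n) = horner b f m := by
  rw [horner_add, add_comm, Nat.add_mul_div_right _ _ (by positivity),
    Nat.div_eq_of_lt (horner_lt (fun i => hf (m + i)) n), zero_add]

theorem pack_eq_horner (b : ℕ) (f : ℕ → ℕ) (k lo : ℕ) :
    pack b f k lo = horner b (fun i => f (lo + i)) (2 ^ k) := by
  induction k generalizing lo with
  | zero => simp [horner, pack]
  | succ k ih =>
    change (pack b f k lo) <<< (b * 2 ^ k) + pack b f k (lo + 2 ^ k) = _
    rw [ih, ih, Nat.shiftLeft_eq, pow_succ 2 k, mul_two, horner_add]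
    simp only [add_assoc]

theorem cast_horner {R : Type*} [CommRing R] {b : ℕ} {e : R} (he : ((2 ^ b : ℕ) : R) = e)
    (hee : e * e = 1) (f : ℕ → ℕ) (n : ℕ) :
    e ^ (n + 1) * (horner b f n : R) = ∑ i ∈ Finset.range n, (f i : R) * e ^ i := by
  induction n with
  | zero => simp [horner]
  | succ n ih =>
    rw [Finset.sum_range_succ, ← ih, horner, Nat.cast_add, Nat.cast_mul, he]
    linear_combination (e ^ (n + 1) * (horner b f n : R) + e ^ n * f n) * hee

theorem moebDigit_le_two (i : ℕ) : moebDigit i ≤ 2 := by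
  have h : sqfreeOdd (2 * i + 1) ≤ 1 := Nat.div_le_self 1 _
  change 1 + sqfreeOdd (2 * i + 1) - 2 * sqfreeOdd (2 * i + 1) * (omegaOdd (2 * i + 1) % 2) ≤ 2
  lia

theorem smallMoeb_eq {i : ℕ} (hi : i < 4096) :
    (smallMoeb i : ℤ) = ArithmeticFunction.moebius (2 * i + 1) + 1 := by
  have hd : ∀ i, moebDigit i < 2 ^ 2 := fun i => (moebDigit_le_two i).trans_lt (by norm_num)
  have h : smallMoeb i = smallPack >>> (2 * (4095 - i)) % 4 := rfl
  have hp : smallPack = horner 2 moebDigit (i + 1 + (4095 - i)) := by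
    rw [smallPack, pack_eq_horner, show i + 1 + (4095 - i) = 2 ^ 12 by lia]
    simp only [zero_add]
  rw [← moebDigit_eq (by lia), h, hp, Nat.shiftRight_eq_div_pow, horner_div hd, horner]
  have := hd i
  lia

theorem splitLook_eq (k V i : ℕ) (hi : i < 2048 * 2 ^ k) :
    splitLook k V i = V / 2 ^ (27 * (2048 * 2 ^ k - 1 - i)) % 18014398509481983 := by
  induction k generalizing V i with
  | zero =>
    change V >>> (27 * (2047 - i)) % 18014398509481983 = _
    rw [Nat.shiftRight_eq_div_pow]
    rfl
  | succ k ih =>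
    change @Bool.rec (fun _ => ℕ) (splitLook k (V >>> (55296 * 2 ^ k)) i) (splitLook k
      ((V >>> (55296 * 2 ^ k) % 18014398509481983) <<< (55296 * 2 ^ k) + V % 2 ^ (55296 * 2 ^ k))
      (i - 2048 * 2 ^ k)) (Nat.ble (2048 * 2 ^ k) i) = _
    rw [show 55296 * 2 ^ k = 27 * (2048 * 2 ^ k) by lia, Nat.shiftRight_eq_div_pow,
      Nat.shiftLeft_eq]
    rw [show 2048 * 2 ^ (k + 1) = 2048 * 2 ^ k * 2 by ring] at hi ⊢
    generalize 2048 * 2 ^ k = P at *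
    by_cases h : P ≤ i
    · rw [Nat.ble_eq_true_of_le h]
      change splitLook k _ _ = _
      rw [ih _ _ (by lia)]
      rw [show P * 2 - 1 - i = P - 1 - (i - P) by lia]
      have hs : 2 ^ (27 * P) =
          2 ^ (27 * P - 27 * (P - 1 - (i - P))) * 2 ^ (27 * (P - 1 - (i - P))) := by
        rw [← pow_add]
        congr 1
        lia
      have hV : V = V / 2 ^ (27 * P) % 18014398509481983 * 2 ^ (27 * P) + V % 2 ^ (27 * P) +
          18014398509481983 * (V / 2 ^ (27 * P) / 18014398509481983 *
            2 ^ (27 * P - 27 * (P - 1 - (i - P)))) * 2 ^ (27 * (P - 1 - (i - P))) := by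
        have h1 := Nat.div_add_mod V (2 ^ (27 * P))
        have h2 := Nat.div_add_mod (V / 2 ^ (27 * P)) 18014398509481983
        rw [mul_assoc, mul_assoc (_ / _ / _), ← hs]
        generalize V / 2 ^ (27 * P) / 18014398509481983 = q at *
        generalize V / 2 ^ (27 * P) % 18014398509481983 = r at *
        generalize V / 2 ^ (27 * P) = A at *
        generalize V % 2 ^ (27 * P) = c at *
        rw [← h1, ← h2]
        ring
      conv_rhs => rw [hV]
      rw [Nat.add_mul_div_right _ _ (by positivity), Nat.add_mul_mod_self_left]
    · rw [Bool.eq_false_iff.2 (fun h' => h (Nat.le_of_ble_eq_true h'))]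
      change splitLook k _ _ = _
      rw [ih _ _ (by lia), Nat.div_div_eq_div_mul, ← pow_add]
      congr 3
      lia

/-- The ring in which the computation takes place; `2 ^ 27` is an involution in it. -/
abbrev ComputationRing : Type := ZMod 18014398509481983

/-- The class of `2 ^ 27`. -/
def invol : ComputationRing := ((2 ^ 27 : ℕ) : ComputationRing)

theorem invol_mul_invol : invol * invol = 1 := by
  rw [invol, ← Nat.cast_mul, ← Nat.cast_one, ZMod.natCast_eq_natCast_iff]
  rfl

theorem invol_pow_mod_two (i : ℕ) : invol ^ (i % 2) = invol ^ i := by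
  conv_rhs => rw [← Nat.div_add_mod i 2, pow_add, pow_mul, sq, invol_mul_invol, one_pow, one_mul]

theorem cast_twist (i t : ℕ) : (twist i t : ComputationRing) = invol ^ i * t := by
  change ((t <<< (27 * (i % 2)) : ℕ) : ComputationRing) = _
  rw [Nat.shiftLeft_eq, pow_mul, Nat.cast_mul, Nat.cast_pow, ← invol, invol_pow_mod_two, mul_comm]

/-- The shifted Möbius function at the odd number `2 * i + 1`. -/
def shiftedMoebius (i : ℕ) : ℕ := (ArithmeticFunction.moebius (2 * i + 1) + 1).toNat

theorem coe_shiftedMoebius (i : ℕ) :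
    (shiftedMoebius i : ℤ) = ArithmeticFunction.moebius (2 * i + 1) + 1 := by
  have := (abs_le.1 (ArithmeticFunction.abs_moebius_le_one (n := 2 * i + 1))).1
  exact Int.toNat_of_nonneg (by lia)

theorem shiftedMoebius_le_two (i : ℕ) : shiftedMoebius i ≤ 2 := by
  have h := coe_shiftedMoebius i
  have := (abs_le.1 (ArithmeticFunction.abs_moebius_le_one (n := 2 * i + 1))).2
  lia

/-- The contribution of the numbers congruent to `1` modulo `4`. -/
def sumOne (w : ℕ) : ℕ :=
  ∑ i ∈ Finset.range ((w + 1) / 2), if i % 2 = 0 then shiftedMoebius i else 0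

/-- The contribution of the numbers congruent to `3` modulo `4`. -/
def sumThree (w : ℕ) : ℕ :=
  ∑ i ∈ Finset.range ((w + 1) / 2), if i % 2 = 0 then 0 else shiftedMoebius i

/-- Both contributions packed into a single number. -/
def sumPacked (w : ℕ) : ℕ := sumOne w + 134217728 * sumThree w

theorem sumOne_le (w : ℕ) : sumOne w ≤ w + 1 := by
  have : sumOne w ≤ ∑ i ∈ Finset.range ((w + 1) / 2), 2 := Finset.sum_le_sum fun i _ => by
    split_ifs
    exacts [shiftedMoebius_le_two i, Nat.zero_le 2]
  rw [Finset.sum_const, Finset.card_range, smul_eq_mul] at this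
  lia

theorem sumThree_le (w : ℕ) : sumThree w ≤ w + 1 := by
  have : sumThree w ≤ ∑ i ∈ Finset.range ((w + 1) / 2), 2 := Finset.sum_le_sum fun i _ => by
    split_ifs
    exacts [Nat.zero_le 2, shiftedMoebius_le_two i]
  rw [Finset.sum_const, Finset.card_range, smul_eq_mul] at this
  lia

theorem cast_sumPacked (w : ℕ) : (sumPacked w : ComputationRing) =
    ∑ i ∈ Finset.range ((w + 1) / 2), (shiftedMoebius i : ComputationRing) * invol ^ i := by
  rw [sumPacked, sumOne, sumThree, Nat.cast_add, Nat.cast_mul, Nat.cast_sum, Nat.cast_sum,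
    Finset.mul_sum, ← Finset.sum_add_distrib]
  refine Finset.sum_congr rfl fun i _ => ?_
  rw [← invol_pow_mod_two]
  rcases Nat.mod_two_eq_zero_or_one i with h | h
  · simp [h]
  · simp [h, invol, mul_comm]

theorem sumPacked_lt {w : ℕ} (hw : w < 67108864) : sumPacked w < 18014398509481983 := by
  have h1 := sumOne_le w
  have h2 := sumThree_le w
  rw [sumPacked]
  lia

theorem eq_of_cast_eq {m n : ℕ} (hm : m < 18014398509481983) (hn : n < 18014398509481983)
    (h : (m : ComputationRing) = n) : m = n := by
  rw [ZMod.natCast_eq_natCast_iff] at h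
  exact Nat.ModEq.eq_of_lt_of_lt h hm hn

theorem smallQ_eq {w : ℕ} (h1 : 1 ≤ w) (hw : w < 65536) : smallQ w = sumPacked w := by
  have hd : ∀ i, moebDigit i < 2 ^ 27 := fun i => (moebDigit_le_two i).trans_lt (by norm_num)
  refine eq_of_cast_eq (Nat.mod_lt _ (by norm_num)) (sumPacked_lt (by lia)) ?_
  obtain ⟨i, hi⟩ : ∃ i, i = (w - 1) / 2 := ⟨_, rfl⟩
  have hp : fullPack = horner 27 moebDigit (i + 1 + (32767 - i)) := by
    rw [fullPack, pack_eq_horner, show i + 1 + (32767 - i) = 2 ^ 15 by lia]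
    simp only [zero_add]
  change ((twist ((w - 1) / 2) (splitLook 4 fullPack ((w - 1) / 2)) % 18014398509481983 : ℕ) :
    ComputationRing) = _
  rw [← hi, ZMod.natCast_mod, cast_twist, splitLook_eq 4 _ _ (by lia), ZMod.natCast_mod, hp,
    show 2048 * 2 ^ 4 - 1 - i = 32767 - i by lia, horner_div hd, cast_sumPacked,
    show (w + 1) / 2 = i + 1 by lia]
  have hc := cast_horner (e := invol) rfl invol_mul_invol moebDigit (i + 1)
  rw [pow_succ, pow_succ, mul_assoc (invol ^ i), invol_mul_invol, mul_one] at hc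
  rw [hc]
  refine Finset.sum_congr rfl fun j hj => ?_
  rw [Finset.mem_range] at hj
  congr 2
  have h := moebDigit_eq (i := j) (by lia)
  rw [← coe_shiftedMoebius] at h
  exact_mod_cast h

theorem binSum_eq (f : ℕ → ℕ) (k lo n : ℕ) :
    binSum f k lo n = ∑ i ∈ Finset.range n, f (lo + i) := by
  induction k generalizing lo n with
  | zero =>
    induction n with
    | zero => rfl
    | succ n ih =>
      rw [Finset.sum_range_succ, ← ih]
      rfl
  | succ k ih =>
    change binSum f k lo (n / 2) + binSum f k (lo + n / 2) (n - n / 2) = _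
    rw [ih, ih]
    conv_rhs => rw [show n = n / 2 + (n - n / 2) by lia, Finset.sum_range_add]
    simp only [add_assoc]

theorem isqrt_eq (v : ℕ) : isqrt v = Nat.sqrt v := by
  have key : ∀ s, isqrtAux v s = Nat.sqrt v := by
    intro s
    change @Bool.rec (fun _ => ℕ) (Nat.sqrt v) s
      (Nat.ble (s * s) v && Nat.ble (v + 1) ((s + 1) * (s + 1))) = _
    cases h : (Nat.ble (s * s) v && Nat.ble (v + 1) ((s + 1) * (s + 1)))
    · rfl
    · rw [Bool.and_eq_true, Nat.ble_eq, Nat.ble_eq] at h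
      exact Nat.eq_sqrt.2 h
  exact key _

theorem cast_cntX (w : ℕ) :
    (cntX w : ComputationRing) = ∑ i ∈ Finset.range ((w + 1) / 2), invol ^ i := by
  have key : ∀ t : ℕ, ∑ i ∈ Finset.range t, invol ^ i =
      (((t + 1) / 2 : ℕ) : ComputationRing) + invol * ((t / 2 : ℕ) : ComputationRing) := by
    intro t
    induction t with
    | zero => simp
    | succ t ih =>
      rw [Finset.sum_range_succ, ih, ← invol_pow_mod_two]
      rcases Nat.mod_two_eq_zero_or_one t with h | h
      · rw [h, show (t + 1 + 1) / 2 = (t + 1) / 2 + 1 by lia, show (t + 1) / 2 = t / 2 by lia]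
        push_cast
        ring
      · rw [h, show (t + 1 + 1) / 2 = (t + 1) / 2 by lia, show (t + 1) / 2 = t / 2 + 1 by lia]
        push_cast
        ring
  rw [key]
  change (((w + 3) / 4 + 2 ^ 27 * ((w + 1) / 4) : ℕ) : ComputationRing) = _
  rw [Nat.cast_add, Nat.cast_mul, invol, show ((w + 1) / 2 + 1) / 2 = (w + 3) / 4 by lia,
    show (w + 1) / 2 / 2 = (w + 1) / 4 by lia]

theorem sumPacked_recurrence {v : ℕ} (hv : 1 ≤ v) :
    (sumPacked v : ComputationRing) = 1 - ∑ i ∈ Finset.range ((v.sqrt - 1) / 2), invol ^ (1 + i) *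
      ((sumPacked (v / (2 * (1 + i) + 1)) : ComputationRing) +
        (((ArithmeticFunction.moebius (2 * (1 + i) + 1) : ℤ) : ComputationRing) - 1) *
          (cntX (v / (2 * (1 + i) + 1)) : ComputationRing)) +
      (cntX v.sqrt : ComputationRing) *
        ((sumPacked v.sqrt : ComputationRing) - (cntX v.sqrt : ComputationRing)) := by
  let ψ : ℕ → ComputationRing := fun n => if n % 2 = 0 then 0 else invol ^ (n / 2)
  have hψ : ∀ n, n % 2 = 0 → ψ n = 0 := fun n h => if_pos h
  have hψ' : ∀ i, ψ (2 * i + 1) = invol ^ i := fun i => by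
    simp only [ψ]
    rw [if_neg (by lia), show (2 * i + 1) / 2 = i by lia]
  have hψ1 : ψ 1 = 1 := (hψ' 0).trans (pow_zero _)
  have hmul : ∀ a b, ψ (a * b) = ψ a * ψ b := by
    intro a b
    rcases Nat.mod_two_eq_zero_or_one a with ha | ha
    · rw [hψ a ha, hψ _ (by rw [Nat.mul_mod, ha, zero_mul, Nat.zero_mod]), zero_mul]
    rcases Nat.mod_two_eq_zero_or_one b with hb | hb
    · rw [hψ b hb, hψ _ (by rw [Nat.mul_mod, hb, mul_zero, Nat.zero_mod]), mul_zero]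
    · obtain ⟨i, rfl⟩ : ∃ i, a = 2 * i + 1 := ⟨a / 2, by lia⟩
      obtain ⟨j, rfl⟩ : ∃ j, b = 2 * j + 1 := ⟨b / 2, by lia⟩
      rw [show (2 * i + 1) * (2 * j + 1) = 2 * (2 * (i * j) + (i + j)) + 1 by ring, hψ', hψ', hψ',
        pow_add, pow_mul, sq, invol_mul_invol, one_pow, one_mul, pow_add]
  let f : ℕ → ComputationRing := fun n =>
    ((ArithmeticFunction.moebius n : ℤ) : ComputationRing) * ψ n
  have hf : ∀ n, n % 2 = 0 → f n = 0 := fun n h => by simp only [f, hψ n h, mul_zero]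
  have hX : ∀ w, ∑ n ∈ Finset.Icc 1 w, ψ n = (cntX w : ComputationRing) := by
    intro w
    rw [sum_Icc_eq_sum_odd hψ, cast_cntX]
    exact Finset.sum_congr rfl fun i _ => hψ' i
  have hP : ∀ w, ∑ n ∈ Finset.Icc 1 w, f n =
      (sumPacked w : ComputationRing) - (cntX w : ComputationRing) := by
    intro w
    rw [sum_Icc_eq_sum_odd hf, cast_cntX, cast_sumPacked, ← Finset.sum_sub_distrib]
    refine Finset.sum_congr rfl fun i _ => ?_
    have h := congrArg (Int.cast (R := ComputationRing)) (coe_shiftedMoebius i)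
    rw [Int.cast_natCast, Int.cast_add, Int.cast_one] at h
    simp only [f]
    rw [hψ', h]
    ring
  have hone : ∑ n ∈ Finset.Icc 1 v, ∑ p ∈ n.divisorsAntidiagonal, f p.1 * ψ p.2 = 1 := by
    have : ∀ n ∈ Finset.Icc 1 v, ∑ p ∈ n.divisorsAntidiagonal, f p.1 * ψ p.2 =
        if n = 1 then 1 else 0 := by
      intro n hn
      have h1 : ∀ p ∈ n.divisorsAntidiagonal, f p.1 * ψ p.2 =
          ψ n * ((ArithmeticFunction.moebius p.1 : ℤ) : ComputationRing) := fun p hp => by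
        rw [← (Nat.mem_divisorsAntidiagonal.1 hp).1, hmul]
        simp only [f]
        ring
      have h2 := congrArg (fun F : ArithmeticFunction ℤ => F n)
        ArithmeticFunction.moebius_mul_coe_zeta
      simp only [ArithmeticFunction.coe_mul_zeta_apply] at h2
      rw [Finset.sum_congr rfl h1, ← Finset.mul_sum,
        Nat.sum_divisorsAntidiagonal (fun d _ => ((ArithmeticFunction.moebius d : ℤ) :
          ComputationRing)), ← Int.cast_sum, h2, ArithmeticFunction.one_apply]
      split_ifs with h
      · subst h
        rw [hψ1, Int.cast_one, mul_one]
      · simp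
    rw [Finset.sum_congr rfl this, Finset.sum_ite_eq', if_pos (Finset.mem_Icc.2 ⟨le_rfl, hv⟩)]
  have hs : 1 ≤ v.sqrt := Nat.sqrt_pos.2 hv
  rw [sum_divisorsAntidiagonal_hyperbola, hX, hP] at hone
  simp only [hX, hP] at hone
  rw [sum_Icc_eq_sum_odd (fun n h => by rw [hf n h, zero_mul]),
    sum_Icc_eq_sum_odd (fun n h => by rw [hψ n h, zero_mul]), ← Finset.sum_add_distrib,
    show (v.sqrt + 1) / 2 = (v.sqrt - 1) / 2 + 1 by lia, Finset.sum_range_succ'] at hone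
  simp only [f, hψ', hψ1, mul_zero, zero_add, Nat.div_one, one_mul,
    ArithmeticFunction.moebius_apply_one, Int.cast_one] at hone
  have hsum : ∑ i ∈ Finset.range ((v.sqrt - 1) / 2), invol ^ (1 + i) *
      ((sumPacked (v / (2 * (1 + i) + 1)) : ComputationRing) +
        (((ArithmeticFunction.moebius (2 * (1 + i) + 1) : ℤ) : ComputationRing) - 1) *
          (cntX (v / (2 * (1 + i) + 1)) : ComputationRing)) = _ :=
    Finset.sum_congr rfl fun i _ => by rw [add_comm 1 i]
  rw [hsum]
  have hsum' := Finset.sum_congr (rfl : Finset.range ((v.sqrt - 1) / 2) = _) fun i _ =>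
    show ((ArithmeticFunction.moebius (2 * (i + 1) + 1) : ℤ) : ComputationRing) *
      invol ^ (i + 1) * (cntX (v / (2 * (i + 1) + 1)) : ComputationRing) + invol ^ (i + 1) *
      ((sumPacked (v / (2 * (i + 1) + 1)) : ComputationRing) -
        (cntX (v / (2 * (i + 1) + 1)) : ComputationRing)) = invol ^ (i + 1) *
      ((sumPacked (v / (2 * (i + 1) + 1)) : ComputationRing) +
        (((ArithmeticFunction.moebius (2 * (i + 1) + 1) : ℤ) : ComputationRing) - 1) *
          (cntX (v / (2 * (i + 1) + 1)) : ComputationRing)) by ring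
  rw [hsum'] at hone
  linear_combination hone

theorem cast_modulus_sub_one : ((18014398509481982 : ℕ) : ComputationRing) = -1 := by
  rw [eq_neg_iff_add_eq_zero, ← Nat.cast_one, ← Nat.cast_add, ZMod.natCast_eq_zero_iff]

theorem cast_smallMoeb_add {i : ℕ} (hi : i < 4096) (c : ℕ) :
    ((smallMoeb i + c : ℕ) : ComputationRing) =
      ((ArithmeticFunction.moebius (2 * i + 1) : ℤ) : ComputationRing) + 1 + c := by
  have h := congrArg (Int.cast (R := ComputationRing)) (smallMoeb_eq hi)
  rw [Int.cast_natCast, Int.cast_add, Int.cast_one] at h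
  rw [Nat.cast_add, h]

theorem lookup_eq_of_lt {x A m b : ℕ} (h : A < b) : lookup x A m b = smallQ (x / b) := by
  change @Bool.rec (fun _ => ℕ) (smallQ (x / b)) _ (Nat.ble b A) = _
  rw [Bool.eq_false_iff.2 fun h' => h.not_ge (Nat.le_of_ble_eq_true h')]

theorem lookup_eq_of_le {x A m b : ℕ} (h : b ≤ A) :
    lookup x A m b = m / 2 ^ (54 * ((A - b) / 2)) % 2 ^ 54 := by
  change @Bool.rec (fun _ => ℕ) _ (m >>> (54 * ((A - b) / 2)) % 2 ^ 54) (Nat.ble b A) = _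
  rw [Nat.ble_eq_true_of_le h, Nat.shiftRight_eq_div_pow]

theorem sqrt_le_of_lt {v : ℕ} (hv : v < 67108864) : v.sqrt ≤ 8191 :=
  Nat.le_of_lt_succ (Nat.sqrt_lt.2 hv)

theorem le_of_mem_range_sqrt {v i : ℕ} (hi : i < (v.sqrt - 1) / 2) : 2 * (1 + i) + 1 ≤ v :=
  le_trans (by lia) (Nat.sqrt_le_self v)

theorem leaf_eq (x A m a i : ℕ) : leaf x A m a i = twist i (lookup x A m (a * (2 * i + 1)) +
    (smallMoeb i + 18014398509481981) * cntX (x / (a * (2 * i + 1)))) := rfl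

theorem entryS_eq (x A m a s : ℕ) : entryS x A m a s = (1 + 18014398509481982 *
    binSum (leaf x A m a) (Nat.log2 ((s - 1) / 2)) 1 ((s - 1) / 2) +
    cntX s * (smallQ s + 18014398509481982 * cntX s)) % 18014398509481983 := rfl

theorem entry_eq {x A m a : ℕ} (hx : x < 67108864) (ha : 1 ≤ a) (hax : a ≤ x)
    (hlook : ∀ i, 1 ≤ i → a * (2 * i + 1) ≤ x →
      lookup x A m (a * (2 * i + 1)) = sumPacked (x / (a * (2 * i + 1)))) :
    entry x A m a = sumPacked (x / a) := by
  have hv1 : 1 ≤ x / a := (Nat.one_le_div_iff ha).2 hax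
  have hv2 : x / a < 67108864 := (Nat.div_le_self x a).trans_lt hx
  have hs := sqrt_le_of_lt hv2
  have hs1 : 1 ≤ (x / a).sqrt := Nat.sqrt_pos.2 hv1
  rw [show entry x A m a = entryS x A m a (isqrt (x / a)) from rfl, isqrt_eq, entryS_eq]
  refine eq_of_cast_eq (Nat.mod_lt _ (by norm_num)) (sumPacked_lt hv2) ?_
  rw [ZMod.natCast_mod, sumPacked_recurrence hv1, binSum_eq, smallQ_eq hs1 (by lia)]
  simp only [Nat.cast_add, Nat.cast_mul, cast_modulus_sub_one, Nat.cast_sum, Nat.cast_one]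
  have hsum : ∑ i ∈ Finset.range (((x / a).sqrt - 1) / 2),
      (leaf x A m a (1 + i) : ComputationRing) =
      ∑ i ∈ Finset.range (((x / a).sqrt - 1) / 2), invol ^ (1 + i) *
        ((sumPacked (x / a / (2 * (1 + i) + 1)) : ComputationRing) +
          (((ArithmeticFunction.moebius (2 * (1 + i) + 1) : ℤ) : ComputationRing) - 1) *
            (cntX (x / a / (2 * (1 + i) + 1)) : ComputationRing)) :=
    Finset.sum_congr rfl fun i hi => by
      rw [Finset.mem_range] at hi
      have hle := (Nat.le_div_iff_mul_le (by lia)).1 (le_of_mem_range_sqrt hi)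
      have h2 : ((18014398509481981 : ℕ) : ComputationRing) = -2 := by
        have h := cast_modulus_sub_one
        rw [show 18014398509481982 = 18014398509481981 + 1 from rfl, Nat.cast_succ] at h
        linear_combination h
      rw [leaf_eq, cast_twist, hlook (1 + i) (by lia) (by rwa [mul_comm]), Nat.cast_add,
        Nat.cast_mul, cast_smallMoeb_add (by lia), ← Nat.div_div_eq_div_mul, h2]
      ring
  rw [hsum]
  ring

/-- The first `k` entries of the table have been computed correctly. -/
def MemoCorrect (x A k m : ℕ) : Prop :=
  m < 2 ^ (54 * k) ∧ ∀ i < k, m / 2 ^ (54 * i) % 2 ^ 54 = sumPacked (x / (A - 2 * i))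

theorem MemoCorrect.lookup_eq {x A k m : ℕ} (h : MemoCorrect x A k m) (hA : A % 2 = 1)
    (hxA : x / (A + 1) < 65536) {b : ℕ} (hb : b % 2 = 1) (hbx : b ≤ x) (hk : A < b + 2 * k) :
    lookup x A m b = sumPacked (x / b) := by
  rcases le_or_gt b A with hbA | hbA
  · rw [lookup_eq_of_le hbA, h.2 _ (by lia), show A - 2 * ((A - b) / 2) = b by lia]
  · rw [lookup_eq_of_lt hbA]
    refine smallQ_eq ((Nat.one_le_div_iff (by lia)).2 hbx) ?_
    exact (Nat.div_le_div_left hbA (by lia)).trans_lt hxA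

theorem MemoCorrect.succ {x A k m : ℕ} (h : MemoCorrect x A k m) (hA : A % 2 = 1)
    (hxA : x / (A + 1) < 65536) (hx : x < 67108864) (hAx : A ≤ x) (hk : 2 * k < A) :
    MemoCorrect x A (k + 1) (m + entry x A m (A - 2 * k) <<< (54 * k)) := by
  have hE : entry x A m (A - 2 * k) = sumPacked (x / (A - 2 * k)) :=
    entry_eq hx (by lia) (by lia) fun i hi hix => h.lookup_eq hA hxA
      (by rw [Nat.mul_mod, show (A - 2 * k) % 2 = 1 by lia, show (2 * i + 1) % 2 = 1 by lia]) hix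
      (by nlinarith [Nat.sub_add_cancel hk.le])
  have hlt : sumPacked (x / (A - 2 * k)) < 2 ^ 54 :=
    (sumPacked_lt ((Nat.div_le_self _ _).trans_lt hx)).trans (by norm_num)
  rw [hE, Nat.shiftLeft_eq]
  constructor
  · rw [Nat.mul_succ, pow_add]
    have h1 := h.1
    have h2 := Nat.mul_le_mul_right (2 ^ (54 * k)) hlt
    rw [Nat.succ_mul] at h2
    lia
  · intro i hi
    rcases Nat.lt_succ_iff_lt_or_eq.1 hi with hi | rfl
    · rw [← h.2 i hi, show 54 * k = 54 * (k - i - 1) + 54 + 54 * i by lia, pow_add, ← mul_assoc,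
        Nat.add_mul_div_right _ _ (by positivity), pow_add, ← mul_assoc, Nat.add_mul_mod_self_right]
    · rw [Nat.add_mul_div_right _ _ (by positivity), Nat.div_eq_of_lt h.1, zero_add,
        Nat.mod_eq_of_lt hlt]

theorem memo_succ (x A n k m : ℕ) : memo x A (n + 1) k m =
    memo x A n (k + 1) (m + entry x A m (A - 2 * k) <<< (54 * k)) := by
  change @Bool.rec (fun _ => ℕ) _ _ (Nat.beq m (0 * k)) = _
  cases Nat.beq m (0 * k) <;> rfl

theorem memoCorrect_memo {x A : ℕ} (hA : A % 2 = 1) (hxA : x / (A + 1) < 65536)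
    (hx : x < 67108864) (hAx : A ≤ x) {n k m : ℕ} (h : MemoCorrect x A k m)
    (hk : 2 * (k + n) ≤ A + 1) : MemoCorrect x A (k + n) (memo x A n k m) := by
  induction n generalizing k m with
  | zero => exact h
  | succ n ih =>
    rw [memo_succ, show k + (n + 1) = k + 1 + n by lia]
    exact ih (h.succ hA hxA hx hAx (by lia)) (by lia)

theorem cast_partOne {w : ℕ} (hw : w < 67108864) :
    (partOne (sumPacked w) w : ComputationRing) = ∑ i ∈ Finset.range ((w + 1) / 2),
      if i % 2 = 0 then ((ArithmeticFunction.moebius (2 * i + 1) : ℤ) : ComputationRing) else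
          0 := by
  have hmod : sumPacked w % 134217728 = sumOne w := by
    have := sumOne_le w
    rw [sumPacked]
    lia
  change ((sumPacked w % 134217728 + 18014398509481982 * ((w + 3) / 4) : ℕ) : ComputationRing) = _
  have hcard : ∀ t : ℕ, ∑ i ∈ Finset.range t, (if i % 2 = 0 then (1 : ComputationRing) else 0) =
      (((t + 1) / 2 : ℕ) : ComputationRing) := by
    intro t
    induction t with
    | zero => simp
    | succ t ih =>
      rw [Finset.sum_range_succ, ih]
      split_ifs with h
      · rw [show (t + 1 + 1) / 2 = (t + 1) / 2 + 1 by lia, Nat.cast_succ]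
      · rw [show (t + 1 + 1) / 2 = (t + 1) / 2 by lia, add_zero]
  rw [hmod, Nat.cast_add, Nat.cast_mul, cast_modulus_sub_one, neg_one_mul, ← sub_eq_add_neg,
    show (w + 3) / 4 = ((w + 1) / 2 + 1) / 2 by lia, ← hcard, sumOne, Nat.cast_sum,
    ← Finset.sum_sub_distrib]
  refine Finset.sum_congr rfl fun i _ => ?_
  split_ifs
  · rw [← Int.cast_natCast, coe_shiftedMoebius, Int.cast_add, Int.cast_one, add_sub_cancel_right]
  · rw [Nat.cast_zero, sub_zero]

theorem cast_partThree {w : ℕ} (hw : w < 67108864) :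
    (partThree (sumPacked w) w : ComputationRing) = ∑ i ∈ Finset.range ((w + 1) / 2),
      if i % 2 = 0 then 0 else ((ArithmeticFunction.moebius (2 * i + 1) : ℤ) :
          ComputationRing) := by
  have hdiv : sumPacked w / 134217728 = sumThree w := by
    have := sumOne_le w
    rw [sumPacked]
    lia
  change ((sumPacked w / 134217728 + 18014398509481982 * ((w + 1) / 4) : ℕ) : ComputationRing) = _
  have hcard : ∀ t : ℕ, ∑ i ∈ Finset.range t, (if i % 2 = 0 then (0 : ComputationRing) else 1) =
      ((t / 2 : ℕ) : ComputationRing) := by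
    intro t
    induction t with
    | zero => simp
    | succ t ih =>
      rw [Finset.sum_range_succ, ih]
      split_ifs with h
      · rw [show (t + 1) / 2 = t / 2 by lia, add_zero]
      · rw [show (t + 1) / 2 = t / 2 + 1 by lia, Nat.cast_succ]
  rw [hdiv, Nat.cast_add, Nat.cast_mul, cast_modulus_sub_one, neg_one_mul, ← sub_eq_add_neg,
    show (w + 1) / 4 = (w + 1) / 2 / 2 by lia, ← hcard, sumThree, Nat.cast_sum,
    ← Finset.sum_sub_distrib]
  refine Finset.sum_congr rfl fun i _ => ?_
  split_ifs
  · rw [Nat.cast_zero, sub_zero]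
  · rw [← Int.cast_natCast, coe_shiftedMoebius, Int.cast_add, Int.cast_one, add_sub_cancel_right]

theorem oddMoebius_odd (i : ℕ) :
    oddMoebius (2 * i + 1) = ArithmeticFunction.moebius (2 * i + 1) := if_neg (by lia)

theorem twistedMoebius_odd (i : ℕ) : twistedMoebius (2 * i + 1) =
    if i % 2 = 0 then ArithmeticFunction.moebius (2 * i + 1)
    else -ArithmeticFunction.moebius (2 * i + 1) := by
  rw [twistedMoebius, ZMod.χ₄_nat_eq_if_mod_four, if_neg (by lia)]
  split_ifs
  · rw [mul_one]
  · lia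
  · lia
  · rw [mul_neg_one]

theorem cast_sum_oddMoebius {w : ℕ} (hw : w < 67108864) :
    ∑ n ∈ Finset.Icc 1 w, ((oddMoebius n : ℤ) : ComputationRing) =
      (partOne (sumPacked w) w : ComputationRing) +
          (partThree (sumPacked w) w : ComputationRing) := by
  rw [sum_Icc_eq_sum_odd (fun n h => by rw [oddMoebius, if_pos h, Int.cast_zero]),
    cast_partOne hw, cast_partThree hw, ← Finset.sum_add_distrib]
  refine Finset.sum_congr rfl fun i _ => ?_
  rw [oddMoebius_odd]
  split_ifs
  · rw [add_zero]
  · rw [zero_add]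

theorem cast_sum_twistedMoebius {w : ℕ} (hw : w < 67108864) :
    ∑ n ∈ Finset.Icc 1 w, ((twistedMoebius n : ℤ) : ComputationRing) =
      (partOne (sumPacked w) w : ComputationRing) -
          (partThree (sumPacked w) w : ComputationRing) := by
  rw [sum_Icc_eq_sum_odd (fun n h => by rw [twistedMoebius_of_even h, Int.cast_zero]),
    cast_partOne hw, cast_partThree hw, ← Finset.sum_sub_distrib]
  refine Finset.sum_congr rfl fun i _ => ?_
  rw [twistedMoebius_odd]
  split_ifs
  · rw [sub_zero]
  · rw [zero_sub, Int.cast_neg]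

theorem cast_signedPart (i q w : ℕ) : (signedPart i q w : ComputationRing) =
    if i % 2 = 0 then 2 * (partOne q w : ComputationRing)
    else -2 * (partThree q w : ComputationRing) := by
  change ((@Nat.rec (fun _ => ℕ) (2 * partOne q w)
    (fun _ _ => 2 * 18014398509481982 * partThree q w) (i % 2) : ℕ) : ComputationRing) = _
  rcases Nat.mod_two_eq_zero_or_one i with h | h
  · rw [h, if_pos rfl]
    change ((2 * partOne q w : ℕ) : ComputationRing) = _
    rw [Nat.cast_mul, Nat.cast_two]
  · rw [h, if_neg one_ne_zero]
    change ((2 * 18014398509481982 * partThree q w : ℕ) : ComputationRing) = _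
    rw [Nat.cast_mul, Nat.cast_mul, cast_modulus_sub_one, Nat.cast_two]
    ring

theorem oddSumS_eq (x A m s : ℕ) : oddSumS x A m s =
    binSum (oddLeaf x A m) (Nat.log2 ((s + 1) / 2)) 0 ((s + 1) / 2) + 18014398509481982 *
      ((partOne (smallQ s) s + partThree (smallQ s) s) *
        (partOne (smallQ s) s + 18014398509481982 * partThree (smallQ s) s)) := rfl

theorem oddLeaf_eq (x A m i : ℕ) : oddLeaf x A m i = (smallMoeb i + 18014398509481982) *
    signedPart i (lookup x A m (2 * i + 1)) (x / (2 * i + 1)) := rfl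

theorem cast_oddSum {x A n : ℕ} (hA : A % 2 = 1) (hxA : x / (A + 1) < 65536) (hx : x < 67108864)
    (hAx : A ≤ x) (hn : 2 * n = A + 1) :
    (oddSum x A n : ComputationRing) = ((oddMertens x : ℤ) : ComputationRing) := by
  have hmemo : MemoCorrect x A (0 + n) (memo x A n 0 0) :=
    memoCorrect_memo hA hxA hx hAx ⟨by simp, by simp⟩ (by lia)
  have hs := sqrt_le_of_lt hx
  have hs1 : 1 ≤ x.sqrt := Nat.sqrt_pos.2 (by lia)
  have hsx := Nat.sqrt_le_self x
  have hdiv : ∀ j, x / j < 67108864 := fun j => (Nat.div_le_self x j).trans_lt hx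
  rw [oddMertens]
  push_cast
  rw [sum_divisorsAntidiagonal_hyperbola (fun n => ((oddMoebius n : ℤ) : ComputationRing))
      (fun n => ((twistedMoebius n : ℤ) : ComputationRing)), cast_sum_oddMoebius (by lia),
    cast_sum_twistedMoebius (by lia)]
  simp only [cast_sum_oddMoebius (hdiv _), cast_sum_twistedMoebius (hdiv _)]
  rw [sum_Icc_eq_sum_odd (fun n h => by rw [oddMoebius, if_pos h, Int.cast_zero, zero_mul]),
    sum_Icc_eq_sum_odd (fun n h => by rw [twistedMoebius_of_even h, Int.cast_zero, zero_mul]),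
    ← Finset.sum_add_distrib, oddSum, isqrt_eq, oddSumS_eq, binSum_eq, smallQ_eq hs1 (by lia)]
  have hsum : ∀ i ∈ Finset.range ((x.sqrt + 1) / 2),
      (oddLeaf x A (memo x A n 0 0) (0 + i) : ComputationRing) =
      ((oddMoebius (2 * i + 1) : ℤ) : ComputationRing) *
        ((partOne (sumPacked (x / (2 * i + 1))) (x / (2 * i + 1)) : ComputationRing) -
          (partThree (sumPacked (x / (2 * i + 1))) (x / (2 * i + 1)) : ComputationRing)) +
      ((twistedMoebius (2 * i + 1) : ℤ) : ComputationRing) *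
        ((partOne (sumPacked (x / (2 * i + 1))) (x / (2 * i + 1)) : ComputationRing) +
          (partThree (sumPacked (x / (2 * i + 1))) (x / (2 * i + 1)) : ComputationRing)) := by
    intro i hi
    rw [Finset.mem_range] at hi
    rw [zero_add, oddLeaf_eq, hmemo.lookup_eq hA hxA (by lia) (by lia) (by lia), Nat.cast_mul,
      cast_smallMoeb_add (by lia), cast_modulus_sub_one, cast_signedPart, oddMoebius_odd,
      twistedMoebius_odd]
    split_ifs
    · ring
    · rw [Int.cast_neg]
      ring
  rw [← Finset.sum_congr rfl hsum]
  simp only [Nat.cast_add, Nat.cast_mul, cast_modulus_sub_one, Nat.cast_sum]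
  ring

theorem computation : Nat.beq (Nat.mod (Nat.add (oddSum 63929149 975 488)
    (Nat.mul 18014398509481982 (oddSum 31964574 487 244))) 18014398509481983) 8786 = true := by
  decide +kernel

theorem sub_eq_of_beq {a b c : ℕ} (h : Nat.beq (Nat.mod (Nat.add a
    (Nat.mul 18014398509481982 b)) 18014398509481983) c = true) :
    (a : ComputationRing) - b = c := by
  have h := Nat.eq_of_beq_eq_true h
  change (a + 18014398509481982 * b) % 18014398509481983 = c at h
  rw [← h, ZMod.natCast_mod, Nat.cast_add, Nat.cast_mul, cast_modulus_sub_one]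
  ring

theorem cast_oddMertens_sub : ((oddMertens 63929149 - oddMertens 31964574 : ℤ) :
    ComputationRing) = ((8786 : ℕ) : ComputationRing) := by
  rw [← sub_eq_of_beq computation, Int.cast_sub,
    cast_oddSum (by norm_num) (by norm_num) (by norm_num) (by norm_num) (by norm_num),
    cast_oddSum (by norm_num) (by norm_num) (by norm_num) (by norm_num) (by norm_num)]

theorem oddMertens_sub_eq (h : |oddMertens 63929149 - oddMertens 31964574| ≤ 10000) :
    oddMertens 63929149 - oddMertens 31964574 = 8786 := by
  have h1 := cast_oddMertens_sub
  rw [← Int.cast_natCast, ZMod.intCast_eq_intCast_iff] at h1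
  have h2 := h1.dvd
  rw [abs_le] at h
  push_cast at h2
  lia

end GaussianMertens

theorem FormSystem.false_of_discr_eq_neg_four {ι : Type} [Fintype ι] {a c : ℕ → ℝ} {w : ℕ}
    (F : FormSystem ι a (-4) w)
    (P : ZetaPair a c (√(-(-4) : ℤ) / (2 * Real.pi)) (Fintype.card ι / w))
    (hac : ∀ n, n ≠ 0 → ∑ p ∈ n.divisorsAntidiagonal, a p.1 * c p.2 = if n = 1 then 1 else 0)
    (hlim : ∀ ε > 0, ∃ N : ℕ, ∀ n, N ≤ n → |∑ k ∈ Finset.Icc 1 n, c k| ≤ (1 + ε) * √n) :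
    False := by
  have hw := F.w_eq_four P.a_one
  have hN : (1 : ℕ) ≤ 63929149 := by norm_num
  have hpi3 := Real.pi_gt_three
  have hpi4 := Real.pi_lt_four
  have hD : √(-(-4) : ℤ) / (2 * Real.pi) = 1 / Real.pi := by
    rw [show (((-(-4) : ℤ)) : ℝ) = 2 ^ 2 by norm_num, Real.sqrt_sq (by norm_num)]
    field_simp
  rw [hD, F.card_eq_one_of_discr_eq_neg_four, hw] at P
  have hz : 1 / ((1 / Real.pi) ^ 2 * (63929149 : ℕ)) ≤ 1 / 1000000 := by
    rw [div_pow, one_pow, div_mul_eq_mul_div, one_mul, one_div_div, Nat.cast_ofNat,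
      div_le_div_iff₀ (by norm_num) (by norm_num)]
    nlinarith
  have hz0 : 0 ≤ 1 / ((1 / Real.pi) ^ 2 * (63929149 : ℕ)) := by positivity
  have hz1 := hz.trans (by norm_num : (1 : ℝ) / 1000000 ≤ 3 / 2)
  have key := P.abs_sum_sub_tsum_residue_le hlim hN
  have hup := P.tsum_residueTerm_le hN hz1
  have hlow := P.le_tsum_residueTerm hN hz1
  have hζ := P.one_le_zetaNat le_rfl
  set z := 1 / ((1 / Real.pi) ^ 2 * ((63929149 : ℕ) : ℝ))
  have hup' : 1 / (1 / Real.pi) * (z / zetaNat a 2 + z ^ 3 / 97) ≤ 1 := by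
    have h1 : z / zetaNat a 2 ≤ z := div_le_self hz0 hζ
    have h2 : z ^ 3 ≤ z := pow_le_of_le_one hz0 (by linarith) (by norm_num)
    rw [one_div_one_div]
    nlinarith
  have hlow' : 1 / (1 / Real.pi) * (z ^ 2 / 7) ≤ 1 := by
    have h2 : z ^ 2 ≤ z := pow_le_of_le_one hz0 (by linarith) (by norm_num)
    rw [one_div_one_div]
    nlinarith
  have hs : √((63929149 : ℕ) : ℝ) ≤ 7996 := by
    rw [Real.sqrt_le_left (by norm_num)]
    norm_num
  rw [F.sum_eq_oddMertens_sub P.a_one hac, show 63929149 / 2 = 31964574 from rfl, _root_.abs_le]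
    at key
  have hr : -1 / (((1 : ℕ) : ℝ) / (4 : ℕ)) = -4 := by norm_num
  rw [hr] at hup hlow
  generalize ∑' k, residueCoeff a _ _ k / ((63929149 : ℕ) : ℝ) ^ k = T at key hup hlow
  generalize √((63929149 : ℕ) : ℝ) = s at key hs
  have hle : |oddMertens 63929149 - oddMertens 31964574| ≤ 10000 := by
    rw [_root_.abs_le, ← Int.cast_le (R := ℝ), ← Int.cast_le (R := ℝ)]
    rw [Int.cast_sub] at key ⊢
    obtain ⟨key1, key2⟩ := key
    constructor <;> norm_num only [Int.cast_neg, Int.cast_ofNat] <;> linarith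
  rw [GaussianMertens.oddMertens_sub_eq hle] at key
  rw [Int.cast_ofNat] at key
  linarith [key.2]

theorem FormSystem.discr_emod_four {ι : Type} [Fintype ι] {a : ℕ → ℝ} {d : ℤ} {w : ℕ}
    (F : FormSystem ι a d w) : -d % 4 = 0 ∨ -d % 4 = 3 := by
  have h := F.absDiscr_eq F.one
  rw [ReducedForm.absDiscr] at h
  have h1 := Int.sq_mod_four_eq_one_of_odd (x := ((F.form F.one).B : ℤ))
  obtain ⟨k, hk⟩ | hB := Int.even_or_odd ((F.form F.one).B : ℤ)
  · rw [hk] at h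
    have : -d = 4 * ((F.form F.one).A * (F.form F.one).C - k * k) := by linear_combination -h
    lia
  · have h2 := h1 hB
    rw [mul_assoc] at h
    lia

theorem FormSystem.false_of_zetaPair {ι : Type} [Fintype ι] {a c : ℕ → ℝ} {d : ℤ} {w : ℕ}
    (F : FormSystem ι a d w) (hd : d < 0) (hd3 : d ≠ -3)
    (P : ZetaPair a c (√(-d : ℤ) / (2 * Real.pi)) (Fintype.card ι / w))
    (hnat : ∀ n, ∃ m : ℕ, a n = m)
    (hac : ∀ n, n ≠ 0 → ∑ p ∈ n.divisorsAntidiagonal, a p.1 * c p.2 = if n = 1 then 1 else 0)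
    (hlim : ∀ ε > 0, ∃ N : ℕ, ∀ n, N ≤ n → |∑ k ∈ Finset.Icc 1 n, c k| ≤ (1 + ε) * √n) :
    False := by
  have h4 := F.discr_emod_four
  obtain ⟨δ, hδ⟩ := Int.eq_ofNat_of_zero_le (show 0 ≤ -d by lia)
  rw [hδ] at h4
  obtain hlt | rfl | hlt : δ < 4 ∨ δ = 4 ∨ 4 < δ := by lia
  · lia
  · obtain rfl : d = -4 := by lia
    exact F.false_of_discr_eq_neg_four P hac hlim
  · obtain h48 | h49 := Nat.lt_or_ge 48 δ
    · exact F.false_of_large hδ h48 P hac hlim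
    · have h1 := tableCheck_table hlt h49 (by lia)
      rw [F.tableCheck_eq_false hδ hlt h49 P hnat hac hlim] at h1
      exact Bool.false_ne_true h1

theorem exists_idealCount_eq (K : Type) [Field K] [NumberField K] (n : ℕ) :
    ∃ m : ℕ, idealCount K n = m := by
  rw [idealCount]
  split_ifs
  · exact ⟨0, Nat.cast_zero.symm⟩
  · exact ⟨_, rfl⟩

/-- The naïve Mertens-type conjecture is false over every imaginary quadratic field
except `ℚ(√-3)` (the imaginary quadratic field of discriminant `-3`). -/
theorem naive_mertens_false_imaginary_quadratic
    (K : Type) [Field K] [NumberField K]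
    (hdeg : Module.finrank ℚ K = 2)
    (himag : NumberField.discr K < 0)
    (hne : NumberField.discr K ≠ -3) :
    ¬ NaiveMertensConj K := by
  intro h
  obtain ⟨F⟩ := nonempty_formSystem hdeg himag
  exact F.false_of_zetaPair himag hne F.zetaPair (exists_idealCount_eq K)
    (fun n hn => sum_idealCount_mul_moebiusSum hn) fun ε hε => h.exists_abs_sum_le ε hε
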